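/- arXiv:0708.1919 — 2 statements merged into one kernel-verified Lean document; each statement's English description precedes it below -/
import Mathlib

section
/- Let C > 0, let κ₁ and κ₂ be kernels taking values in [0,C], and let t ≥ 1 be an odd integer. Suppose that s(Sub_t(F), κ₁) = s(Sub_t(F), κ₂) for every finite simple graph F. Then κ₁ ∼ κ₂. -/
open MeasureTheory Set Filter
open scoped ENNReal Classical

noncomputable section

/-- The (0-based) index of the subinterval `((i)/n, (i+1)/n]` of `[0,1]` containing `x`. -/
def idx (n : ℕ) (x : ℝ) : ℕ := ⌈x * n⌉₊ - 1

/-- The subset of `[0,1]` corresponding to a set of vertices of a graph on `Fin n`: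
the union of the intervals `(i/n, (i+1)/n]` for `i ∈ X` (vertices `0`-indexed). -/
def vtxSet (n : ℕ) (X : Finset (Fin n)) : Set ℝ :=
  ⋃ i ∈ X, Ioc ((i : ℝ) / n) (((i : ℝ) + 1) / n)

/-- The kernel associated to a graph `G` on `{1,…,n}` and normalizing constant `p`:
it takes the value `1/p` on `((i−1)/n, i/n] × ((j−1)/n, j/n]` whenever `ij ∈ E(G)`,
and `0` elsewhere. -/
def graphKernel {n : ℕ} (p : ℝ) (G : SimpleGraph (Fin n)) : ℝ → ℝ → ℝ := fun x y =>
  if h : x ∈ Ioc (0:ℝ) 1 ∧ y ∈ Ioc (0:ℝ) 1 ∧ idx n x < n ∧ idx n y < n then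
    (if G.Adj ⟨idx n x, h.2.2.1⟩ ⟨idx n y, h.2.2.2⟩ then 1 / p else 0)
  else 0

/-- The cut norm of `W : [0,1]² → ℝ`. -/
def cutNorm (W : ℝ → ℝ → ℝ) : ℝ :=
  sSup {r | ∃ S T : Set ℝ, MeasurableSet S ∧ MeasurableSet T ∧
    S ⊆ Icc 0 1 ∧ T ⊆ Icc 0 1 ∧ r = |∫ q in S ×ˢ T, W q.1 q.2|}

/-- `τ` is a Lebesgue-measure-preserving bijection of `[0,1]`. -/
def MPBij (τ : ℝ → ℝ) : Prop :=
  MeasurePreserving τ (volume.restrict (Icc 0 1)) (volume.restrict (Icc 0 1)) ∧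
    BijOn τ (Icc 0 1) (Icc 0 1)

/-- The cut distance between two kernels. -/
def cutDist (κ₁ κ₂ : ℝ → ℝ → ℝ) : ℝ :=
  sInf {r | ∃ τ : ℝ → ℝ, MPBij τ ∧ r = cutNorm (fun x y => κ₁ x y - κ₂ (τ x) (τ y))}

/-- The number of homomorphisms from `F` to `G`. -/
def homCount {α β : Type*} (F : SimpleGraph α) (G : SimpleGraph β) : ℕ :=
  Nat.card (F →g G)

/-- The number of injective homomorphisms (embeddings) from `F` to `G`. -/
def embCount {α β : Type*} (F : SimpleGraph α) (G : SimpleGraph β) : ℕ :=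
  Nat.card {φ : F →g G // Function.Injective φ}

/-- The number of edges of a graph. -/
def edgeCount {α : Type*} (F : SimpleGraph α) : ℕ := Nat.card F.edgeSet

/-- The normalized homomorphism count `t_p(F,G)`. -/
def tDen {α β : Type*} [Fintype α] [Fintype β] (p : ℝ) (F : SimpleGraph α)
    (G : SimpleGraph β) : ℝ :=
  homCount F G / (p ^ edgeCount F * (Fintype.card β : ℝ) ^ Fintype.card α)

/-- The normalized embedding count `s_p(F,G)`. -/
def sDen {α β : Type*} [Fintype α] [Fintype β] (p : ℝ) (F : SimpleGraph α)
    (G : SimpleGraph β) : ℝ :=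
  embCount F G / (p ^ edgeCount F * ((Fintype.card β).descFactorial (Fintype.card α) : ℝ))

/-- The homomorphism density `s(F,κ)` of a finite graph in a kernel. -/
def homDensity {α : Type*} [Fintype α] (F : SimpleGraph α) (κ : ℝ → ℝ → ℝ) : ℝ :=
  ∫ x in Set.univ.pi (fun _ : α => Icc (0:ℝ) 1),
    ∏ e ∈ F.edgeFinset,
      Sym2.lift ⟨fun i j => (κ (x i) (x j) + κ (x j) (x i)) / 2,
        fun i j => by dsimp only; rw [add_comm (κ (x i) (x j)) (κ (x j) (x i))]⟩ e

/-- The homomorphism density as a lower integral (for possibly unbounded kernels). -/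
def homDensityL {α : Type*} [Fintype α] (F : SimpleGraph α) (κ : ℝ → ℝ → ℝ) : ℝ≥0∞ :=
  ∫⁻ x in Set.univ.pi (fun _ : α => Icc (0:ℝ) 1),
    ∏ e ∈ F.edgeFinset,
      Sym2.lift ⟨fun i j => ENNReal.ofReal ((κ (x i) (x j) + κ (x j) (x i)) / 2),
        fun i j => by dsimp only; rw [add_comm (κ (x i) (x j)) (κ (x j) (x i))]⟩ e

/-- A kernel: a symmetric measurable function `[0,1]² → [0,∞)`. -/
def IsKernel (κ : ℝ → ℝ → ℝ) : Prop :=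
  Measurable (Function.uncurry κ) ∧ (∀ x y, κ x y = κ y x) ∧ ∀ x y, 0 ≤ κ x y

/-- A kernel taking values in `[0,C]`. -/
def IsKernelBdd (κ : ℝ → ℝ → ℝ) (C : ℝ) : Prop :=
  Measurable (Function.uncurry κ) ∧ (∀ x y, κ x y = κ y x) ∧ ∀ x y, κ x y ∈ Icc 0 C

/-- A standard kernel: a symmetric measurable function `[0,1]² → [0,1]`. -/
def IsStdKernel (κ : ℝ → ℝ → ℝ) : Prop := IsKernelBdd κ 1

/-- A doubly stochastic measure: a Borel measure on `[0,1]²` both of whose marginals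
are Lebesgue measure on `[0,1]`. -/
def IsDoublyStochastic (μ : Measure (ℝ × ℝ)) : Prop :=
  μ.map Prod.fst = volume.restrict (Icc 0 1) ∧ μ.map Prod.snd = volume.restrict (Icc 0 1)

/-- The quantity `d_μ(κ₁,κ₂)`. -/
def dMu (μ : Measure (ℝ × ℝ)) (κ₁ κ₂ : ℝ → ℝ → ℝ) : ℝ :=
  sSup {r | ∃ S T : Set (ℝ × ℝ), MeasurableSet S ∧ MeasurableSet T ∧
    S ⊆ Icc 0 1 ×ˢ Icc 0 1 ∧ T ⊆ Icc 0 1 ×ˢ Icc 0 1 ∧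
    r = |∫ w in S ×ˢ T, (κ₁ w.1.1 w.2.1 - κ₂ w.1.2 w.2.2) ∂(μ.prod μ)|}

/-- Equivalence of kernels via a coupling. -/
def KernelEquiv (κ₁ κ₂ : ℝ → ℝ → ℝ) : Prop :=
  ∃ μ : Measure (ℝ × ℝ), IsDoublyStochastic μ ∧
    ∀ᵐ w ∂(μ.prod μ), κ₁ w.1.1 w.2.1 = κ₂ w.1.2 w.2.2

/-- `e_G(A,B)`: the number of ordered pairs `(i,j) ∈ A × B` with `ij ∈ E(G)`. -/
def ePairs {n : ℕ} (G : SimpleGraph (Fin n)) (A B : Finset (Fin n)) : ℕ :=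
  ((A ×ˢ B).filter fun q => G.Adj q.1 q.2).card

/-- The normalized density `d_p(A,B)`. -/
def dDens {n : ℕ} (p : ℝ) (G : SimpleGraph (Fin n)) (A B : Finset (Fin n)) : ℝ :=
  ePairs G A B / (p * A.card * B.card)

/-- A sequence of graphs has density bounded by `C`. -/
def DensityBoundedBy (p : ℕ → ℝ) (G : ∀ n, SimpleGraph (Fin n)) (C : ℝ) : Prop :=
  ∀ ε > (0:ℝ), ∀ δ > (0:ℝ), ∀ᶠ n in atTop, ∀ A B : Finset (Fin n),
    ε * n ≤ A.card → ε * n ≤ B.card → dDens (p n) (G n) A B ≤ C + δ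

/-- The parts of a partition of `Fin n` indexed by `Fin k`, given as a colouring. -/
def fiber {n k : ℕ} (c : Fin n → Fin k) (a : Fin k) : Finset (Fin n) :=
  Finset.univ.filter fun v => c v = a

/-- The finite-type kernel `G/Π` associated to a partition of the vertex set of `G`. -/
def partKernel {n k : ℕ} (p : ℝ) (G : SimpleGraph (Fin n)) (c : Fin n → Fin k) :
    ℝ → ℝ → ℝ := fun x y =>
  if h : x ∈ Ioc (0:ℝ) 1 ∧ y ∈ Ioc (0:ℝ) 1 ∧ idx n x < n ∧ idx n y < n then
    dDens p G (fiber c (c ⟨idx n x, h.2.2.1⟩)) (fiber c (c ⟨idx n y, h.2.2.2⟩))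
  else 0

/-- A partition is weakly `(ε,p)`-regular for `G`. -/
def WeaklyRegular {n k : ℕ} (p ε : ℝ) (G : SimpleGraph (Fin n)) (c : Fin n → Fin k) : Prop :=
  cutNorm (fun x y => graphKernel p G x y - partKernel p G c x y) ≤ ε

/-- `(A,B)` is an `(ε,p)`-regular pair for `G`. -/
def RegPair {n : ℕ} (p ε : ℝ) (G : SimpleGraph (Fin n)) (A B : Finset (Fin n)) : Prop :=
  ∀ A' ⊆ A, ∀ B' ⊆ B, ε * A.card ≤ A'.card → ε * B.card ≤ B'.card →
    |dDens p G A' B' - dDens p G A B| ≤ ε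

/-- An `(ε,p)`-regular partition of `G` into `k` parts. -/
def RegPartition {n k : ℕ} (p ε : ℝ) (G : SimpleGraph (Fin n)) (c : Fin n → Fin k) : Prop :=
  (∀ a : Fin k, (fiber c a).card = n / k ∨ (fiber c a).card = n / k + 1) ∧
  ((Finset.univ.filter (fun q : Fin k × Fin k =>
      q.1 < q.2 ∧ ¬ RegPair p ε G (fiber c q.1) (fiber c q.2))).card : ℝ)
    ≤ ε * ((k : ℝ) * ((k : ℝ) - 1) / 2)

/-- The number of walks `v₀v₁⋯v_ℓ` in `G` with `v_i ∈ X_i` for each `i`. -/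
def walkCount {n ℓ : ℕ} (G : SimpleGraph (Fin n)) (X : Fin (ℓ+1) → Finset (Fin n)) : ℕ :=
  Nat.card {v : Fin (ℓ+1) → Fin n //
    (∀ i, v i ∈ X i) ∧ ∀ i : Fin ℓ, G.Adj (v i.castSucc) (v i.succ)}

/-- `κ(X₀,X₁,…,X_ℓ)`: the kernel analogue of the walk count. -/
def kernelWalk {ℓ : ℕ} (κ : ℝ → ℝ → ℝ) (X : Fin (ℓ+1) → Set ℝ) : ℝ :=
  ∫ x in Set.univ.pi X, ∏ i : Fin ℓ, κ (x i.castSucc) (x i.succ)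

/-- `p_t(u,v)`: the number of paths of length `t` in `G` from `u` to `v`. -/
def pathCount {n : ℕ} (G : SimpleGraph (Fin n)) (t : ℕ) (u v : Fin n) : ℕ :=
  Nat.card {w : Fin (t+1) → Fin n // w 0 = u ∧ w (Fin.last t) = v ∧
    Function.Injective w ∧ ∀ i : Fin t, G.Adj (w i.castSucc) (w i.succ)}

/-- The `i`-th vertex on the `r`-th subdivided edge (from `u r` to `v r`, `ℓ` steps). -/
def pv (ℓ : ℕ) {k m : ℕ} (u v : Fin m → Fin k) (r : Fin m) (i : ℕ) :
    Fin k ⊕ (Fin m × Fin (ℓ - 1)) :=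
  if h0 : i = 0 then Sum.inl (u r)
  else if h : i < ℓ then Sum.inr (r, ⟨i - 1, by omega⟩)
  else Sum.inl (v r)

/-- The `(ℓ−1)`-fold subdivision of the loopless multigraph with `k` vertices and
edges `u r — v r` for `r < m`. -/
def multiSubdiv (ℓ : ℕ) {k m : ℕ} (u v : Fin m → Fin k) :
    SimpleGraph (Fin k ⊕ (Fin m × Fin (ℓ - 1))) :=
  SimpleGraph.fromRel fun a b =>
    ∃ r : Fin m, ∃ i : ℕ, i < ℓ ∧ a = pv ℓ u v r i ∧ b = pv ℓ u v r (i + 1)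

/-- Membership in the family `F_ℓ` of `(ℓ−1)`-fold subdivisions of finite loopless
multigraphs. -/
def InFamilyF (ℓ : ℕ) {N : ℕ} (F : SimpleGraph (Fin N)) : Prop :=
  ∃ (k m : ℕ) (u v : Fin m → Fin k), 1 ≤ k ∧ (∀ r, u r ≠ v r) ∧
    Nonempty (F ≃g multiSubdiv ℓ u v)

/-- The edges of a simple graph on `Fin k`, as ordered pairs `(i,j)` with `i < j`. -/
abbrev edgeIdx {k : ℕ} (F : SimpleGraph (Fin k)) : Type :=
  {q : Fin k × Fin k // q.1 < q.2 ∧ F.Adj q.1 q.2}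

/-- The `i`-th vertex on the subdivision of the edge `e` (`t` steps). -/
def spv (t : ℕ) {k : ℕ} {F : SimpleGraph (Fin k)} (e : edgeIdx F) (i : ℕ) :
    Fin k ⊕ (edgeIdx F × Fin (t - 1)) :=
  if h0 : i = 0 then Sum.inl e.1.1
  else if h : i < t then Sum.inr (e, ⟨i - 1, by omega⟩)
  else Sum.inl e.1.2

/-- The `t`-subdivision `Sub_t(F)` of a simple graph `F`: each edge is replaced by a
path of length `t` through `t−1` new internal vertices. -/
def subdiv (t : ℕ) {k : ℕ} (F : SimpleGraph (Fin k)) :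
    SimpleGraph (Fin k ⊕ (edgeIdx F × Fin (t - 1))) :=
  SimpleGraph.fromRel fun a b =>
    ∃ e : edgeIdx F, ∃ i : ℕ, i < t ∧ a = spv t e i ∧ b = spv t e (i + 1)

/-- The `t`-th power kernel `κ^t`. -/
def kpow (κ : ℝ → ℝ → ℝ) : ℕ → ℝ → ℝ → ℝ
  | 0 => fun _ _ => 0
  | 1 => κ
  | (n + 2) => fun x y => ∫ z in Icc (0:ℝ) 1, kpow κ (n + 1) x z * κ z y

/-- `φ : Fin ℓ → Fin n` is a homomorphism from `F` to `G`. -/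
def IsHom {α β : Type*} (F : SimpleGraph α) (G : SimpleGraph β) (φ : α → β) : Prop :=
  ∀ i j, F.Adj i j → G.Adj (φ i) (φ j)

/-- `F` is flat over its induced subgraph `F'` on the first `ℓ` vertices, for the
sequence `(G_n)` with normalizing function `p`. -/
def FlatOver (p : ℕ → ℝ) (G : ∀ n, SimpleGraph (Fin n)) {k ℓ : ℕ} (h : ℓ ≤ k)
    (F : SimpleGraph (Fin k)) : Prop :=
  ∀ ε > (0:ℝ), ∀ᶠ n in atTop,
    ((Finset.univ.filter (fun φ : Fin ℓ → Fin n =>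
        IsHom (F.comap (Fin.castLE h)) (G n) φ ∧
        ε * ((n:ℝ) ^ (k - ℓ) * p n ^ (edgeCount F - edgeCount (F.comap (Fin.castLE h)))) <
          |((Finset.univ.filter (fun ψ : Fin k → Fin n =>
              IsHom F (G n) ψ ∧ ψ ∘ Fin.castLE h = φ)).card : ℝ) -
            (n:ℝ) ^ (k - ℓ) * p n ^ (edgeCount F - edgeCount (F.comap (Fin.castLE h)))|)).card
      : ℝ)
      ≤ ε * ((Finset.univ.filter (fun φ : Fin ℓ → Fin n =>
          IsHom (F.comap (Fin.castLE h)) (G n) φ)).card : ℝ)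

/-- The set of density matrices of balanced partitions of `V(G)` into `k` nonempty
parts. -/
def MsetG (k : ℕ) {n : ℕ} (p : ℝ) (G : SimpleGraph (Fin n)) : Set (Fin k → Fin k → ℝ) :=
  {M | ∃ c : Fin n → Fin k, Function.Surjective c ∧
    (∀ a b, (fiber c a).card ≤ (fiber c b).card + 1) ∧
    M = fun a b => dDens p G (fiber c a) (fiber c b)}

/-- The closed set of density matrices of partitions of `[0,1]` into `k` parts of
measure `1/k`, for a kernel `κ`. -/
def MsetK (k : ℕ) (κ : ℝ → ℝ → ℝ) : Set (Fin k → Fin k → ℝ) :=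
  closure {M | ∃ Q : Fin k → Set ℝ, (∀ a, MeasurableSet (Q a)) ∧
    (Pairwise fun a b => Disjoint (Q a) (Q b)) ∧ (⋃ a, Q a) = Icc 0 1 ∧
    (∀ a, volume (Q a) = 1 / (k : ℝ≥0∞)) ∧
    M = fun a b => (k : ℝ)^2 * ∫ q in (Q a) ×ˢ (Q b), κ q.1 q.2}

end

noncomputable section

/-- A symmetric measurable function on `X × X` with values in `[0, C]`. -/
structure IsBoundedKernel {X : Type*} [MeasurableSpace X] (W : X → X → ℝ) (C : ℝ) : Prop where
  measurable : Measurable (Function.uncurry W)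
  symm : ∀ x y, W x y = W y x
  nonneg : ∀ x y, 0 ≤ W x y
  le : ∀ x y, W x y ≤ C

/-- The `(n+1)`-st power of a kernel with respect to the measure `μ`. -/
def iterKernel {X : Type*} [MeasurableSpace X] (μ : Measure X) (W : X → X → ℝ) :
    ℕ → X → X → ℝ
  | 0 => W
  | n + 1 => fun x y => ∫ z, W x z * iterKernel μ W n z y ∂μ

namespace IsBoundedKernel

variable {X : Type*} [MeasurableSpace X] {μ : Measure X} {W : X → X → ℝ} {C : ℝ}

lemma norm_le (h : IsBoundedKernel W C) (x y : X) : ‖W x y‖ ≤ C := by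
  rw [Real.norm_of_nonneg (h.nonneg x y)]; exact h.le x y

lemma bound_nonneg (h : IsBoundedKernel W C) (x : X) : 0 ≤ C :=
  (h.nonneg x x).trans (h.le x x)

lemma measurable_left (h : IsBoundedKernel W C) (x : X) : Measurable (W x) :=
  h.measurable.comp measurable_prodMk_left

lemma measurable_right (h : IsBoundedKernel W C) (y : X) : Measurable (fun x => W x y) :=
  h.measurable.comp measurable_prodMk_right

lemma comp {Z : Type*} [MeasurableSpace Z] {φ : Z → X} (h : IsBoundedKernel W C)
    (hφ : Measurable φ) : IsBoundedKernel (fun z z' => W (φ z) (φ z')) C where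
  measurable := h.measurable.comp ((hφ.comp measurable_fst).prodMk (hφ.comp measurable_snd))
  symm _ _ := h.symm _ _
  nonneg _ _ := h.nonneg _ _
  le _ _ := h.le _ _

lemma div_const (h : IsBoundedKernel W C) (hC : 0 < C) :
    IsBoundedKernel (fun x y => W x y / C) 1 where
  measurable := h.measurable.div_const C
  symm x y := by rw [h.symm]
  nonneg x y := div_nonneg (h.nonneg x y) hC.le
  le x y := by rw [div_le_one hC]; exact h.le x y

lemma iterKernel_measurable (h : IsBoundedKernel W C) [SFinite μ] (n : ℕ) :
    Measurable (Function.uncurry (iterKernel μ W n)) := by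
  induction n with
  | zero => exact h.measurable
  | succ n ih =>
    have : StronglyMeasurable (fun p : (X × X) × X => W p.1.1 p.2 * iterKernel μ W n p.2 p.1.2) :=
      ((h.measurable.comp (measurable_fst.fst.prodMk measurable_snd)).mul
        (ih.comp (measurable_snd.prodMk measurable_fst.snd))).stronglyMeasurable
    exact this.integral_prod_right.measurable

lemma iterKernel_mem [IsProbabilityMeasure μ] (h : IsBoundedKernel W C) (n : ℕ) (x y : X) :
    0 ≤ iterKernel μ W n x y ∧ iterKernel μ W n x y ≤ C ^ (n + 1) := by
  have hC : 0 ≤ C := h.bound_nonneg x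
  induction n generalizing x with
  | zero => simpa [iterKernel] using ⟨h.nonneg x y, h.le x y⟩
  | succ n ih =>
    refine ⟨integral_nonneg fun z => mul_nonneg (h.nonneg x z) (ih z).1, ?_⟩
    have hb : ∀ z, ‖W x z * iterKernel μ W n z y‖ ≤ C ^ (n + 1 + 1) := fun z => by
      rw [norm_mul, pow_succ' C (n + 1), Real.norm_of_nonneg (ih z).1]
      exact mul_le_mul (h.norm_le x z) (ih z).2 (ih z).1 hC
    have := norm_integral_le_of_norm_le_const (μ := μ) (ae_of_all _ hb)
    simp only [probReal_univ, mul_one] at this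
    exact (Real.le_norm_self _).trans this

lemma integrable_mul_iterKernel [IsProbabilityMeasure μ] (h : IsBoundedKernel W C) (n : ℕ)
    (x y : X) : Integrable (fun q : X × X => W x q.1 * (iterKernel μ W n q.1 q.2 * W q.2 y))
      (μ.prod μ) := by
  have hC : 0 ≤ C := h.bound_nonneg x
  refine Integrable.of_bound (C := C * (C ^ (n + 1) * C)) ?_ (ae_of_all _ fun q => ?_)
  · exact (((h.measurable_left x).comp measurable_fst).mul
      ((h.iterKernel_measurable n).mul
        ((h.measurable_right y).comp measurable_snd))).aestronglyMeasurable
  · have hm := h.iterKernel_mem (μ := μ) n q.1 q.2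
    rw [norm_mul, norm_mul, Real.norm_of_nonneg hm.1]
    exact mul_le_mul (h.norm_le _ _) (mul_le_mul hm.2 (h.norm_le _ _) (norm_nonneg _)
      (by positivity)) (mul_nonneg hm.1 (norm_nonneg _)) hC

lemma iterKernel_succ' [IsProbabilityMeasure μ] (h : IsBoundedKernel W C) (n : ℕ) (x y : X) :
    iterKernel μ W (n + 1) x y = ∫ z, iterKernel μ W n x z * W z y ∂μ := by
  induction n generalizing x y with
  | zero => rfl
  | succ n ih =>
    calc iterKernel μ W (n + 1 + 1) x y
        = ∫ z, W x z * ∫ u, iterKernel μ W n z u * W u y ∂μ ∂μ := by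
          rw [iterKernel]; simp_rw [ih]
      _ = ∫ z, ∫ u, W x z * (iterKernel μ W n z u * W u y) ∂μ ∂μ := by
          simp_rw [integral_const_mul]
      _ = ∫ u, ∫ z, W x z * (iterKernel μ W n z u * W u y) ∂μ ∂μ :=
          integral_integral_swap (h.integrable_mul_iterKernel n x y)
      _ = ∫ u, iterKernel μ W (n + 1) x u * W u y ∂μ := by
          simp_rw [iterKernel, ← integral_mul_const, mul_assoc]

lemma iterKernel_symm [IsProbabilityMeasure μ] (h : IsBoundedKernel W C) (n : ℕ) (x y : X) :
    iterKernel μ W n x y = iterKernel μ W n y x := by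
  induction n generalizing x y with
  | zero => exact h.symm x y
  | succ n ih =>
    rw [h.iterKernel_succ', iterKernel]
    refine integral_congr_ae (ae_of_all _ fun z => ?_)
    simp only
    rw [ih x z, h.symm z y, mul_comm]

/-- Powers of bounded kernels are bounded kernels. -/
lemma iterKernel [IsProbabilityMeasure μ] (h : IsBoundedKernel W C) (n : ℕ) :
    IsBoundedKernel (iterKernel μ W n) (C ^ (n + 1)) where
  measurable := h.iterKernel_measurable n
  symm := h.iterKernel_symm n
  nonneg x y := (h.iterKernel_mem n x y).1
  le x y := (h.iterKernel_mem n x y).2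

end IsBoundedKernel

/-- Kernel powers commute with pulling back along a measure-preserving map. -/
lemma iterKernel_comp {X Z : Type*} [MeasurableSpace X] [MeasurableSpace Z] {μ : Measure Z}
    {ν : Measure X} [SFinite ν] {φ : Z → X} (hφ : MeasurePreserving φ μ ν) {W : X → X → ℝ}
    {C : ℝ} (h : IsBoundedKernel W C) (n : ℕ) (z z' : Z) :
    iterKernel μ (fun a b => W (φ a) (φ b)) n z z' = iterKernel ν W n (φ z) (φ z') := by
  induction n generalizing z with
  | zero => rfl
  | succ n ih =>
    simp only [iterKernel, ih]
    rw [← hφ.map_eq, integral_map hφ.measurable.aemeasurable]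
    · rw [hφ.map_eq]
      exact ((h.measurable_left _).mul ((h.iterKernel_measurable n).comp
        measurable_prodMk_right)).aestronglyMeasurable

section Operator

variable {X : Type*} [MeasurableSpace X] {μ : Measure X} {W V : X → X → ℝ} {C : ℝ}

lemma integrable_kernel_mul (h : IsBoundedKernel W C) {f : X → ℂ} (hf : Integrable f μ) (x : X) :
    Integrable (fun y => (W x y : ℂ) * f y) μ :=
  hf.bdd_mul (c := C) (Complex.measurable_ofReal.comp (h.measurable_left x)).aestronglyMeasurable
    (ae_of_all _ fun y => by simpa using h.norm_le x y)

lemma norm_integral_kernel_mul_le (h : IsBoundedKernel W C) {f : X → ℂ} (hf : Integrable f μ)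
    (x : X) : ‖∫ y, (W x y : ℂ) * f y ∂μ‖ ≤ C * ∫ y, ‖f y‖ ∂μ := by
  rw [← integral_const_mul]
  refine norm_integral_le_of_norm_le (hf.norm.const_mul C) (ae_of_all _ fun y => ?_)
  rw [norm_mul]
  gcongr
  simpa using h.norm_le x y

variable [IsProbabilityMeasure μ]

lemma aestronglyMeasurable_integral_kernel_mul (h : IsBoundedKernel W C) {f : X → ℂ}
    (hf : AEStronglyMeasurable f μ) :
    AEStronglyMeasurable (fun x => ∫ y, (W x y : ℂ) * f y ∂μ) μ := by
  refine AEStronglyMeasurable.integral_prod_right'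
    (f := fun p : X × X => (W p.1 p.2 : ℂ) * f p.2) ?_
  exact (Complex.measurable_ofReal.comp h.measurable).aestronglyMeasurable.mul hf.comp_snd

lemma memLp_integral_kernel_mul (h : IsBoundedKernel W C) {f : X → ℂ} (hf : Integrable f μ) :
    MemLp (fun x => ∫ y, (W x y : ℂ) * f y ∂μ) 2 μ :=
  MemLp.of_bound (aestronglyMeasurable_integral_kernel_mul h hf.1) _
    (ae_of_all _ (norm_integral_kernel_mul_le h hf))

lemma integrable_of_Lp_two (f : Lp ℂ 2 μ) : Integrable f μ :=
  (Lp.memLp f).integrable (by norm_num)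

lemma integral_norm_le_norm_Lp_two (f : Lp ℂ 2 μ) : ∫ y, ‖f y‖ ∂μ ≤ ‖f‖ := by
  rw [Lp.norm_def, integral_norm_eq_lintegral_enorm (Lp.aestronglyMeasurable f),
    ← eLpNorm_one_eq_lintegral_enorm]
  exact ENNReal.toReal_mono (Lp.eLpNorm_ne_top f)
    (eLpNorm_le_eLpNorm_of_exponent_le (by norm_num) (Lp.aestronglyMeasurable f))

/-- The integral operator on `L²(μ)` with a bounded kernel. -/
def integralOp (μ : Measure X) [IsProbabilityMeasure μ] (h : IsBoundedKernel W C) :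
    Lp ℂ 2 μ →L[ℂ] Lp ℂ 2 μ :=
  LinearMap.mkContinuous
    { toFun := fun f => (memLp_integral_kernel_mul h (integrable_of_Lp_two f)).toLp _
      map_add' := fun f g => by
        rw [← MemLp.toLp_add]
        refine MemLp.toLp_congr _ _ (ae_of_all _ fun x => ?_)
        simp only [Pi.add_apply]
        rw [← integral_add (integrable_kernel_mul h (integrable_of_Lp_two f) x)
          (integrable_kernel_mul h (integrable_of_Lp_two g) x)]
        refine integral_congr_ae ?_
        filter_upwards [Lp.coeFn_add f g] with y hy
        rw [hy, Pi.add_apply, mul_add]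
      map_smul' := fun c f => by
        rw [← MemLp.toLp_const_smul]
        refine MemLp.toLp_congr _ _ (ae_of_all _ fun x => ?_)
        simp only [Pi.smul_apply, smul_eq_mul, RingHom.id_apply]
        rw [← integral_const_mul]
        refine integral_congr_ae ?_
        filter_upwards [Lp.coeFn_smul c f] with y hy
        rw [hy, Pi.smul_apply, smul_eq_mul, mul_left_comm] }
    C fun f => by
      obtain ⟨x⟩ : Nonempty X := nonempty_of_isProbabilityMeasure μ
      have hC := h.bound_nonneg x
      have := Lp.norm_le_of_ae_bound (p := 2) (μ := μ)
        (f := (memLp_integral_kernel_mul h (integrable_of_Lp_two f)).toLp _)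
        (C := C * ‖f‖) (by positivity) (by
          filter_upwards [MemLp.coeFn_toLp (memLp_integral_kernel_mul h (integrable_of_Lp_two f))]
            with x hx
          rw [hx]
          exact (norm_integral_kernel_mul_le h (integrable_of_Lp_two f) x).trans
            (mul_le_mul_of_nonneg_left (integral_norm_le_norm_Lp_two f) hC))
      simpa [measureUnivNNReal] using this

lemma integralOp_coeFn (h : IsBoundedKernel W C) (f : Lp ℂ 2 μ) :
    integralOp μ h f =ᵐ[μ] fun x => ∫ y, (W x y : ℂ) * f y ∂μ :=
  MemLp.coeFn_toLp (memLp_integral_kernel_mul h (integrable_of_Lp_two f))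

lemma isSelfAdjoint_integralOp (h : IsBoundedKernel W C) : IsSelfAdjoint (integralOp μ h) := by
  rw [ContinuousLinearMap.isSelfAdjoint_iff_isSymmetric]
  intro f g
  have hf := integrable_of_Lp_two f
  have hg := integrable_of_Lp_two g
  rw [ContinuousLinearMap.coe_coe, L2.inner_def, L2.inner_def]
  have h_int : Integrable (fun p : X × X => (W p.1 p.2 : ℂ) *
      ((starRingEnd ℂ) (f p.2) * g p.1)) (μ.prod μ) := by
    refine Integrable.bdd_mul (c := C) ?_
      (Complex.measurable_ofReal.comp h.measurable).aestronglyMeasurable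
      (ae_of_all _ fun p => by simpa using h.norm_le p.1 p.2)
    have hf' : Integrable (fun x => (starRingEnd ℂ) (f x)) μ :=
      (LinearIsometryEquiv.integrable_comp_iff (Complex.conjLIE)).2 hf
    simpa [mul_comm] using hg.mul_prod hf'
  calc ∫ a, inner ℂ (integralOp μ h f a) (g a) ∂μ
      = ∫ x, ∫ y, (W x y : ℂ) * ((starRingEnd ℂ) (f y) * g x) ∂μ ∂μ := by
        refine integral_congr_ae ?_
        filter_upwards [integralOp_coeFn h f] with x hx
        rw [hx, RCLike.inner_apply, ← integral_conj, ← integral_const_mul]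
        refine integral_congr_ae (ae_of_all _ fun y => ?_)
        simp only [map_mul, Complex.conj_ofReal]
        ring
    _ = ∫ y, ∫ x, (W x y : ℂ) * ((starRingEnd ℂ) (f y) * g x) ∂μ ∂μ :=
        integral_integral_swap h_int
    _ = ∫ a, inner ℂ (f a) (integralOp μ h g a) ∂μ := by
        refine integral_congr_ae ?_
        filter_upwards [integralOp_coeFn h g] with y hy
        rw [hy, RCLike.inner_apply, ← integral_mul_const]
        refine integral_congr_ae (ae_of_all _ fun x => ?_)
        simp only
        rw [h.symm x y]
        ring

lemma integralOp_pow (h : IsBoundedKernel W C) (n : ℕ) :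
    integralOp μ h ^ (n + 1) = integralOp μ (h.iterKernel (μ := μ) n) := by
  induction n with
  | zero =>
    ext1 f
    have hpow : integralOp μ h ^ (0 + 1) = integralOp μ h := pow_one _
    rw [hpow]
    refine Lp.ext ?_
    filter_upwards [integralOp_coeFn h f, integralOp_coeFn (h.iterKernel (μ := μ) 0) f]
      with x h1 h2
    rw [h1, h2]
    rfl
  | succ n ih =>
    ext1 f
    rw [pow_succ', ih, mul_apply_eq_comp]
    refine Lp.ext ?_
    set hn := h.iterKernel (μ := μ) n
    filter_upwards [integralOp_coeFn h (integralOp μ hn f),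
      integralOp_coeFn (h.iterKernel (μ := μ) (n + 1)) f] with x h1 h2
    rw [h1, h2]
    have h_int : Integrable (fun p : X × X => (W x p.1 : ℂ) *
        ((iterKernel μ W n p.1 p.2 : ℂ) * f p.2)) (μ.prod μ) := by
      refine Integrable.bdd_mul (c := C) ?_ (Complex.measurable_ofReal.comp
        ((h.measurable_left x).comp measurable_fst)).aestronglyMeasurable
        (ae_of_all _ fun p => by simpa using h.norm_le x p.1)
      exact Integrable.bdd_mul (c := C ^ (n + 1)) ((integrable_of_Lp_two f).comp_snd μ)
        (Complex.measurable_ofReal.comp hn.measurable).aestronglyMeasurable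
        (ae_of_all _ fun p => by simpa using hn.norm_le p.1 p.2)
    calc ∫ z, (W x z : ℂ) * integralOp μ hn f z ∂μ
        = ∫ z, ∫ y, (W x z : ℂ) * ((iterKernel μ W n z y : ℂ) * f y) ∂μ ∂μ := by
          refine integral_congr_ae ?_
          filter_upwards [integralOp_coeFn hn f] with z hz
          rw [hz, integral_const_mul]
      _ = ∫ y, ∫ z, (W x z : ℂ) * ((iterKernel μ W n z y : ℂ) * f y) ∂μ ∂μ :=
          integral_integral_swap h_int
      _ = ∫ y, (iterKernel μ W (n + 1) x y : ℂ) * f y ∂μ := by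
          refine integral_congr_ae (ae_of_all _ fun y => ?_)
          simp only [iterKernel]
          rw [← integral_complex_ofReal, ← integral_mul_const]
          refine integral_congr_ae (ae_of_all _ fun z => ?_)
          simp only [Complex.ofReal_mul]
          ring

lemma integralOp_congr {C' : ℝ} (hW : IsBoundedKernel W C) (hV : IsBoundedKernel V C')
    (heq : ∀ᵐ p ∂(μ.prod μ), W p.1 p.2 = V p.1 p.2) : integralOp μ hW = integralOp μ hV := by
  ext1 f
  refine Lp.ext ?_
  filter_upwards [integralOp_coeFn hW f, integralOp_coeFn hV f,
    Measure.ae_ae_of_ae_prod heq] with x h1 h2 h3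
  rw [h1, h2]
  refine integral_congr_ae ?_
  filter_upwards [h3] with y hy
  rw [hy]

lemma ae_eq_of_integralOp_eq {C' : ℝ} (hW : IsBoundedKernel W C) (hV : IsBoundedKernel V C')
    (heq : integralOp μ hW = integralOp μ hV) :
    ∀ᵐ p ∂(μ.prod μ), W p.1 p.2 = V p.1 p.2 := by
  have key : ∀ {U : X → X → ℝ} {c : ℝ} (hU : IsBoundedKernel U c) {s t : Set X}
      (hs : MeasurableSet s) (ht : MeasurableSet t),
      (inner ℂ (indicatorConstLp 2 hs (measure_ne_top μ s) (1 : ℂ))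
        (integralOp μ hU (indicatorConstLp 2 ht (measure_ne_top μ t) (1 : ℂ)))) =
      ((∫ p in s ×ˢ t, U p.1 p.2 ∂(μ.prod μ) : ℝ) : ℂ) := by
    intro U c hU s t hs ht
    rw [L2.inner_indicatorConstLp_one, setIntegral_prod, ← integral_complex_ofReal]
    · refine integral_congr_ae (ae_restrict_of_ae ?_)
      filter_upwards [integralOp_coeFn hU (indicatorConstLp 2 ht (measure_ne_top μ t) (1 : ℂ))]
        with x hx
      rw [hx, ← integral_complex_ofReal, ← integral_indicator ht]
      refine integral_congr_ae ?_
      filter_upwards [indicatorConstLp_coeFn (p := 2) (hs := ht) (hμs := measure_ne_top μ t)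
        (c := (1 : ℂ))] with y hy
      rw [hy]
      by_cases hyt : y ∈ t <;> simp [hyt]
    · exact (Integrable.of_bound (C := c) hU.measurable.aestronglyMeasurable
        (ae_of_all _ fun p => hU.norm_le p.1 p.2)).integrableOn
  have hfin : ∀ {U : X → X → ℝ} {c : ℝ} (_ : IsBoundedKernel U c),
      Integrable (fun p : X × X => U p.1 p.2) (μ.prod μ) := fun {U c} hU =>
    Integrable.of_bound (C := c) hU.measurable.aestronglyMeasurable
      (ae_of_all _ fun p => hU.norm_le p.1 p.2)
  have hmeas : (μ.prod μ).withDensity (fun p => ENNReal.ofReal (W p.1 p.2)) =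
      (μ.prod μ).withDensity (fun p => ENNReal.ofReal (V p.1 p.2)) := by
    have : IsFiniteMeasure ((μ.prod μ).withDensity (fun p => ENNReal.ofReal (W p.1 p.2))) :=
      isFiniteMeasure_withDensity_ofReal (hfin hW).2
    refine Measure.ext_prod fun {s t} hs ht => ?_
    rw [withDensity_apply _ (hs.prod ht), withDensity_apply _ (hs.prod ht),
      ← ofReal_integral_eq_lintegral_ofReal (hfin hW).integrableOn
        (ae_of_all _ fun p => hW.nonneg _ _),
      ← ofReal_integral_eq_lintegral_ofReal (hfin hV).integrableOn
        (ae_of_all _ fun p => hV.nonneg _ _)]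
    have := key hW hs ht
    rw [heq, key hV hs ht] at this
    rw [Complex.ofReal_injective this]
  have hWm := hW.measurable.ennreal_ofReal
  have hVm := hV.measurable.ennreal_ofReal
  have := (withDensity_eq_iff_of_sigmaFinite hWm.aemeasurable hVm.aemeasurable).1 hmeas
  filter_upwards [this] with p hp
  exact (ENNReal.ofReal_eq_ofReal_iff (hW.nonneg _ _) (hV.nonneg _ _)).1 hp

/-- A self-adjoint element of a C⋆-algebra is determined by any of its odd powers. -/
lemma IsSelfAdjoint.eq_of_odd_pow_eq {A : Type*} [CStarAlgebra A] {a b : A}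
    (ha : IsSelfAdjoint a) (hb : IsSelfAdjoint b) {t : ℕ} (ht : Odd t) (hab : a ^ t = b ^ t) :
    a = b := by
  have hmono : StrictMono (fun x : ℝ => x ^ t) := ht.strictMono_pow
  have hbot : Tendsto (fun x : ℝ => x ^ t) atBot atBot := by
    have := tendsto_neg_atTop_atBot.comp
      ((tendsto_pow_atTop (α := ℝ) ht.pos.ne').comp tendsto_neg_atBot_atTop)
    refine this.congr fun x => ?_
    simp [ht.neg_pow]
  have hsurj : Function.Surjective (fun x : ℝ => x ^ t) :=
    (continuous_pow t).surjective (tendsto_pow_atTop ht.pos.ne') hbot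
  let e : ℝ ≃o ℝ := hmono.orderIsoOfSurjective _ hsurj
  have he : ∀ x, e.symm (x ^ t) = x := fun x => e.symm_apply_apply x
  have key : ∀ c : A, IsSelfAdjoint c → cfc e.symm (c ^ t) = c := fun c hc => by
    rw [← cfc_comp_pow e.symm t c (e.symm.continuous.continuousOn) hc]
    simp only [he]
    exact cfc_id' ℝ c hc
  rw [← key a ha, hab, key b hb]

/-- Bounded kernels are determined almost everywhere by any of their odd powers. -/
theorem ae_eq_of_iterKernel_ae_eq (hW : IsBoundedKernel W C) (hV : IsBoundedKernel V C) {n : ℕ}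
    (hn : Odd (n + 1))
    (heq : ∀ᵐ p ∂(μ.prod μ), iterKernel μ W n p.1 p.2 = iterKernel μ V n p.1 p.2) :
    ∀ᵐ p ∂(μ.prod μ), W p.1 p.2 = V p.1 p.2 := by
  refine ae_eq_of_integralOp_eq hW hV ?_
  refine (isSelfAdjoint_integralOp hW).eq_of_odd_pow_eq (isSelfAdjoint_integralOp hV) hn ?_
  rw [integralOp_pow, integralOp_pow]
  exact integralOp_congr _ _ heq

end Operator

section RandomGraph

variable {E : Type*}

/-- The probability of the configuration `G` when every `e` is switched on independently with
probability `v e`. -/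
def graphWeight [Fintype E] (v : E → ℝ) (G : E → Bool) : ℝ := ∏ e, if G e then v e else 1 - v e

/-- The deviation of the indicator of `G e` from its mean. -/
def edgeDev (v : E → ℝ) (G : E → Bool) (e : E) : ℝ := (if G e then 1 else 0) - v e

lemma graphWeight_nonneg [Fintype E] {v : E → ℝ} (h0 : ∀ e, 0 ≤ v e) (h1 : ∀ e, v e ≤ 1)
    (G : E → Bool) :
    0 ≤ graphWeight v G :=
  Finset.prod_nonneg fun e _ => by split_ifs <;> linarith [h0 e, h1 e]

lemma graphWeight_le_one [Fintype E] {v : E → ℝ} (h0 : ∀ e, 0 ≤ v e) (h1 : ∀ e, v e ≤ 1)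
    (G : E → Bool) :
    graphWeight v G ≤ 1 :=
  Finset.prod_le_one (fun e _ => by split_ifs <;> linarith [h0 e, h1 e])
    (fun e _ => by split_ifs <;> linarith [h0 e, h1 e])

lemma sum_graphWeight [Fintype E] [DecidableEq E] (v : E → ℝ) : ∑ G, graphWeight v G = 1 := by
  have := Finset.prod_univ_sum (fun _ : E => (Finset.univ : Finset Bool))
    (fun e b => if b then v e else 1 - v e)
  rw [Fintype.piFinset_univ] at this
  simpa [graphWeight] using this.symm

lemma abs_edgeDev_le {v : E → ℝ} (h0 : ∀ e, 0 ≤ v e) (h1 : ∀ e, v e ≤ 1) (G : E → Bool) (e : E) :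
    |edgeDev v G e| ≤ 1 := by
  rw [edgeDev, abs_le]
  split_ifs <;> constructor <;> linarith [h0 e, h1 e]

lemma edgeDev_update_of_ne [DecidableEq E] (v : E → ℝ) (G : E → Bool) {e e' : E} (h : e' ≠ e)
    (b : Bool) :
    edgeDev v (Function.update G e b) e' = edgeDev v G e' := by
  simp [edgeDev, Function.update_of_ne h]

/-- The deviation at `e` has mean zero and is uncorrelated with everything that does not depend on
the state of `e`. -/
lemma sum_graphWeight_mul_edgeDev [Fintype E] [DecidableEq E] (v : E → ℝ) (e : E)
    (R : (E → Bool) → ℝ)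
    (hR : ∀ G b, R (Function.update G e b) = R G) :
    ∑ G, graphWeight v G * (edgeDev v G e * R G) = 0 := by
  have hsplit : ∀ G : E → Bool, graphWeight v G = (if G e then v e else 1 - v e) *
      ∏ e' ∈ Finset.univ.erase e, if G e' then v e' else 1 - v e' := fun G =>
    (Finset.mul_prod_erase _ _ (Finset.mem_univ e)).symm
  refine Finset.sum_involution (fun G _ => Function.update G e (!G e)) (fun G _ => ?_)
    (fun G _ _ => ?_) (fun _ _ => Finset.mem_univ _) (fun G _ => ?_)
  · have hrest : (∏ e' ∈ Finset.univ.erase e,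
        if Function.update G e (!G e) e' then v e' else 1 - v e') =
        ∏ e' ∈ Finset.univ.erase e, if G e' then v e' else 1 - v e' :=
      Finset.prod_congr rfl fun e' he' => by
        rw [Function.update_of_ne (Finset.ne_of_mem_erase he')]
    rw [hR, hsplit G, hsplit (Function.update G e (!G e)), hrest]
    simp only [edgeDev, Function.update_self]
    cases G e <;> simp <;> ring
  · intro h
    have := congrFun h e
    simp at this
  · simp

end RandomGraph

section CycleSum

variable {n : ℕ}

/-- The sum of `A i j * A i j' * A i' j * A i' j'` over all `i, i', j, j'`. -/
def cycleSum (A : Fin n → Fin n → ℝ) : ℝ := ∑ j, ∑ j', (∑ i, A i j * A i j') ^ 2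

lemma cycleSum_nonneg (A : Fin n → Fin n → ℝ) : 0 ≤ cycleSum A := by
  unfold cycleSum; positivity

/-- Bilinear forms with bounded coefficient vectors are controlled by the cycle sum. -/
lemma bilin_pow_four_le (A : Fin n → Fin n → ℝ) {s t : Fin n → ℝ} (hs : ∀ i, |s i| ≤ 1)
    (ht : ∀ i, |t i| ≤ 1) :
    (∑ i, ∑ j, s i * t j * A i j) ^ 4 ≤ (n : ℝ) ^ 4 * cycleSum A := by
  have hs2 : ∑ i, s i ^ 2 ≤ (n : ℝ) := by
    calc ∑ i, s i ^ 2 ≤ ∑ _i : Fin n, (1 : ℝ) :=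
          Finset.sum_le_sum fun i _ => by rw [sq_le_one_iff_abs_le_one]; exact hs i
      _ = n := by simp
  have h1 : (∑ i, ∑ j, s i * t j * A i j) ^ 2 ≤ (n : ℝ) * ∑ i, (∑ j, t j * A i j) ^ 2 := by
    have := Finset.sum_mul_sq_le_sq_mul_sq Finset.univ s (fun i => ∑ j, t j * A i j)
    calc (∑ i, ∑ j, s i * t j * A i j) ^ 2 = (∑ i, s i * ∑ j, t j * A i j) ^ 2 := by
          simp_rw [Finset.mul_sum, mul_assoc]
      _ ≤ _ := this
      _ ≤ _ := by gcongr
  have h2 : ∑ i, (∑ j, t j * A i j) ^ 2 =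
      ∑ p : Fin n × Fin n, (t p.1 * t p.2) * ∑ i, A i p.1 * A i p.2 := by
    simp_rw [sq, Finset.sum_mul_sum, Fintype.sum_prod_type, Finset.mul_sum]
    rw [Finset.sum_comm]
    refine Finset.sum_congr rfl fun j _ => ?_
    rw [Finset.sum_comm]
    refine Finset.sum_congr rfl fun j' _ => Finset.sum_congr rfl fun i _ => ?_
    ring
  have h3 : (∑ i, (∑ j, t j * A i j) ^ 2) ^ 2 ≤ (n : ℝ) ^ 2 * cycleSum A := by
    rw [h2]
    refine (Finset.sum_mul_sq_le_sq_mul_sq Finset.univ (fun p : Fin n × Fin n => t p.1 * t p.2)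
      (fun p => ∑ i, A i p.1 * A i p.2)).trans ?_
    have ht2 : ∑ p : Fin n × Fin n, (t p.1 * t p.2) ^ 2 ≤ (n : ℝ) ^ 2 := by
      calc ∑ p : Fin n × Fin n, (t p.1 * t p.2) ^ 2 ≤ ∑ _p : Fin n × Fin n, (1 : ℝ) :=
            Finset.sum_le_sum fun p _ => by
              rw [sq_le_one_iff_abs_le_one, abs_mul]
              exact mul_le_one₀ (ht _) (abs_nonneg _) (ht _)
        _ = (n : ℝ) ^ 2 := by simp [sq]
    rw [cycleSum, ← Fintype.sum_prod_type' (f := fun j j' => (∑ i, A i j * A i j') ^ 2)]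
    exact mul_le_mul_of_nonneg_right ht2 (Finset.sum_nonneg fun _ _ => sq_nonneg _)
  calc (∑ i, ∑ j, s i * t j * A i j) ^ 4 = ((∑ i, ∑ j, s i * t j * A i j) ^ 2) ^ 2 := by ring
    _ ≤ ((n : ℝ) * ∑ i, (∑ j, t j * A i j) ^ 2) ^ 2 := by gcongr
    _ = (n : ℝ) ^ 2 * (∑ i, (∑ j, t j * A i j) ^ 2) ^ 2 := by ring
    _ ≤ (n : ℝ) ^ 2 * ((n : ℝ) ^ 2 * cycleSum A) := by gcongr
    _ = _ := by ring

lemma sum_graphWeight_mul_cycle_eq_zero (v : Sym2 (Fin n) → ℝ) {i i' j j' : Fin n}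
    (hi : i ≠ i') (hj : j ≠ j') :
    ∑ G, graphWeight v G * (edgeDev v G s(i, j) * edgeDev v G s(i, j') *
      (edgeDev v G s(i', j) * edgeDev v G s(i', j'))) = 0 := by
  by_cases h : s(i, j) = s(i', j')
  · have hij : i = j' ∧ j = i' := by
      rcases Sym2.eq_iff.1 h with h | h
      · exact absurd h.1 hi
      · exact h
    obtain ⟨rfl, rfl⟩ := hij
    have := sum_graphWeight_mul_edgeDev v s(j, j)
      (fun G => edgeDev v G s(i, j) * edgeDev v G s(i, i) * edgeDev v G s(j, i)) (fun G b => by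
        rw [edgeDev_update_of_ne, edgeDev_update_of_ne, edgeDev_update_of_ne] <;>
          simp [hi])
    rw [← this]
    exact Finset.sum_congr rfl fun G _ => by ring
  · have := sum_graphWeight_mul_edgeDev v s(i, j)
      (fun G => edgeDev v G s(i, j') * edgeDev v G s(i', j) * edgeDev v G s(i', j'))
      (fun G b => by
        rw [edgeDev_update_of_ne, edgeDev_update_of_ne, edgeDev_update_of_ne]
        · exact fun h' => h h'.symm
        · rw [Ne, Sym2.eq_iff]; rintro (h' | h')
          · exact hi h'.1.symm
          · exact hi (h'.2 ▸ h'.1 ▸ rfl)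
        · rw [Ne, Sym2.eq_iff]; rintro (h' | h')
          · exact hj h'.2.symm
          · exact hj (h'.1 ▸ h'.2 ▸ rfl))
    rw [← this]
    exact Finset.sum_congr rfl fun G _ => by ring

/-- The expected cycle sum of the deviations of a random graph has order at most `n ^ 3`. -/
lemma sum_graphWeight_mul_cycleSum_le {v : Sym2 (Fin n) → ℝ} (h0 : ∀ e, 0 ≤ v e)
    (h1 : ∀ e, v e ≤ 1) :
    ∑ G, graphWeight v G * cycleSum (fun i j => edgeDev v G s(i, j)) ≤ 2 * (n : ℝ) ^ 3 := by
  have hexp : ∑ G, graphWeight v G * cycleSum (fun i j => edgeDev v G s(i, j)) =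
      ∑ j, ∑ j', ∑ i, ∑ i', ∑ G, graphWeight v G * (edgeDev v G s(i, j) * edgeDev v G s(i, j') *
        (edgeDev v G s(i', j) * edgeDev v G s(i', j'))) := by
    simp_rw [cycleSum, sq, Finset.sum_mul_sum, Finset.mul_sum]
    rw [Finset.sum_comm]
    refine Finset.sum_congr rfl fun j _ => ?_
    rw [Finset.sum_comm]
    refine Finset.sum_congr rfl fun j' _ => ?_
    rw [Finset.sum_comm]
    refine Finset.sum_congr rfl fun i _ => ?_
    rw [Finset.sum_comm]
  rw [hexp]
  have hone : ∀ j j' i i' : Fin n,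
      ∑ G, graphWeight v G * (edgeDev v G s(i, j) * edgeDev v G s(i, j') *
        (edgeDev v G s(i', j) * edgeDev v G s(i', j'))) ≤ 1 := by
    intro j j' i i'
    rw [← sum_graphWeight v]
    refine Finset.sum_le_sum fun G _ => mul_le_of_le_one_right (graphWeight_nonneg h0 h1 G) ?_
    refine (le_abs_self _).trans ?_
    simp only [abs_mul]
    have := abs_edgeDev_le h0 h1 G
    exact mul_le_one₀ (mul_le_one₀ (this _) (abs_nonneg _) (this _)) (by positivity)
      (mul_le_one₀ (this _) (abs_nonneg _) (this _))
  have hterm : ∀ j j' i i' : Fin n,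
      ∑ G, graphWeight v G * (edgeDev v G s(i, j) * edgeDev v G s(i, j') *
        (edgeDev v G s(i', j) * edgeDev v G s(i', j'))) ≤
      (if i = i' then 1 else 0) + (if j = j' then 1 else 0) := by
    intro j j' i i'
    by_cases hi : i = i'
    · have := hone j j' i i'
      rw [if_pos hi]
      split_ifs <;> linarith
    · by_cases hj : j = j'
      · simpa [hi, hj] using hone j j' i i'
      · rw [sum_graphWeight_mul_cycle_eq_zero v hi hj]
        simp [hi, hj]
  calc _ ≤ ∑ j : Fin n, ∑ j' : Fin n, ∑ i : Fin n, ∑ i' : Fin n,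
        ((if i = i' then (1 : ℝ) else 0) + (if j = j' then 1 else 0)) := by
        gcongr with j _ j' _ i _ i' _
        exact hterm j j' i i'
    _ = 2 * (n : ℝ) ^ 3 := by
        simp only [Finset.sum_add_distrib, Finset.sum_ite_eq, Finset.mem_univ, if_true,
          Finset.sum_const, Finset.card_univ, Fintype.card_fin, nsmul_eq_mul, ← Finset.mul_sum]
        simp
        ring

end CycleSum

section Averaging

variable {Ω : Type*} [MeasurableSpace Ω] {P : Measure Ω}

/-- Some value of `φ` is at most its average with respect to the density `ρ`. -/
lemma exists_mul_integral_le {ρ φ : Ω → ℝ} (hρ0 : ∀ x, 0 ≤ ρ x) (hρ : Integrable ρ P)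
    (hφ : Integrable (fun x => φ x * ρ x) P) (hpos : 0 < ∫ x, ρ x ∂P) :
    ∃ x, φ x * ∫ y, ρ y ∂P ≤ ∫ y, φ y * ρ y ∂P := by
  by_contra! hcon
  set w := ∫ y, ρ y ∂P
  set m := ∫ y, φ y * ρ y ∂P
  have h_int : Integrable (fun x => φ x * ρ x - m / w * ρ x) P := hφ.sub (hρ.const_mul _)
  have hlt : ∀ x, m / w < φ x := fun x => by rw [div_lt_iff₀ hpos]; exact hcon x
  have hnn : ∀ x, 0 ≤ φ x * ρ x - m / w * ρ x := fun x => by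
    rw [← sub_mul]; exact mul_nonneg (sub_nonneg.2 (hlt x).le) (hρ0 x)
  have hzero : ∫ x, (φ x * ρ x - m / w * ρ x) ∂P = 0 := by
    rw [integral_sub hφ (hρ.const_mul _), integral_const_mul, div_mul_cancel₀ _ hpos.ne', sub_self]
  have hae := (integral_eq_zero_iff_of_nonneg hnn h_int).1 hzero
  have hρae : ρ =ᵐ[P] 0 := by
    filter_upwards [hae] with x hx
    simp only [Pi.zero_apply, ← sub_mul, mul_eq_zero, sub_eq_zero] at hx
    exact hx.resolve_left (hlt x).ne'
  exact hpos.ne' (integral_eq_zero_of_ae hρae)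

/-- Two families of densities with the same masses can be sampled jointly, sharing the discrete
label, without exceeding the sum of the expectations. -/
lemma exists_common_label {𝒢 : Type*} [Fintype 𝒢] {ρ₁ ρ₂ φ₁ φ₂ : 𝒢 → Ω → ℝ}
    (h01 : ∀ G x, 0 ≤ ρ₁ G x) (h02 : ∀ G x, 0 ≤ ρ₂ G x)
    (hi1 : ∀ G, Integrable (ρ₁ G) P) (hi2 : ∀ G, Integrable (ρ₂ G) P)
    (hφ1 : ∀ G, Integrable (fun x => φ₁ G x * ρ₁ G x) P)
    (hφ2 : ∀ G, Integrable (fun x => φ₂ G x * ρ₂ G x) P)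
    (hmass : ∀ G, ∫ x, ρ₁ G x ∂P = ∫ x, ρ₂ G x ∂P) (hone : ∑ G, ∫ x, ρ₁ G x ∂P = 1)
    {B : ℝ} (hB : ∑ G, ∫ x, φ₁ G x * ρ₁ G x ∂P + ∑ G, ∫ x, φ₂ G x * ρ₂ G x ∂P ≤ B) :
    ∃ G x y, φ₁ G x + φ₂ G y ≤ B := by
  have hG : ∃ G, 0 < ∫ x, ρ₁ G x ∂P ∧
      ∫ x, φ₁ G x * ρ₁ G x ∂P + ∫ x, φ₂ G x * ρ₂ G x ∂P ≤ B * ∫ x, ρ₁ G x ∂P := by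
    by_contra! hcon
    have hz : ∀ {ρ φ : Ω → ℝ}, (∀ x, 0 ≤ ρ x) → Integrable ρ P → ∫ x, ρ x ∂P = 0 →
        ∫ x, φ x * ρ x ∂P = 0 := fun {ρ φ} h0 hi h => by
      have := (integral_eq_zero_iff_of_nonneg h0 hi).1 h
      refine integral_eq_zero_of_ae ?_
      filter_upwards [this] with x hx
      simp [hx]
    have hle : ∀ G, B * ∫ x, ρ₁ G x ∂P ≤
        ∫ x, φ₁ G x * ρ₁ G x ∂P + ∫ x, φ₂ G x * ρ₂ G x ∂P := fun G => by
      rcases (integral_nonneg (h01 G) : 0 ≤ ∫ x, ρ₁ G x ∂P).eq_or_lt with h | h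
      · rw [hz (h01 G) (hi1 G) h.symm, hz (h02 G) (hi2 G) (by rw [← hmass, ← h]), ← h]
        simp
      · exact (hcon G h).le
    obtain ⟨G₀, hG₀⟩ : ∃ G, 0 < ∫ x, ρ₁ G x ∂P := by
      by_contra! h
      have : ∑ G, ∫ x, ρ₁ G x ∂P ≤ 0 := Finset.sum_nonpos fun G _ => h G
      linarith
    have := Finset.sum_lt_sum (s := Finset.univ) (fun G _ => hle G)
      ⟨G₀, Finset.mem_univ _, hcon G₀ hG₀⟩
    rw [← Finset.mul_sum, hone, Finset.sum_add_distrib] at this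
    linarith
  obtain ⟨G, hpos, hle⟩ := hG
  obtain ⟨x, hx⟩ := exists_mul_integral_le (h01 G) (hi1 G) (hφ1 G) hpos
  obtain ⟨y, hy⟩ := exists_mul_integral_le (h02 G) (hi2 G) (hφ2 G) (hmass G ▸ hpos)
  refine ⟨G, x, y, le_of_mul_le_mul_right ?_ hpos⟩
  rw [← hmass] at hy
  linarith

end Averaging

section Sampling

variable {X : Type*} {n : ℕ}

/-- The value of the kernel `W` at the sample points joined by a non-loop `e`; loops get `0`. -/
def edgeVal (W : X → X → ℝ) (x : Fin n → X) (e : Sym2 (Fin n)) : ℝ :=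
  if e.IsDiag then 0 else W (x e.out.1) (x e.out.2)

/-- The average over pairs of distinct sample points of `|W - g|`. -/
def approxErr (W g : X → X → ℝ) (x : Fin n → X) : ℝ :=
  ((n : ℝ) ^ 2)⁻¹ * ∑ i, ∑ j, if i = j then 0 else |W (x i) (x j) - g (x i) (x j)|

/-- The normalized cycle sum of the deviations of the graph `G` from the sampled kernel. -/
def cycleErr (W : X → X → ℝ) (x : Fin n → X) (G : Sym2 (Fin n) → Bool) : ℝ :=
  ((n : ℝ) ^ 4)⁻¹ * cycleSum fun i j => edgeDev (edgeVal W x) G s(i, j)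

lemma edgeVal_of_not_isDiag {W : X → X → ℝ} (hW : ∀ a b, W a b = W b a) (x : Fin n → X)
    {i j : Fin n} (hij : i ≠ j) : edgeVal W x s(i, j) = W (x i) (x j) := by
  have hout : s((Quot.out s(i, j)).1, (Quot.out s(i, j)).2) = s(i, j) := Quot.out_eq _
  rw [edgeVal, if_neg (by simpa using hij)]
  rcases Sym2.eq_iff.1 hout with h | h
  · rw [h.1, h.2]
  · rw [h.1, h.2, hW]

lemma edgeVal_self (W : X → X → ℝ) (x : Fin n → X) (i : Fin n) : edgeVal W x s(i, i) = 0 := by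
  simp [edgeVal]

lemma approxErr_nonneg (W g : X → X → ℝ) (x : Fin n → X) : 0 ≤ approxErr W g x := by
  unfold approxErr
  refine mul_nonneg (by positivity) (Finset.sum_nonneg fun i _ => Finset.sum_nonneg fun j _ => ?_)
  split_ifs <;> positivity

lemma cycleErr_nonneg (W : X → X → ℝ) (x : Fin n → X) (G : Sym2 (Fin n) → Bool) :
    0 ≤ cycleErr W x G :=
  mul_nonneg (by positivity) (cycleSum_nonneg _)

variable [MeasurableSpace X] {ν : Measure X} {W V : X → X → ℝ}

/-- The average of `f` over the sample, squared distance to the mean. -/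
def avgErr (ν : Measure X) (f : X → ℝ) (x : Fin n → X) : ℝ :=
  ((n : ℝ)⁻¹ * ∑ i, f (x i) - ∫ a, f a ∂ν) ^ 2

lemma avgErr_nonneg (f : X → ℝ) (x : Fin n → X) : 0 ≤ avgErr ν f x := sq_nonneg _

lemma edgeVal_nonneg (h : IsBoundedKernel W 1) (x : Fin n → X) (e : Sym2 (Fin n)) :
    0 ≤ edgeVal W x e := by
  unfold edgeVal; split_ifs; exacts [le_rfl, h.nonneg _ _]

lemma edgeVal_le_one (h : IsBoundedKernel W 1) (x : Fin n → X) (e : Sym2 (Fin n)) :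
    edgeVal W x e ≤ 1 := by
  unfold edgeVal; split_ifs; exacts [zero_le_one, h.le _ _]

lemma measurable_edgeVal (h : IsBoundedKernel W 1) (e : Sym2 (Fin n)) :
    Measurable (fun x : Fin n → X => edgeVal W x e) := by
  unfold edgeVal
  split_ifs
  · exact measurable_const
  · have hpair : Measurable fun x : Fin n → X => (x e.out.1, x e.out.2) :=
      (measurable_pi_apply _).prodMk (measurable_pi_apply _)
    exact h.measurable.comp hpair

lemma measurable_graphWeight_edgeVal (h : IsBoundedKernel W 1) (G : Sym2 (Fin n) → Bool) :
    Measurable (fun x : Fin n → X => graphWeight (edgeVal W x) G) := by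
  unfold graphWeight
  refine Finset.measurable_prod _ fun e _ => ?_
  split_ifs
  · exact measurable_edgeVal h e
  · exact (measurable_edgeVal h e).const_sub 1

lemma graphWeight_edgeVal_nonneg (h : IsBoundedKernel W 1) (G : Sym2 (Fin n) → Bool)
    (x : Fin n → X) : 0 ≤ graphWeight (edgeVal W x) G :=
  graphWeight_nonneg (edgeVal_nonneg h x) (edgeVal_le_one h x) G

lemma norm_graphWeight_edgeVal_le (h : IsBoundedKernel W 1) (G : Sym2 (Fin n) → Bool)
    (x : Fin n → X) : ‖graphWeight (edgeVal W x) G‖ ≤ 1 := by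
  rw [Real.norm_of_nonneg (graphWeight_edgeVal_nonneg h G x)]
  exact graphWeight_le_one (edgeVal_nonneg h x) (edgeVal_le_one h x) G

lemma integrable_mul_graphWeight (h : IsBoundedKernel W 1) {φ : (Fin n → X) → ℝ}
    (hφ : Integrable φ (Measure.pi fun _ => ν)) (G : Sym2 (Fin n) → Bool) :
    Integrable (fun x => φ x * graphWeight (edgeVal W x) G) (Measure.pi fun _ => ν) :=
  hφ.mul_bdd (c := 1) (measurable_graphWeight_edgeVal h G).aestronglyMeasurable
    (ae_of_all _ (norm_graphWeight_edgeVal_le h G))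

lemma sum_integral_mul_graphWeight (h : IsBoundedKernel W 1) {φ : (Fin n → X) → ℝ}
    (hφ : Integrable φ (Measure.pi fun _ => ν)) :
    ∑ G, ∫ x, φ x * graphWeight (edgeVal W x) G ∂(Measure.pi fun _ => ν) =
      ∫ x, φ x ∂(Measure.pi fun _ => ν) := by
  rw [← integral_finsetSum _ fun G _ => integrable_mul_graphWeight h hφ G]
  simp_rw [← Finset.mul_sum, sum_graphWeight, mul_one]

variable [IsProbabilityMeasure ν]

lemma integrable_graphWeight_edgeVal (h : IsBoundedKernel W 1) (G : Sym2 (Fin n) → Bool) :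
    Integrable (fun x : Fin n → X => graphWeight (edgeVal W x) G) (Measure.pi fun _ => ν) :=
  Integrable.of_bound (measurable_graphWeight_edgeVal h G).aestronglyMeasurable
    1 (ae_of_all _ (norm_graphWeight_edgeVal_le h G))

/-- Random graphs sampled from two kernels have the same distribution as soon as the moments
along loopless simple graphs agree. -/
lemma integral_graphWeight_eq (hW : IsBoundedKernel W 1) (hV : IsBoundedKernel V 1)
    (hmom : ∀ S : Finset (Sym2 (Fin n)), (∀ e ∈ S, ¬ e.IsDiag) →
      ∫ x, ∏ e ∈ S, edgeVal W x e ∂(Measure.pi fun _ => ν) =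
        ∫ x, ∏ e ∈ S, edgeVal V x e ∂(Measure.pi fun _ => ν)) (G : Sym2 (Fin n) → Bool) :
    ∫ x, graphWeight (edgeVal W x) G ∂(Measure.pi fun _ => ν) =
      ∫ x, graphWeight (edgeVal V x) G ∂(Measure.pi fun _ => ν) := by
  have hmom' : ∀ S : Finset (Sym2 (Fin n)),
      ∫ x, ∏ e ∈ S, edgeVal W x e ∂(Measure.pi fun _ => ν) =
        ∫ x, ∏ e ∈ S, edgeVal V x e ∂(Measure.pi fun _ => ν) := by
    intro S
    by_cases hS : ∀ e ∈ S, ¬ e.IsDiag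
    · exact hmom S hS
    · push Not at hS
      obtain ⟨e, heS, he⟩ := hS
      have hz : ∀ (U : X → X → ℝ) (x : Fin n → X), ∏ e ∈ S, edgeVal U x e = 0 := fun U x =>
        Finset.prod_eq_zero heS (by simp [edgeVal, he])
      simp_rw [hz]
  have hexp : ∀ {U : X → X → ℝ}, IsBoundedKernel U 1 →
      ∫ x, graphWeight (edgeVal U x) G ∂(Measure.pi fun _ => ν) =
      ∑ S ∈ (Finset.univ : Finset (Sym2 (Fin n))).powerset,
        ((∏ e ∈ S, if G e then (1 : ℝ) else -1) *
          ∏ e ∈ Finset.univ \ S, if G e then (0 : ℝ) else 1) *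
          ∫ x, ∏ e ∈ S, edgeVal U x e ∂(Measure.pi fun _ => ν) := by
    intro U hU
    have hpt : ∀ x : Fin n → X, graphWeight (edgeVal U x) G =
        ∑ S ∈ (Finset.univ : Finset (Sym2 (Fin n))).powerset,
        ((∏ e ∈ S, if G e then (1 : ℝ) else -1) *
          ∏ e ∈ Finset.univ \ S, if G e then (0 : ℝ) else 1) *
          ∏ e ∈ S, edgeVal U x e := by
      intro x
      have : graphWeight (edgeVal U x) G = ∏ e, ((if G e then (1 : ℝ) else -1) * edgeVal U x e +
          (if G e then (0 : ℝ) else 1)) :=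
        Finset.prod_congr rfl fun e _ => by split_ifs <;> ring
      rw [this, Finset.prod_add]
      refine Finset.sum_congr rfl fun S _ => ?_
      rw [Finset.prod_mul_distrib]
      ring
    simp_rw [hpt]
    rw [integral_finsetSum]
    · simp_rw [integral_const_mul]
    · intro S _
      refine Integrable.const_mul (Integrable.of_bound
        (Finset.measurable_prod _ fun e _ => measurable_edgeVal hU e).aestronglyMeasurable 1
        (ae_of_all _ fun x => ?_)) _
      rw [norm_prod]
      refine Finset.prod_le_one (fun _ _ => norm_nonneg _) fun e _ => ?_
      rw [Real.norm_of_nonneg (edgeVal_nonneg hU x e)]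
      exact edgeVal_le_one hU x e
  rw [hexp hW, hexp hV]
  simp_rw [hmom']

/-- Two distinct coordinates of an i.i.d. sample are distributed according to `ν × ν`. -/
lemma measurePreserving_pair {i j : Fin n} (hij : i ≠ j) :
    MeasurePreserving (fun x : Fin n → X => (x i, x j)) (Measure.pi fun _ => ν) (ν.prod ν) := by
  refine ⟨(measurable_pi_apply i).prodMk (measurable_pi_apply j), ?_⟩
  have hind := (ProbabilityTheory.iIndepFun_pi (μ := fun _ : Fin n => ν)
    (X := fun _ => (id : X → X)) fun _ => aemeasurable_id).indepFun hij
  have := (ProbabilityTheory.indepFun_iff_map_prod_eq_prod_map_map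
    (measurable_pi_apply i).aemeasurable (measurable_pi_apply j).aemeasurable).1 hind
  refine this.trans ?_
  have hev : ∀ i : Fin n, Measure.map (fun x : Fin n → X => x i) (Measure.pi fun _ => ν) = ν :=
    fun i => (measurePreserving_eval (fun _ : Fin n => ν) i).map_eq
  exact congrArg₂ _ (hev i) (hev j)

lemma integral_comp_pair {i j : Fin n} (hij : i ≠ j) {F : X × X → ℝ}
    (hF : AEStronglyMeasurable F (ν.prod ν)) :
    ∫ x : Fin n → X, F (x i, x j) ∂(Measure.pi fun _ => ν) = ∫ p, F p ∂(ν.prod ν) := by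
  have h := measurePreserving_pair (ν := ν) hij
  rw [← h.map_eq, integral_map h.measurable.aemeasurable (by rwa [h.map_eq])]

lemma integrable_pair {i j : Fin n} (hij : i ≠ j) {F : X × X → ℝ} (hF : Integrable F (ν.prod ν)) :
    Integrable (fun x : Fin n → X => F (x i, x j)) (Measure.pi fun _ => ν) :=
  (measurePreserving_pair hij).integrable_comp_of_integrable hF

lemma integrable_approxErr {g : X → X → ℝ}
    (h_int : Integrable (fun p : X × X => |W p.1 p.2 - g p.1 p.2|) (ν.prod ν)) :
    Integrable (fun x : Fin n → X => approxErr W g x) (Measure.pi fun _ => ν) := by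
  refine Integrable.const_mul (integrable_finsetSum _ fun i _ =>
    integrable_finsetSum _ fun j _ => ?_) _
  by_cases hij : i = j
  · simp [hij]
  · simpa [hij] using integrable_pair hij h_int

lemma integral_approxErr_le {g : X → X → ℝ}
    (h_int : Integrable (fun p : X × X => |W p.1 p.2 - g p.1 p.2|) (ν.prod ν)) :
    ∫ x : Fin n → X, approxErr W g x ∂(Measure.pi fun _ => ν) ≤
      ∫ p, |W p.1 p.2 - g p.1 p.2| ∂(ν.prod ν) := by
  set I := ∫ p, |W p.1 p.2 - g p.1 p.2| ∂(ν.prod ν)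
  have hI : 0 ≤ I := integral_nonneg fun _ => abs_nonneg _
  have hterm : ∀ i j : Fin n, Integrable (fun x : Fin n → X =>
      if i = j then 0 else |W (x i) (x j) - g (x i) (x j)|) (Measure.pi fun _ => ν) := by
    intro i j
    by_cases hij : i = j
    · simp [hij]
    · simpa [hij] using integrable_pair hij h_int
  have hval : ∀ i j : Fin n, ∫ x : Fin n → X,
      (if i = j then 0 else |W (x i) (x j) - g (x i) (x j)|) ∂(Measure.pi fun _ => ν) ≤ I := by
    intro i j
    by_cases hij : i = j
    · simpa [hij] using hI
    · simp only [hij, if_false]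
      exact (integral_comp_pair hij h_int.1).le
  unfold approxErr
  rw [integral_const_mul, integral_finsetSum _ fun i _ => integrable_finsetSum _ fun j _ =>
    hterm i j]
  simp_rw [integral_finsetSum _ fun j _ => hterm _ j]
  have hsum : ∑ i : Fin n, ∑ j : Fin n, ∫ x : Fin n → X,
      (if i = j then 0 else |W (x i) (x j) - g (x i) (x j)|) ∂(Measure.pi fun _ => ν) ≤
      (n : ℝ) ^ 2 * I := by
    calc _ ≤ ∑ _i : Fin n, ∑ _j : Fin n, I :=
          Finset.sum_le_sum fun i _ => Finset.sum_le_sum fun j _ => hval i j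
      _ = _ := by simp; ring
  calc _ ≤ ((n : ℝ) ^ 2)⁻¹ * ((n : ℝ) ^ 2 * I) := by gcongr
    _ ≤ I := by
      rw [← mul_assoc]
      exact mul_le_of_le_one_left hI inv_mul_le_one

lemma abs_integral_le_one {f : X → ℝ} (hf1 : ∀ a, |f a| ≤ 1) : |∫ a, f a ∂ν| ≤ 1 := by
  have := norm_integral_le_of_norm_le_const (μ := ν) (f := f) (C := 1) (ae_of_all _ hf1)
  simpa using this

lemma integrable_avgErr {f : X → ℝ} (hf : Measurable f) (hf1 : ∀ a, |f a| ≤ 1) :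
    Integrable (fun x : Fin n → X => avgErr ν f x) (Measure.pi fun _ => ν) := by
  unfold avgErr
  refine Integrable.of_bound (C := (((n : ℝ)⁻¹ * n) + 1) ^ 2) ?_ (ae_of_all _ fun x => ?_)
  · exact ((((Finset.measurable_sum _ fun i _ => hf.comp (measurable_pi_apply i)).const_mul
      _).sub_const _).pow_const 2).aestronglyMeasurable
  · rw [norm_pow]
    refine pow_le_pow_left₀ (norm_nonneg _) ((norm_sub_le _ _).trans (add_le_add ?_ ?_)) 2
    · rw [norm_mul, Real.norm_of_nonneg (by positivity)]
      refine mul_le_mul_of_nonneg_left ?_ (by positivity)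
      calc ‖∑ i, f (x i)‖ ≤ ∑ _i : Fin n, (1 : ℝ) := norm_sum_le_of_le _ fun i _ => hf1 _
        _ = n := by simp
    · exact abs_integral_le_one hf1

/-- The weak law of large numbers, in quadratic mean. -/
lemma integral_avgErr_le {f : X → ℝ} (hn : 0 < n) (hf : Measurable f) (hf1 : ∀ a, |f a| ≤ 1) :
    ∫ x : Fin n → X, avgErr ν f x ∂(Measure.pi fun _ => ν) ≤ 4 / n := by
  set c := ∫ a, f a ∂ν with hc
  have hn' : (n : ℝ) ≠ 0 := by positivity
  have hb : ∀ a, |f a - c| ≤ 2 := fun a => by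
    have := abs_sub (f a) c
    linarith [hf1 a, abs_integral_le_one (ν := ν) hf1]
  have hfc : Measurable fun a => f a - c := hf.sub_const c
  have hpt : ∀ x : Fin n → X, avgErr ν f x =
      ((n : ℝ) ^ 2)⁻¹ * ∑ i, ∑ j, (f (x i) - c) * (f (x j) - c) := by
    intro x
    rw [← Finset.sum_mul_sum, Finset.sum_sub_distrib, avgErr, ← hc]
    simp
    field_simp
  have hFint : Integrable (fun p : X × X => (f p.1 - c) * (f p.2 - c)) (ν.prod ν) := by
    have : Integrable (fun a => f a - c) ν :=
      Integrable.of_bound hfc.aestronglyMeasurable 2 (ae_of_all _ hb)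
    exact this.mul_prod this
  have hF0 : ∫ p : X × X, (f p.1 - c) * (f p.2 - c) ∂(ν.prod ν) = 0 := by
    rw [integral_prod_mul (fun a => f a - c) (fun a => f a - c), integral_sub
      (Integrable.of_bound hf.aestronglyMeasurable 1 (ae_of_all _ hf1)) (integrable_const _)]
    simp [← hc]
  have hterm : ∀ i j : Fin n, Integrable (fun x : Fin n → X => (f (x i) - c) * (f (x j) - c))
      (Measure.pi fun _ => ν) := fun i j => by
    refine Integrable.of_bound ((hfc.comp (measurable_pi_apply i)).mul
      (hfc.comp (measurable_pi_apply j))).aestronglyMeasurable (2 * 2) (ae_of_all _ fun x => ?_)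
    rw [norm_mul]
    exact mul_le_mul (hb _) (hb _) (norm_nonneg _) (by norm_num)
  have hval : ∀ i j : Fin n, ∫ x : Fin n → X, (f (x i) - c) * (f (x j) - c)
      ∂(Measure.pi fun _ => ν) ≤ if i = j then 4 else 0 := by
    intro i j
    split_ifs with hij
    · have := norm_integral_le_of_norm_le_const (μ := Measure.pi fun _ : Fin n => ν) (C := 2 * 2)
        (f := fun x : Fin n → X => (f (x i) - c) * (f (x j) - c)) (ae_of_all _ fun x => by
          rw [norm_mul]
          exact mul_le_mul (hb _) (hb _) (norm_nonneg _) (by norm_num))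
      rw [probReal_univ] at this
      linarith [Real.le_norm_self (∫ x : Fin n → X, (f (x i) - c) * (f (x j) - c)
        ∂(Measure.pi fun _ => ν))]
    · rw [integral_comp_pair (F := fun p : X × X => (f p.1 - c) * (f p.2 - c)) hij hFint.1, hF0]
  simp_rw [hpt]
  rw [integral_const_mul, integral_finsetSum _ fun i _ => integrable_finsetSum _ fun j _ =>
    hterm i j]
  simp_rw [integral_finsetSum _ fun j _ => hterm _ j]
  calc _ ≤ ((n : ℝ) ^ 2)⁻¹ * ∑ i : Fin n, ∑ j : Fin n, (if i = j then (4 : ℝ) else 0) := by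
        gcongr with i _ j _
        exact hval i j
    _ = 4 / n := by
        simp
        field_simp

lemma integrable_cycleErr (h : IsBoundedKernel W 1) (G : Sym2 (Fin n) → Bool) :
    Integrable (fun x : Fin n → X => cycleErr W x G) (Measure.pi fun _ => ν) := by
  unfold cycleErr cycleSum
  have hm : ∀ e, Measurable (fun x : Fin n → X => edgeDev (edgeVal W x) G e) := fun e =>
    (measurable_edgeVal h e).const_sub _
  refine Integrable.const_mul (integrable_finsetSum _ fun j _ =>
    integrable_finsetSum _ fun j' _ => ?_) _
  refine Integrable.of_bound (C := (n : ℝ) ^ 2) ?_ (ae_of_all _ fun x => ?_)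
  · exact ((Finset.measurable_sum _ fun i _ =>
      (hm _).mul (hm _)).pow_const 2).aestronglyMeasurable
  · rw [norm_pow]
    refine pow_le_pow_left₀ (norm_nonneg _) ?_ 2
    calc _ ≤ ∑ _i : Fin n, (1 : ℝ) := norm_sum_le_of_le _ fun i _ => by
          have := abs_edgeDev_le (edgeVal_nonneg h x) (edgeVal_le_one h x) G
          rw [norm_mul]
          exact mul_le_one₀ (this _) (norm_nonneg _) (this _)
      _ = n := by simp

lemma sum_integral_cycleErr_le (hn : 0 < n) (h : IsBoundedKernel W 1) :
    ∑ G, ∫ x : Fin n → X, cycleErr W x G * graphWeight (edgeVal W x) G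
      ∂(Measure.pi fun _ => ν) ≤ 2 / n := by
  have hn' : (n : ℝ) ≠ 0 := by positivity
  rw [← integral_finsetSum _ fun G _ => integrable_mul_graphWeight h (integrable_cycleErr h G) G]
  have hle : ∀ x : Fin n → X, ∑ G, cycleErr W x G * graphWeight (edgeVal W x) G ≤ 2 / n := by
    intro x
    have := sum_graphWeight_mul_cycleSum_le (edgeVal_nonneg h x) (edgeVal_le_one h x)
    calc _ = ((n : ℝ) ^ 4)⁻¹ * ∑ G, graphWeight (edgeVal W x) G *
          cycleSum (fun i j => edgeDev (edgeVal W x) G s(i, j)) := by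
          rw [Finset.mul_sum]
          exact Finset.sum_congr rfl fun G _ => by rw [cycleErr]; ring
      _ ≤ ((n : ℝ) ^ 4)⁻¹ * (2 * (n : ℝ) ^ 3) := by gcongr
      _ = 2 / n := by field_simp
  calc _ ≤ ∫ _x : Fin n → X, (2 / n : ℝ) ∂(Measure.pi fun _ => ν) :=
        integral_mono (integrable_finsetSum _ fun G _ =>
          integrable_mul_graphWeight h (integrable_cycleErr h G) G) (integrable_const _) hle
    _ = 2 / n := by simp

end Sampling

section CoupledSamples

variable {X : Type*} [MeasurableSpace X] {ν : Measure X} {W W₁ W₂ : X → X → ℝ} {n : ℕ}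

/-- The part of the total cost of a sample that does not involve the graph. -/
def pointCost (ν : Measure X) (W : X → X → ℝ) (g : ℕ → X → X → ℝ) (f : ℕ → X → ℝ)
    (x : Fin n → X) : ℝ :=
  ∑ j ∈ Finset.range n, (1 / 2 : ℝ) ^ (j + 1) *
    (8 ^ j * approxErr W (g j) x + n * avgErr ν (f j) x)

lemma pointCost_nonneg (g : ℕ → X → X → ℝ) (f : ℕ → X → ℝ) (x : Fin n → X) :
    0 ≤ pointCost ν W g f x :=
  Finset.sum_nonneg fun j _ => mul_nonneg (by positivity)
    (add_nonneg (mul_nonneg (by positivity) (approxErr_nonneg _ _ _))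
      (mul_nonneg (by positivity) (avgErr_nonneg _ _)))

lemma le_pointCost (g : ℕ → X → X → ℝ) (f : ℕ → X → ℝ) (x : Fin n → X) {j : ℕ} (hj : j < n) :
    (1 / 2 : ℝ) ^ (j + 1) * (8 ^ j * approxErr W (g j) x + n * avgErr ν (f j) x) ≤
      pointCost ν W g f x :=
  Finset.single_le_sum (f := fun j => (1 / 2 : ℝ) ^ (j + 1) *
    (8 ^ j * approxErr W (g j) x + n * avgErr ν (f j) x))
    (fun j _ => mul_nonneg (by positivity)
      (add_nonneg (mul_nonneg (by positivity) (approxErr_nonneg _ _ _))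
        (mul_nonneg (by positivity) (avgErr_nonneg _ _)))) (Finset.mem_range.2 hj)

variable [IsProbabilityMeasure ν]

lemma integrable_pointCost {g : ℕ → X → X → ℝ} {f : ℕ → X → ℝ}
    (hg : ∀ j, Integrable (fun p : X × X => |W p.1 p.2 - g j p.1 p.2|) (ν.prod ν))
    (hf : ∀ j, Measurable (f j)) (hf1 : ∀ j a, |f j a| ≤ 1) :
    Integrable (fun x : Fin n → X => pointCost ν W g f x) (Measure.pi fun _ => ν) :=
  integrable_finsetSum _ fun j _ => (((integrable_approxErr (hg j)).const_mul _).add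
    ((integrable_avgErr (hf j) (hf1 j)).const_mul _)).const_mul _

lemma integral_pointCost_le {g : ℕ → X → X → ℝ} {f : ℕ → X → ℝ} (hn : 0 < n)
    (hg : ∀ j, Integrable (fun p : X × X => |W p.1 p.2 - g j p.1 p.2|) (ν.prod ν))
    (hg8 : ∀ j, ∫ p, |W p.1 p.2 - g j p.1 p.2| ∂(ν.prod ν) ≤ (1 / 8) ^ j)
    (hf : ∀ j, Measurable (f j)) (hf1 : ∀ j a, |f j a| ≤ 1) :
    ∫ x : Fin n → X, pointCost ν W g f x ∂(Measure.pi fun _ => ν) ≤ 5 := by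
  have hn' : (0 : ℝ) < n := by exact_mod_cast hn
  have ha := fun j => (integrable_approxErr (n := n) (hg j)).const_mul ((8 : ℝ) ^ j)
  have hb := fun j => (integrable_avgErr (n := n) (ν := ν) (hf j) (hf1 j)).const_mul (n : ℝ)
  have hab : ∀ j, Integrable (fun x : Fin n → X => (1 / 2 : ℝ) ^ (j + 1) *
      (8 ^ j * approxErr W (g j) x + n * avgErr ν (f j) x)) (Measure.pi fun _ => ν) :=
    fun j => ((ha j).add (hb j)).const_mul _
  unfold pointCost
  rw [integral_finsetSum _ fun j _ => hab j]
  calc _ ≤ ∑ j ∈ Finset.range n, (1 / 2 : ℝ) ^ (j + 1) * 5 := by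
        refine Finset.sum_le_sum fun j _ => ?_
        rw [integral_const_mul]
        refine mul_le_mul_of_nonneg_left ?_ (by positivity)
        rw [integral_add (ha j) (hb j), integral_const_mul, integral_const_mul]
        have h1 : (8 : ℝ) ^ j * ∫ x : Fin n → X, approxErr W (g j) x ∂(Measure.pi fun _ => ν)
            ≤ 1 := by
          calc _ ≤ (8 : ℝ) ^ j * (1 / 8) ^ j := by
                gcongr
                exact (integral_approxErr_le (hg j)).trans (hg8 j)
            _ = 1 := by rw [← mul_pow]; norm_num
        have h2 : (n : ℝ) * ∫ x : Fin n → X, avgErr ν (f j) x ∂(Measure.pi fun _ => ν) ≤ 4 := by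
          calc _ ≤ (n : ℝ) * (4 / n) := by
                gcongr
                exact integral_avgErr_le hn (hf j) (hf1 j)
            _ = 4 := by field_simp
        linarith
    _ = 5 * (1 / 2) * ∑ j ∈ Finset.range n, (1 / 2 : ℝ) ^ j := by
        rw [Finset.mul_sum]
        exact Finset.sum_congr rfl fun j _ => by ring
    _ ≤ 5 := by
        have := sum_geometric_two_le n
        linarith

/-- If two kernels have the same moments, then there are samples of both of them which are
simultaneously typical and close to the same graph. -/
theorem exists_coupled_samples (hW₁ : IsBoundedKernel W₁ 1) (hW₂ : IsBoundedKernel W₂ 1)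
    (hn : 0 < n)
    (hmom : ∀ S : Finset (Sym2 (Fin n)), (∀ e ∈ S, ¬ e.IsDiag) →
      ∫ x, ∏ e ∈ S, edgeVal W₁ x e ∂(Measure.pi fun _ => ν) =
        ∫ x, ∏ e ∈ S, edgeVal W₂ x e ∂(Measure.pi fun _ => ν))
    {g h : ℕ → X → X → ℝ} {f : ℕ → X → ℝ}
    (hg : ∀ j, Integrable (fun p : X × X => |W₁ p.1 p.2 - g j p.1 p.2|) (ν.prod ν))
    (hg8 : ∀ j, ∫ p, |W₁ p.1 p.2 - g j p.1 p.2| ∂(ν.prod ν) ≤ (1 / 8) ^ j)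
    (hh : ∀ j, Integrable (fun p : X × X => |W₂ p.1 p.2 - h j p.1 p.2|) (ν.prod ν))
    (hh8 : ∀ j, ∫ p, |W₂ p.1 p.2 - h j p.1 p.2| ∂(ν.prod ν) ≤ (1 / 8) ^ j)
    (hf : ∀ j, Measurable (f j)) (hf1 : ∀ j a, |f j a| ≤ 1) :
    ∃ (G : Sym2 (Fin n) → Bool) (x y : Fin n → X),
      (cycleErr W₁ x G ≤ 14 / n ∧ cycleErr W₂ y G ≤ 14 / n) ∧ ∀ j < n,
        (approxErr W₁ (g j) x ≤ 28 * (1 / 4) ^ j ∧ approxErr W₂ (h j) y ≤ 28 * (1 / 4) ^ j) ∧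
        avgErr ν (f j) x ≤ 28 * 2 ^ j / n ∧ avgErr ν (f j) y ≤ 28 * 2 ^ j / n := by
  have hn' : (0 : ℝ) < n := by exact_mod_cast hn
  have hexp : ∀ {W : X → X → ℝ} (_ : IsBoundedKernel W 1) {g : ℕ → X → X → ℝ}
      (_ : ∀ j, Integrable (fun p : X × X => |W p.1 p.2 - g j p.1 p.2|) (ν.prod ν))
      (_ : ∀ j, ∫ p, |W p.1 p.2 - g j p.1 p.2| ∂(ν.prod ν) ≤ (1 / 8) ^ j),
      (∀ G : Sym2 (Fin n) → Bool, Integrable (fun x : Fin n → X =>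
        (pointCost ν W g f x + n * cycleErr W x G) * graphWeight (edgeVal W x) G)
          (Measure.pi fun _ => ν)) ∧
      ∑ G : Sym2 (Fin n) → Bool, ∫ x : Fin n → X,
        (pointCost ν W g f x + n * cycleErr W x G) * graphWeight (edgeVal W x) G
          ∂(Measure.pi fun _ => ν) ≤ 7 := by
    intro W hW g hg hg8
    have hp := integrable_pointCost (n := n) hg hf hf1
    have hc := fun G => integrable_cycleErr (n := n) (ν := ν) hW G
    have hpG := fun G => integrable_mul_graphWeight hW hp G
    have hcG := fun G => (integrable_mul_graphWeight hW (hc G) G).const_mul (n : ℝ)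
    have heq : ∀ (G : Sym2 (Fin n) → Bool) (x : Fin n → X),
        (pointCost ν W g f x + n * cycleErr W x G) * graphWeight (edgeVal W x) G =
        pointCost ν W g f x * graphWeight (edgeVal W x) G +
          n * (cycleErr W x G * graphWeight (edgeVal W x) G) := fun G x => by ring
    simp_rw [heq]
    refine ⟨fun G => (hpG G).add (hcG G), ?_⟩
    simp_rw [fun G => integral_add (hpG G) (hcG G), integral_const_mul]
    rw [Finset.sum_add_distrib, ← Finset.mul_sum, sum_integral_mul_graphWeight hW hp]
    have h1 := integral_pointCost_le hn hg hg8 hf hf1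
    have h2 : (n : ℝ) * ∑ G : Sym2 (Fin n) → Bool, ∫ x : Fin n → X,
        cycleErr W x G * graphWeight (edgeVal W x) G ∂(Measure.pi fun _ => ν) ≤ 2 := by
      calc _ ≤ (n : ℝ) * (2 / n) := by
            gcongr
            exact sum_integral_cycleErr_le hn hW
        _ = 2 := by field_simp
    linarith
  have hone : ∑ G : Sym2 (Fin n) → Bool, ∫ x : Fin n → X, graphWeight (edgeVal W₁ x) G
      ∂(Measure.pi fun _ => ν) = 1 := by
    have := sum_integral_mul_graphWeight (n := n) (ν := ν) hW₁ (φ := fun _ => 1)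
      (integrable_const _)
    simpa using this
  obtain ⟨G, x, y, hxy⟩ := exists_common_label (P := Measure.pi fun _ : Fin n => ν) (B := 14)
    (fun G x => graphWeight_edgeVal_nonneg hW₁ G x)
    (fun G x => graphWeight_edgeVal_nonneg hW₂ G x)
    (fun G => integrable_graphWeight_edgeVal hW₁ G) (fun G => integrable_graphWeight_edgeVal hW₂ G)
    (hexp hW₁ hg hg8).1 (hexp hW₂ hh hh8).1 (integral_graphWeight_eq hW₁ hW₂ hmom) hone
    (by linarith [(hexp hW₁ hg hg8).2, (hexp hW₂ hh hh8).2])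
  have hp1 := pointCost_nonneg (ν := ν) (W := W₁) g f x
  have hp2 := pointCost_nonneg (ν := ν) (W := W₂) h f y
  have hc1 := mul_nonneg hn'.le (cycleErr_nonneg W₁ x G)
  have hc2 := mul_nonneg hn'.le (cycleErr_nonneg W₂ y G)
  have hcost : ∀ {W : X → X → ℝ} {g : ℕ → X → X → ℝ} {x : Fin n → X},
      pointCost ν W g f x ≤ 14 → ∀ j < n,
        approxErr W (g j) x ≤ 28 * (1 / 4) ^ j ∧ avgErr ν (f j) x ≤ 28 * 2 ^ j / n := by
    intro W g x hle j hj
    have h1 := (le_pointCost (ν := ν) (W := W) g f x hj).trans hle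
    have h2 : 8 ^ j * approxErr W (g j) x + n * avgErr ν (f j) x ≤ 28 * 2 ^ j := by
      rw [one_div, inv_pow, inv_mul_le_iff₀ (by positivity)] at h1
      rw [pow_succ] at h1
      linarith
    have ha := mul_nonneg (pow_nonneg (by norm_num : (0 : ℝ) ≤ 8) j) (approxErr_nonneg W (g j) x)
    have hb := mul_nonneg hn'.le (avgErr_nonneg (ν := ν) (f j) x)
    constructor
    · refine le_of_mul_le_mul_left ?_ (by positivity : (0 : ℝ) < 8 ^ j)
      calc _ ≤ 28 * (2 : ℝ) ^ j := by linarith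
        _ = 8 ^ j * (28 * (1 / 4) ^ j) := by
          rw [mul_left_comm, ← mul_pow]; norm_num
    · rw [le_div_iff₀ hn']
      linarith
  refine ⟨G, x, y, ⟨?_, ?_⟩, fun j hj => ?_⟩
  · rw [le_div_iff₀ hn']; linarith
  · rw [le_div_iff₀ hn']; linarith
  · have h1 := hcost (by linarith : pointCost ν W₁ g f x ≤ 14) j hj
    have h2 := hcost (by linarith : pointCost ν W₂ h f y ≤ 14) j hj
    exact ⟨⟨h1.1, h2.1⟩, h1.2, h2.2⟩

end CoupledSamples

section Bilinear

variable {X : Type*} {n : ℕ}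

lemma abs_sum_mul_edgeDev_le {W : X → X → ℝ} {x : Fin n → X} {G : Sym2 (Fin n) → Bool}
    {s t : Fin n → ℝ} (hs : ∀ i, |s i| ≤ 1) (ht : ∀ i, |t i| ≤ 1) {ε : ℝ} (hε : 0 ≤ ε)
    (hc : cycleErr W x G ≤ ε ^ 4) :
    |∑ i, ∑ j, s i * t j * edgeDev (edgeVal W x) G s(i, j)| ≤ (n : ℝ) ^ 2 * ε := by
  rcases Nat.eq_zero_or_pos n with rfl | hn
  · simp
  have hn' : (0 : ℝ) < n := by exact_mod_cast hn
  have h4 := bilin_pow_four_le (fun i j => edgeDev (edgeVal W x) G s(i, j)) hs ht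
  rw [cycleErr, inv_mul_le_iff₀ (by positivity)] at hc
  refine abs_le_of_sq_le_sq ?_ (by positivity)
  refine le_of_sq_le_sq ?_ (by positivity)
  calc _ = (∑ i, ∑ j, s i * t j * edgeDev (edgeVal W x) G s(i, j)) ^ 4 := by ring
    _ ≤ (n : ℝ) ^ 4 * ((n : ℝ) ^ 4 * ε ^ 4) := h4.trans (by gcongr)
    _ = _ := by ring

lemma abs_sum_mul_sub_edgeVal_le {W g : X → X → ℝ} (hW : ∀ a b, W a b = W b a) {K : ℝ}
    (hg : ∀ a b, |g a b| ≤ K) (x : Fin n → X) {s t : Fin n → ℝ} (hs : ∀ i, |s i| ≤ 1)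
    (ht : ∀ i, |t i| ≤ 1) :
    |∑ i, ∑ j, s i * t j * (g (x i) (x j) - edgeVal W x s(i, j))| ≤
      (n : ℝ) ^ 2 * approxErr W g x + n * K := by
  rcases Nat.eq_zero_or_pos n with rfl | hn
  · simp
  have hn' : (0 : ℝ) < n := by exact_mod_cast hn
  calc _ ≤ ∑ i, ∑ j, |s i * t j * (g (x i) (x j) - edgeVal W x s(i, j))| :=
        (Finset.abs_sum_le_sum_abs _ _).trans
          (Finset.sum_le_sum fun i _ => Finset.abs_sum_le_sum_abs _ _)
    _ ≤ ∑ i, ∑ j, ((if i = j then 0 else |W (x i) (x j) - g (x i) (x j)|) +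
          if i = j then K else 0) := by
        refine Finset.sum_le_sum fun i _ => Finset.sum_le_sum fun j _ => ?_
        have hst : |s i * t j| ≤ 1 := by
          rw [abs_mul]; exact mul_le_one₀ (hs i) (abs_nonneg _) (ht j)
        rw [abs_mul]
        refine (mul_le_of_le_one_left (abs_nonneg _) hst).trans ?_
        split_ifs with hij
        · subst hij
          simpa [edgeVal_self] using hg (x i) (x i)
        · rw [edgeVal_of_not_isDiag hW x hij, abs_sub_comm, add_zero]
    _ = _ := by
        simp_rw [Finset.sum_add_distrib]
        congr 1
        · rw [approxErr, mul_inv_cancel_left₀ (by positivity)]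
        · simp

/-- Two samples that are close to the same graph carry almost the same kernel. -/
lemma abs_average_sub_le {W₁ W₂ g h : X → X → ℝ} (hW₁ : ∀ a b, W₁ a b = W₁ b a)
    (hW₂ : ∀ a b, W₂ a b = W₂ b a) {K L : ℝ} (hg : ∀ a b, |g a b| ≤ K) (hh : ∀ a b, |h a b| ≤ L)
    (hn : 0 < n) {x y : Fin n → X} {G : Sym2 (Fin n) → Bool} {s t : Fin n → ℝ}
    (hs : ∀ i, |s i| ≤ 1) (ht : ∀ i, |t i| ≤ 1) {ε : ℝ} (hε : 0 ≤ ε)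
    (hc₁ : cycleErr W₁ x G ≤ ε ^ 4) (hc₂ : cycleErr W₂ y G ≤ ε ^ 4) :
    |((n : ℝ) ^ 2)⁻¹ * ∑ i, ∑ j, s i * t j * (g (x i) (x j) - h (y i) (y j))| ≤
      approxErr W₁ g x + approxErr W₂ h y + (K + L) / n + 2 * ε := by
  have hn' : (0 : ℝ) < n := by exact_mod_cast hn
  have h1 := abs_sum_mul_sub_edgeVal_le hW₁ hg x hs ht
  have h2 := abs_sum_mul_sub_edgeVal_le hW₂ hh y hs ht
  have h3 := abs_sum_mul_edgeDev_le hs ht hε hc₁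
  have h4 := abs_sum_mul_edgeDev_le hs ht hε hc₂
  have hdecomp : ∑ i, ∑ j, s i * t j * (g (x i) (x j) - h (y i) (y j)) =
      ∑ i, ∑ j, s i * t j * (g (x i) (x j) - edgeVal W₁ x s(i, j)) -
      ∑ i, ∑ j, s i * t j * (h (y i) (y j) - edgeVal W₂ y s(i, j)) -
      ∑ i, ∑ j, s i * t j * edgeDev (edgeVal W₁ x) G s(i, j) +
      ∑ i, ∑ j, s i * t j * edgeDev (edgeVal W₂ y) G s(i, j) := by
    simp_rw [← Finset.sum_sub_distrib, ← Finset.sum_add_distrib]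
    refine Finset.sum_congr rfl fun i _ => Finset.sum_congr rfl fun j _ => ?_
    unfold edgeDev
    ring
  rw [abs_mul, abs_of_pos (by positivity), inv_mul_le_iff₀ (by positivity), hdecomp]
  have hr : (n : ℝ) ^ 2 * (approxErr W₁ g x + approxErr W₂ h y + (K + L) / n + 2 * ε) =
      ((n : ℝ) ^ 2 * approxErr W₁ g x + n * K) + ((n : ℝ) ^ 2 * approxErr W₂ h y + n * L) +
        (n : ℝ) ^ 2 * ε + (n : ℝ) ^ 2 * ε := by
    field_simp
    ring
  rw [hr]
  rw [abs_le] at h1 h2 h3 h4 ⊢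
  constructor <;> linarith

end Bilinear

section Empirical

variable {E : Type*} [MeasurableSpace E] {n : ℕ}

/-- The empirical measure of a nonempty sample. -/
def empiricalMeasure (z : Fin (n + 1) → E) : ProbabilityMeasure E :=
  ⟨((n : ℝ≥0∞) + 1)⁻¹ • ∑ i, Measure.dirac (z i), ⟨by
    simp only [Measure.smul_apply, Measure.coe_finsetSum, Finset.sum_apply, measure_univ,
      Finset.sum_const, Finset.card_univ, Fintype.card_fin, smul_eq_mul, nsmul_eq_mul, mul_one]
    push_cast
    exact ENNReal.inv_mul_cancel (by simp) (by finiteness)⟩⟩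

lemma integral_empiricalMeasure (z : Fin (n + 1) → E) {f : E → ℝ} (hf : StronglyMeasurable f) :
    ∫ w, f w ∂(empiricalMeasure z : Measure E) = ((n + 1 : ℕ) : ℝ)⁻¹ * ∑ i, f (z i) := by
  have hcoe : (empiricalMeasure z : Measure E) =
      ((n : ℝ≥0∞) + 1)⁻¹ • ∑ i, Measure.dirac (z i) := rfl
  rw [hcoe, integral_smul_measure, integral_finsetSum_measure]
  · simp only [fun i => integral_dirac' f (z i) hf, ENNReal.toReal_inv, smul_eq_mul]
    congr 2
    rw [ENNReal.toReal_add (by simp) (by simp)]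
    simp
  · intro i _
    exact integrable_dirac' hf (by simp [enorm_lt_top])

lemma integral_empiricalMeasure_prod (z : Fin (n + 1) → E) {f : E × E → ℝ}
    (hf : StronglyMeasurable f)
    (h_int : Integrable f
      ((empiricalMeasure z : Measure E).prod (empiricalMeasure z : Measure E))) :
    ∫ w, f w ∂((empiricalMeasure z : Measure E).prod (empiricalMeasure z : Measure E)) =
      (((n + 1 : ℕ) : ℝ) ^ 2)⁻¹ * ∑ i, ∑ j, f (z i, z j) := by
  rw [integral_prod _ h_int, integral_empiricalMeasure z hf.integral_prod_right']
  simp_rw [fun i => integral_empiricalMeasure z (f := fun w => f (z i, w))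
    (hf.comp_measurable measurable_prodMk_left), ← Finset.mul_sum]
  rw [← mul_assoc]
  congr 1
  ring

end Empirical

section Determining

/-- Functions on a product are determined by their integrals against products of bounded
continuous functions. -/
lemma ae_eq_of_forall_integral_mul_mul_eq {Z T : Type*} [MeasurableSpace Z] [TopologicalSpace Z]
    [BorelSpace Z] [HasOuterApproxClosed Z] [MeasurableSpace T] [TopologicalSpace T] [BorelSpace T]
    [HasOuterApproxClosed T] {ξ : Measure (Z × T)} [IsFiniteMeasure ξ] {U V : Z × T → ℝ}
    (hU : Measurable U) (hV : Measurable V) (hU0 : ∀ p, 0 ≤ U p) (hV0 : ∀ p, 0 ≤ V p)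
    (hUi : Integrable U ξ) (hVi : Integrable V ξ)
    (h : ∀ (f : BoundedContinuousFunction Z ℝ) (g : BoundedContinuousFunction T ℝ),
      ∫ p, f p.1 * g p.2 * U p ∂ξ = ∫ p, f p.1 * g p.2 * V p ∂ξ) :
    ∀ᵐ p ∂ξ, U p = V p := by
  have hfin : ∀ {U : Z × T → ℝ}, Integrable U ξ →
      IsFiniteMeasure (ξ.withDensity fun p => ENNReal.ofReal (U p)) := fun hU =>
    isFiniteMeasure_withDensity_ofReal hU.2
  have := hfin hUi
  have := hfin hVi
  have h_int : ∀ {U : Z × T → ℝ}, Measurable U → (∀ p, 0 ≤ U p) → ∀ φ : Z × T → ℝ,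
      ∫ p, φ p ∂(ξ.withDensity fun p => ENNReal.ofReal (U p)) = ∫ p, φ p * U p ∂ξ := by
    intro U hU hU0 φ
    rw [integral_withDensity_eq_integral_toReal_smul hU.ennreal_ofReal (by simp)]
    refine integral_congr_ae (ae_of_all _ fun p => ?_)
    simp [ENNReal.toReal_ofReal (hU0 p), mul_comm]
  have heq : ξ.withDensity (fun p => ENNReal.ofReal (U p)) =
      ξ.withDensity fun p => ENNReal.ofReal (V p) :=
    Measure.ext_of_integral_mul_boundedContinuousFunction fun f g => by
      rw [h_int hU hU0, h_int hV hV0, h]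
  rw [withDensity_eq_iff_of_sigmaFinite hU.ennreal_ofReal.aemeasurable
    hV.ennreal_ofReal.aemeasurable] at heq
  filter_upwards [heq] with p hp
  exact (ENNReal.ofReal_eq_ofReal_iff (hU0 p) (hV0 p)).1 hp

variable {X : Type*} [MetricSpace X] [CompactSpace X] [MeasurableSpace X] [BorelSpace X]

lemma ContinuousMap.integrable_of_isFiniteMeasure (m : Measure X) [IsFiniteMeasure m]
    (f : C(X, ℝ)) : Integrable f m :=
  (BoundedContinuousFunction.mkOfCompact f).integrable m

/-- Probability measures on a compact space are determined by the integrals of a dense sequence of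
continuous functions. -/
lemma measure_eq_of_forall_integral_dense_eq {m m' : Measure X} [IsProbabilityMeasure m]
    [IsProbabilityMeasure m'] {D : Set C(X, ℝ)} (hD : Dense D)
    (h : ∀ f ∈ D, ∫ a, f a ∂m = ∫ a, f a ∂m') : m = m' := by
  have hcont : ∀ (m : Measure X) [IsProbabilityMeasure m],
      Continuous fun f : C(X, ℝ) => ∫ a, f a ∂m := by
    intro m _
    refine (LipschitzWith.of_dist_le_mul (K := 1) fun f g => ?_).continuous
    rw [dist_eq_norm, ← integral_sub (f.integrable_of_isFiniteMeasure m)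
      (g.integrable_of_isFiniteMeasure m)]
    have := norm_integral_le_of_norm_le_const (μ := m) (f := fun a => f a - g a)
      (C := dist f g) (ae_of_all _ fun a => by
        rw [← dist_eq_norm]; exact ContinuousMap.dist_apply_le_dist a)
    simpa using this
  have hall := Continuous.ext_on hD (hcont m) (hcont m') h
  refine ext_of_forall_integral_eq_of_IsFiniteMeasure fun f => ?_
  exact congrFun hall f.toContinuousMap

end Determining

section Coupling

open scoped Topology

/-- Approximation of a kernel transfers to couplings. -/
lemma abs_integral_mul_mul_sub_le {X Z : Type*} [MeasurableSpace X] [MeasurableSpace Z]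
    {ν : Measure X} [IsProbabilityMeasure ν] {W : X → X → ℝ} {m : Measure Z}
    [IsProbabilityMeasure m] {φ : Z → X} (hφ : MeasurePreserving φ m ν) {g : X × X → ℝ}
    (hg : Integrable (fun p : X × X => |W p.1 p.2 - g p|) (ν.prod ν)) {s t : Z → ℝ}
    (hs : ∀ z, |s z| ≤ 1) (ht : ∀ z, |t z| ≤ 1) :
    |∫ w, s w.1 * t w.2 * (W (φ w.1) (φ w.2) - g (φ w.1, φ w.2)) ∂(m.prod m)| ≤
      ∫ p, |W p.1 p.2 - g p| ∂(ν.prod ν) := by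
  have hφφ := hφ.prod hφ
  calc _ ≤ ∫ w, |W (φ w.1) (φ w.2) - g (φ w.1, φ w.2)| ∂(m.prod m) := by
        refine norm_integral_le_of_norm_le (G := ℝ) (hφφ.integrable_comp_of_integrable hg)
          (ae_of_all _ fun w => ?_)
        rw [norm_mul]
        refine mul_le_of_le_one_left (norm_nonneg _) ?_
        rw [norm_mul]
        exact mul_le_one₀ (hs _) (norm_nonneg _) (ht _)
    _ = _ := by
        rw [← hφφ.map_eq, integral_map hφφ.measurable.aemeasurable
          (by rw [hφφ.map_eq]; exact hg.1)]
        rfl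

variable {X : Type*} [MetricSpace X] [CompactSpace X] [MeasurableSpace X] [BorelSpace X]
  {ν : Measure X} [IsProbabilityMeasure ν] {W W₁ W₂ : X → X → ℝ}

/-- If the empirical averages of a dense sequence of functions converge to their means, then the
limit of the empirical measures has the right marginal. -/
lemma map_eq_of_tendsto_empiricalMeasure {φ : X × X → X} (hφ : Continuous φ)
    (z : ∀ n : ℕ, Fin (n + 1) → X × X) {u : Filter ℕ} [NeBot u] (hu : u ≤ atTop)
    {μ : ProbabilityMeasure (X × X)}
    (hlim : Tendsto (fun n => empiricalMeasure (z n)) u (𝓝 μ)) {d : ℕ → C(X, ℝ)}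
    (hd : DenseRange d) {B : ℕ → ℝ}
    (h : ∀ n j, j < n + 1 → avgErr ν (fun a => d j a / (1 + ‖d j‖)) (fun i => φ (z n i)) ≤
      B j / (n + 1 : ℕ)) :
    (μ : Measure (X × X)).map φ = ν := by
  have := Measure.isProbabilityMeasure_map (μ := (μ : Measure (X × X))) hφ.aemeasurable
  refine measure_eq_of_forall_integral_dense_eq hd ?_
  rintro _ ⟨j, rfl⟩
  rw [integral_map hφ.aemeasurable (d j).continuous.aestronglyMeasurable]
  have hc : (1 + ‖d j‖) ≠ 0 := by positivity
  let F : BoundedContinuousFunction (X × X) ℝ :=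
    BoundedContinuousFunction.mkOfCompact ⟨fun w => d j (φ w) / (1 + ‖d j‖), by fun_prop⟩
  have hF : ∀ w, F w = d j (φ w) / (1 + ‖d j‖) := fun _ => rfl
  have hlimF := (ProbabilityMeasure.tendsto_iff_forall_integral_tendsto.1 hlim) F
  have hsq : Tendsto (fun n => (∫ w, F w ∂(empiricalMeasure (z n) : Measure (X × X)) -
      ∫ a, d j a / (1 + ‖d j‖) ∂ν) ^ 2) u (𝓝 0) := by
    have hB : Tendsto (fun n : ℕ => B j / (n + 1 : ℕ)) u (𝓝 0) :=
      ((tendsto_const_div_atTop_nhds_zero_nat (B j)).comp (tendsto_add_atTop_nat 1)).mono_left hu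
    refine tendsto_of_tendsto_of_tendsto_of_le_of_le' tendsto_const_nhds hB
      (Eventually.of_forall fun n => sq_nonneg _) ?_
    filter_upwards [hu (eventually_ge_atTop j)] with n hn
    rw [integral_empiricalMeasure _ F.continuous.stronglyMeasurable]
    exact h n j (Nat.lt_succ_of_le hn)
  have heq := tendsto_nhds_unique hsq ((hlimF.sub_const _).pow 2)
  have h0 := pow_eq_zero_iff (two_ne_zero) |>.1 heq.symm
  simp_rw [hF, integral_div] at h0
  field_simp at h0
  linarith

lemma abs_integral_prod_le_of_tendsto {E : Type*} [MetricSpace E] [CompactSpace E]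
    [MeasurableSpace E] [BorelSpace E] {μs : ℕ → ProbabilityMeasure E} {μ : ProbabilityMeasure E}
    {u : Filter ℕ} [NeBot u] (hlim : Tendsto μs u (𝓝 μ)) (F : BoundedContinuousFunction (E × E) ℝ)
    {b : ℕ → ℝ} {β : ℝ} (hb : Tendsto b u (𝓝 β))
    (h : ∀ᶠ n in u, |∫ w, F w ∂((μs n : Measure E).prod (μs n : Measure E))| ≤ b n) :
    |∫ w, F w ∂((μ : Measure E).prod (μ : Measure E))| ≤ β := by
  have hprod : Tendsto (fun n => (μs n).prod (μs n)) u (𝓝 (μ.prod μ)) :=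
    (ProbabilityMeasure.continuous_prod.tendsto (μ, μ)).comp (hlim.prodMk_nhds hlim)
  have := (ProbabilityMeasure.tendsto_iff_forall_integral_tendsto.1 hprod) F
  exact le_of_tendsto_of_tendsto this.abs hb h

lemma exists_continuous_approx (hW : IsBoundedKernel W 1) {ε : ℝ} (hε : 0 < ε) :
    ∃ g : BoundedContinuousFunction (X × X) ℝ,
      Integrable (fun p : X × X => |W p.1 p.2 - g p|) (ν.prod ν) ∧
        ∫ p, |W p.1 p.2 - g p| ∂(ν.prod ν) ≤ ε := by
  have h_int : Integrable (fun p : X × X => W p.1 p.2) (ν.prod ν) :=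
    Integrable.of_bound hW.measurable.aestronglyMeasurable 1
      (ae_of_all _ fun p => hW.norm_le p.1 p.2)
  obtain ⟨g, hg, hgi⟩ := h_int.exists_boundedContinuous_integral_sub_le hε
  exact ⟨g, (h_int.sub hgi).abs, hg⟩

/-- Kernels on a compact probability space with the same moments are related by a coupling. -/
theorem exists_coupling_of_moments_eq (hW₁ : IsBoundedKernel W₁ 1) (hW₂ : IsBoundedKernel W₂ 1)
    (hmom : ∀ (n : ℕ) (S : Finset (Sym2 (Fin n))), (∀ e ∈ S, ¬ e.IsDiag) →
      ∫ x, ∏ e ∈ S, edgeVal W₁ x e ∂(Measure.pi fun _ => ν) =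
        ∫ x, ∏ e ∈ S, edgeVal W₂ x e ∂(Measure.pi fun _ => ν)) :
    ∃ μ : Measure (X × X), IsProbabilityMeasure μ ∧ μ.map Prod.fst = ν ∧ μ.map Prod.snd = ν ∧
      ∀ᵐ w ∂(μ.prod μ), W₁ w.1.1 w.2.1 = W₂ w.1.2 w.2.2 := by
  have hpow : ∀ k : ℕ, (0 : ℝ) < (1 / 8) ^ k := fun k => by positivity
  choose g hg hg8 using fun k => exists_continuous_approx (ν := ν) hW₁ (hpow k)
  choose h hh hh8 using fun k => exists_continuous_approx (ν := ν) hW₂ (hpow k)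
  let d : ℕ → C(X, ℝ) := TopologicalSpace.denseSeq _
  have hf : ∀ j, Measurable fun a => d j a / (1 + ‖d j‖) := fun j =>
    (d j).continuous.measurable.div_const _
  have hf1 : ∀ j a, |d j a / (1 + ‖d j‖)| ≤ 1 := fun j a => by
    rw [abs_div, abs_of_pos (by positivity : 0 < 1 + ‖d j‖), div_le_one (by positivity)]
    have : |d j a| ≤ ‖d j‖ := (d j).norm_coe_le_norm a
    linarith
  choose G x y hcyc hxy using fun n : ℕ => exists_coupled_samples (n := n + 1) hW₁ hW₂
    n.succ_pos (hmom (n + 1)) (g := fun j a b => g j (a, b)) (h := fun j a b => h j (a, b))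
    hg hg8 hh hh8 hf hf1
  let z : ∀ n : ℕ, Fin (n + 1) → X × X := fun n i => (x n i, y n i)
  let u : Ultrafilter ℕ := Ultrafilter.of atTop
  have hu : (u : Filter ℕ) ≤ atTop := Ultrafilter.of_le _
  let μ : ProbabilityMeasure (X × X) := (u.map fun n => empiricalMeasure (z n)).lim
  have hlim : Tendsto (fun n => empiricalMeasure (z n)) u (𝓝 μ) :=
    (u.map fun n => empiricalMeasure (z n)).le_nhds_lim
  have hfst : (μ : Measure (X × X)).map Prod.fst = ν :=
    map_eq_of_tendsto_empiricalMeasure continuous_fst z hu hlim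
      (TopologicalSpace.denseRange_denseSeq _) fun n j hj => (hxy n j hj).2.1
  have hsnd : (μ : Measure (X × X)).map Prod.snd = ν :=
    map_eq_of_tendsto_empiricalMeasure continuous_snd z hu hlim
      (TopologicalSpace.denseRange_denseSeq _) fun n j hj => (hxy n j hj).2.2
  have hmp₁ : MeasurePreserving Prod.fst (μ : Measure (X × X)) ν := ⟨measurable_fst, hfst⟩
  have hmp₂ : MeasurePreserving Prod.snd (μ : Measure (X × X)) ν := ⟨measurable_snd, hsnd⟩
  refine ⟨μ, inferInstance, hfst, hsnd, ?_⟩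
  have hK₁ := hW₁.comp (φ := fun w : X × X => w.1) measurable_fst
  have hK₂ := hW₂.comp (φ := fun w : X × X => w.2) measurable_snd
  have h_int : ∀ {U : X × X → X × X → ℝ}, IsBoundedKernel U 1 →
      ∀ {s t : X × X → ℝ}, Continuous s → Continuous t → (∀ w, |s w| ≤ 1) → (∀ w, |t w| ≤ 1) →
      Integrable (fun p : (X × X) × (X × X) => s p.1 * t p.2 * U p.1 p.2)
        ((μ : Measure (X × X)).prod μ) := by
    intro U hU s t hs ht hs1 ht1
    refine Integrable.of_bound (((hs.measurable.comp measurable_fst).mul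
      (ht.measurable.comp measurable_snd)).mul hU.measurable).aestronglyMeasurable 1
      (ae_of_all _ fun p => ?_)
    rw [norm_mul, norm_mul]
    exact mul_le_one₀ (mul_le_one₀ (hs1 _) (norm_nonneg _) (ht1 _)) (norm_nonneg _)
      (hU.norm_le _ _)
  have hkey : ∀ {s t : X × X → ℝ}, Continuous s → Continuous t → (∀ w, |s w| ≤ 1) →
      (∀ w, |t w| ≤ 1) →
      ∫ p : (X × X) × (X × X), s p.1 * t p.2 * W₁ p.1.1 p.2.1 ∂((μ : Measure (X × X)).prod μ) =
      ∫ p : (X × X) × (X × X), s p.1 * t p.2 * W₂ p.1.2 p.2.2 ∂((μ : Measure (X × X)).prod μ) := by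
    intro s t hs ht hs1 ht1
    have hbound : ∀ k : ℕ,
        |∫ p : (X × X) × (X × X), s p.1 * t p.2 * W₁ p.1.1 p.2.1 ∂((μ : Measure (X × X)).prod μ) -
        ∫ p : (X × X) × (X × X), s p.1 * t p.2 * W₂ p.1.2 p.2.2 ∂((μ : Measure (X × X)).prod μ)| ≤
        58 * (1 / 4) ^ k := by
      intro k
      let F : BoundedContinuousFunction ((X × X) × (X × X)) ℝ :=
        BoundedContinuousFunction.mkOfCompact ⟨fun p => s p.1 * t p.2 *
          (g k (p.1.1, p.2.1) - h k (p.1.2, p.2.2)), by fun_prop⟩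
      have hF : ∀ p, F p = s p.1 * t p.2 * (g k (p.1.1, p.2.1) - h k (p.1.2, p.2.2)) :=
        fun _ => rfl
      have hFle : |∫ p, F p ∂((μ : Measure (X × X)).prod μ)| ≤ 56 * (1 / 4) ^ k := by
        let ε : ℕ → ℝ := fun n => √√(14 / (n + 1 : ℕ))
        have hε4 : ∀ n, ε n ^ 4 = 14 / (n + 1 : ℕ) := fun n => by
          have : ε n ^ 4 = (ε n ^ 2) ^ 2 := by ring
          rw [this, Real.sq_sqrt (Real.sqrt_nonneg _), Real.sq_sqrt (by positivity)]
        have hdiv : ∀ c : ℝ, Tendsto (fun n : ℕ => c / (n + 1 : ℕ)) u (𝓝 0) := fun c =>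
          ((tendsto_const_div_atTop_nhds_zero_nat c).comp (tendsto_add_atTop_nat 1)).mono_left hu
        have hε : Tendsto ε u (𝓝 0) := by
          have := (hdiv 14).sqrt.sqrt
          rwa [Real.sqrt_zero, Real.sqrt_zero] at this
        have hb : Tendsto (fun n : ℕ => 28 * (1 / 4 : ℝ) ^ k + 28 * (1 / 4) ^ k +
            (‖g k‖ + ‖h k‖) / (n + 1 : ℕ) + 2 * ε n) u (𝓝 (56 * (1 / 4) ^ k)) := by
          have := ((hdiv (‖g k‖ + ‖h k‖)).const_add
            (28 * (1 / 4 : ℝ) ^ k + 28 * (1 / 4) ^ k)).add (hε.const_mul 2)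
          convert this using 2
          ring
        refine abs_integral_prod_le_of_tendsto hlim F hb ?_
        filter_upwards [hu (eventually_ge_atTop k)] with n hn
        have hkn := Nat.lt_succ_of_le hn
        rw [integral_empiricalMeasure_prod _ F.continuous.stronglyMeasurable (F.integrable _)]
        have := abs_average_sub_le (g := fun a b => g k (a, b)) (h := fun a b => h k (a, b))
          hW₁.symm hW₂.symm
          (fun a b => (g k).norm_coe_le_norm (a, b)) (fun a b => (h k).norm_coe_le_norm (a, b))
          n.succ_pos (x := x n) (y := y n) (G := G n) (s := fun i => s (z n i))
          (t := fun i => t (z n i)) (fun i => hs1 _) (fun i => ht1 _) (Real.sqrt_nonneg _)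
          ((hcyc n).1.trans (hε4 n).ge) ((hcyc n).2.trans (hε4 n).ge)
        refine this.trans ?_
        gcongr
        · exact (hxy n k hkn).1.1
        · exact (hxy n k hkn).1.2
      have h1 := abs_integral_mul_mul_sub_le hmp₁ (hg k) hs1 ht1
      have h2 := abs_integral_mul_mul_sub_le hmp₂ (hh k) hs1 ht1
      have hi₁ := h_int hK₁ hs ht hs1 ht1
      have hi₂ := h_int hK₂ hs ht hs1 ht1
      have hgi : Integrable (fun p : (X × X) × (X × X) => s p.1 * t p.2 * g k (p.1.1, p.2.1))
          ((μ : Measure (X × X)).prod μ) :=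
        (BoundedContinuousFunction.mkOfCompact ⟨fun p : (X × X) × (X × X) =>
          s p.1 * t p.2 * g k (p.1.1, p.2.1), by fun_prop⟩).integrable _
      have hhi : Integrable (fun p : (X × X) × (X × X) => s p.1 * t p.2 * h k (p.1.2, p.2.2))
          ((μ : Measure (X × X)).prod μ) :=
        (BoundedContinuousFunction.mkOfCompact ⟨fun p : (X × X) × (X × X) =>
          s p.1 * t p.2 * h k (p.1.2, p.2.2), by fun_prop⟩).integrable _
      simp_rw [hF, mul_sub] at hFle
      simp_rw [mul_sub] at h1 h2
      rw [integral_sub hgi hhi] at hFle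
      rw [integral_sub hi₁ hgi] at h1
      rw [integral_sub hi₂ hhi] at h2
      have h84 : (1 / 8 : ℝ) ^ k ≤ (1 / 4) ^ k := by gcongr; norm_num
      have h1' := h1.trans (hg8 k)
      have h2' := h2.trans (hh8 k)
      rw [abs_le] at h1' h2' hFle ⊢
      constructor <;> linarith
    have hz : Tendsto (fun k : ℕ => 58 * (1 / 4 : ℝ) ^ k) atTop (𝓝 0) := by
      simpa using (tendsto_pow_atTop_nhds_zero_of_lt_one (by norm_num : (0 : ℝ) ≤ 1 / 4)
        (by norm_num)).const_mul 58
    have := ge_of_tendsto' hz hbound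
    exact sub_eq_zero.1 (abs_nonpos_iff.1 this)
  refine ae_eq_of_forall_integral_mul_mul_eq hK₁.measurable hK₂.measurable
    (fun p => hK₁.nonneg _ _) (fun p => hK₂.nonneg _ _) ?_ ?_ fun s t => ?_
  · exact Integrable.of_bound hK₁.measurable.aestronglyMeasurable 1
      (ae_of_all _ fun p => hK₁.norm_le p.1 p.2)
  · exact Integrable.of_bound hK₂.measurable.aestronglyMeasurable 1
      (ae_of_all _ fun p => hK₂.norm_le p.1 p.2)
  · have hscale : ∀ (s : BoundedContinuousFunction (X × X) ℝ) (w : X × X),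
        |s w / (1 + ‖s‖)| ≤ 1 := fun s w => by
      rw [abs_div, abs_of_pos (by positivity : 0 < 1 + ‖s‖), div_le_one (by positivity)]
      have : |s w| ≤ ‖s‖ := s.norm_coe_le_norm w
      linarith
    have hst := hkey (s := fun w => s w / (1 + ‖s‖)) (t := fun w => t w / (1 + ‖t‖))
      (by fun_prop) (by fun_prop) (hscale s) (hscale t)
    have hpull : ∀ (a b c : ℝ), a / (1 + ‖s‖) * (b / (1 + ‖t‖)) * c =
        ((1 + ‖s‖) * (1 + ‖t‖))⁻¹ * (a * b * c) := fun a b c => by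
      field_simp
    simp_rw [hpull, integral_const_mul] at hst
    exact mul_left_cancel₀ (by positivity) hst

end Coupling

section Path

variable {X : Type*} {n : ℕ}

/-- The product of a kernel along the path from `a` to `b` with interior vertices `v`. -/
def pathWeight (W : X → X → ℝ) (a b : X) (v : Fin n → X) : ℝ :=
  ∏ i : Fin (n + 1), W ((Fin.cons a v : Fin (n + 1) → X) i) ((Fin.snoc v b : Fin (n + 1) → X) i)

lemma pathWeight_cons (W : X → X → ℝ) (a b c : X) (v : Fin n → X) :
    pathWeight W a b (Fin.cons c v : Fin (n + 1) → X) = W a c * pathWeight W c b v := by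
  simp [pathWeight, Fin.prod_univ_succ (n := n + 1), ← Fin.cons_snoc_eq_snoc_cons]

variable [MeasurableSpace X] {ν : Measure X} [IsProbabilityMeasure ν] {W : X → X → ℝ} {C : ℝ}

lemma measurable_pathWeight (h : IsBoundedKernel W C) :
    Measurable fun p : (X × X) × (Fin n → X) => pathWeight W p.1.1 p.1.2 p.2 := by
  refine Finset.measurable_prod _ fun i _ => ?_
  have h1 : Measurable fun p : (X × X) × (Fin n → X) =>
      (Fin.cons p.1.1 p.2 : Fin (n + 1) → X) i := by
    refine Fin.cases ?_ (fun j => ?_) i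
    · simp only [Fin.cons_zero]; fun_prop
    · simp only [Fin.cons_succ]; fun_prop
  have h2 : Measurable fun p : (X × X) × (Fin n → X) =>
      (Fin.snoc p.2 p.1.2 : Fin (n + 1) → X) i := by
    refine Fin.lastCases ?_ (fun j => ?_) i
    · simp only [Fin.snoc_last]; fun_prop
    · simp only [Fin.snoc_castSucc]; fun_prop
  exact h.measurable.comp (h1.prodMk h2)

lemma norm_pathWeight_le (h : IsBoundedKernel W C) (a b : X) (v : Fin n → X) :
    ‖pathWeight W a b v‖ ≤ C ^ (n + 1) := by
  rw [pathWeight, norm_prod]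
  calc _ ≤ ∏ _i : Fin (n + 1), C :=
        Finset.prod_le_prod (fun _ _ => norm_nonneg _) fun i _ => h.norm_le _ _
    _ = _ := by simp

lemma integral_pathWeight (h : IsBoundedKernel W C) (a b : X) :
    ∫ v : Fin n → X, pathWeight W a b v ∂(Measure.pi fun _ => ν) = iterKernel ν W n a b := by
  induction n generalizing a with
  | zero => simp [pathWeight, iterKernel, Fin.snoc]
  | succ n ih =>
    have hmp := (measurePreserving_piFinSuccAbove (fun _ : Fin (n + 1) => ν) 0).symm
    rw [← hmp.integral_comp']
    have heq : ∀ p : X × (Fin n → X), pathWeight W a b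
        ((MeasurableEquiv.piFinSuccAbove (fun _ : Fin (n + 1) => X) 0).symm p) =
        W a p.1 * pathWeight W p.1 b p.2 := fun p => by
      rw [← pathWeight_cons]
      congr 1
      simp [MeasurableEquiv.piFinSuccAbove_symm_apply, Fin.insertNthEquiv]
    simp_rw [heq]
    rw [integral_prod, iterKernel]
    · simp_rw [integral_const_mul, ih]
    · refine Integrable.of_bound (C := C * C ^ (n + 1)) ?_ (ae_of_all _ fun p => ?_)
      · have : Measurable fun p : X × (Fin n → X) => ((p.1, b), p.2) := by fun_prop
        exact (((h.measurable_left a).comp measurable_fst).mul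
          ((measurable_pathWeight h).comp this)).aestronglyMeasurable
      · rw [norm_mul]
        exact mul_le_mul (h.norm_le _ _) (norm_pathWeight_le h _ _ _) (norm_nonneg _)
          (h.bound_nonneg a)

/-- Interior vertices of disjoint paths can be integrated out separately. -/
lemma integral_prod_pathWeight {A E : Type*} [Fintype A] [Fintype E] (h : IsBoundedKernel W C)
    (p q : E → A) :
    ∫ x : A ⊕ (E × Fin n) → X,
        ∏ e, pathWeight W (x (.inl (p e))) (x (.inl (q e))) (fun i => x (.inr (e, i)))
        ∂(Measure.pi fun _ => ν) =
      ∫ x : A → X, ∏ e, iterKernel ν W n (x (p e)) (x (q e)) ∂(Measure.pi fun _ => ν) := by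
  have hmp := measurePreserving_sumPiEquivProdPi_symm (fun _ : A ⊕ (E × Fin n) => ν)
  rw [← hmp.integral_comp']
  simp only [MeasurableEquiv.coe_sumPiEquivProdPi_symm, Equiv.sumPiEquivProdPi_symm_apply]
  rw [integral_prod]
  · congr 1
    ext x
    have hcurry : MeasurePreserving (MeasurableEquiv.curry E (Fin n) X)
        (Measure.pi fun _ => ν) (Measure.pi fun _ => Measure.pi fun _ => ν) := by
      refine ⟨MeasurableEquiv.measurable _, ?_⟩
      have := Measure.infinitePi_map_curry (fun (_ : E) (_ : Fin n) => ν)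
      simpa [Measure.infinitePi_eq_pi] using this
    have := hcurry.integral_comp' fun w : E → Fin n → X =>
      ∏ e, pathWeight W (x (p e)) (x (q e)) (w e)
    refine this.trans ?_
    rw [integral_fintype_prod_eq_prod fun e => pathWeight W (x (p e)) (x (q e))]
    simp_rw [integral_pathWeight h]
  · refine Integrable.of_bound (C := ∏ _e : E, C ^ (n + 1)) ?_ (ae_of_all _ fun x => ?_)
    · refine (Finset.measurable_prod _ fun e _ => ?_).aestronglyMeasurable
      have : Measurable fun x : (A → X) × (E × Fin n → X) =>
          ((x.1 (p e), x.1 (q e)), fun i => x.2 (e, i)) := by fun_prop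
      exact (measurable_pathWeight h).comp this
    · rw [norm_prod]
      exact Finset.prod_le_prod (fun _ _ => norm_nonneg _) fun e _ => norm_pathWeight_le h _ _ _

end Path

section Subdivision

variable {n k : ℕ} {F : SimpleGraph (Fin k)}

lemma spv_eq_cons {X : Type*} (x : Fin k ⊕ (edgeIdx F × Fin n) → X) (e : edgeIdx F)
    (i : Fin (n + 1)) :
    x (spv (n + 1) e i) =
      (Fin.cons (x (.inl e.1.1)) (fun j => x (.inr (e, j))) : Fin (n + 1) → X) i := by
  refine Fin.cases ?_ (fun j => ?_) i
  · simp [spv]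
  · simp [spv]

lemma spv_succ_eq_snoc {X : Type*} (x : Fin k ⊕ (edgeIdx F × Fin n) → X) (e : edgeIdx F)
    (i : Fin (n + 1)) :
    x (spv (n + 1) e (i + 1)) =
      (Fin.snoc (fun j => x (.inr (e, j))) (x (.inl e.1.2)) : Fin (n + 1) → X) i := by
  refine Fin.lastCases ?_ (fun j => ?_) i
  · simp [spv]
  · simp [spv]

/-- The `i`-th edge on the subdivision of `e`. -/
def subdivEdge (F : SimpleGraph (Fin k)) (t : ℕ) (p : edgeIdx F × Fin t) :
    Sym2 (Fin k ⊕ (edgeIdx F × Fin (t - 1))) :=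
  s(spv t p.1 p.2, spv t p.1 (p.2 + 1))

lemma subdivEdge_injective (F : SimpleGraph (Fin k)) (t : ℕ) :
    Function.Injective (subdivEdge F t) := by
  rintro ⟨e, i, hi⟩ ⟨e', i', hi'⟩ h
  have he := e.2.1
  have he' := e'.2.1
  simp only [subdivEdge, spv, Sym2.eq_iff] at h
  simp only [Prod.mk.injEq, Fin.mk.injEq]
  grind

lemma spv_ne_spv_succ (t : ℕ) (e : edgeIdx F) (i : ℕ) (hi : i < t) :
    spv t e i ≠ spv t e (i + 1) := by
  have he := e.2.1
  simp only [spv]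
  grind

lemma edgeFinset_subdiv (F : SimpleGraph (Fin k)) (t : ℕ) :
    (subdiv t F).edgeFinset = Finset.univ.image (subdivEdge F t) := by
  ext e
  induction e using Sym2.ind with
  | _ a b =>
    refine SimpleGraph.mem_edgeFinset.trans ?_
    rw [SimpleGraph.mem_edgeSet]
    simp only [subdiv, SimpleGraph.fromRel_adj, Finset.mem_image, Finset.mem_univ, true_and,
      subdivEdge]
    constructor
    · rintro ⟨_, ⟨e, i, hi, rfl, rfl⟩ | ⟨e, i, hi, rfl, rfl⟩⟩
      · exact ⟨(e, ⟨i, hi⟩), rfl⟩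
      · exact ⟨(e, ⟨i, hi⟩), Sym2.eq_swap⟩
    · rintro ⟨⟨e, i, hi⟩, h⟩
      have hne := spv_ne_spv_succ t e i hi
      rcases Sym2.eq_iff.1 h with ⟨rfl, rfl⟩ | ⟨rfl, rfl⟩
      · exact ⟨hne, .inl ⟨e, i, hi, rfl, rfl⟩⟩
      · exact ⟨hne.symm, .inr ⟨e, i, hi, rfl, rfl⟩⟩

/-- The density of a subdivision is the density of the graph in the corresponding kernel power. -/
theorem homDensity_subdiv {κ : ℝ → ℝ → ℝ} {C : ℝ} (h : IsBoundedKernel κ C)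
    [IsProbabilityMeasure (volume.restrict (Icc (0 : ℝ) 1))] (F : SimpleGraph (Fin k)) (n : ℕ) :
    homDensity (subdiv (n + 1) F) κ =
      ∫ x : Fin k → ℝ, ∏ e : edgeIdx F,
        iterKernel (volume.restrict (Icc 0 1)) κ n (x e.1.1) (x e.1.2)
        ∂(Measure.pi fun _ => volume.restrict (Icc 0 1)) := by
  rw [← integral_prod_pathWeight h (fun e : edgeIdx F => e.1.1) fun e => e.1.2]
  unfold homDensity
  rw [volume_pi, Measure.restrict_pi_pi]
  refine integral_congr_ae (ae_of_all _ fun x => ?_)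
  dsimp only
  rw [edgeFinset_subdiv, Finset.prod_image fun a _ b _ hab => subdivEdge_injective F _ hab,
    Fintype.prod_prod_type]
  refine Finset.prod_congr rfl fun e _ => ?_
  rw [pathWeight]
  refine Finset.prod_congr rfl fun i _ => ?_
  rw [← spv_eq_cons, ← spv_succ_eq_snoc, subdivEdge, Sym2.lift_mk]
  dsimp only
  rw [h.symm (x (spv (n + 1) e (i + 1)))]
  ring

end Subdivision

lemma isProbabilityMeasure_restrict_Icc :
    IsProbabilityMeasure (volume.restrict (Icc (0 : ℝ) 1)) :=
  ⟨by simp⟩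

lemma prod_edgeVal_eq_prod_edgeIdx {X : Type*} {V : X → X → ℝ} (hV : ∀ a b, V a b = V b a) {k : ℕ}
    {S : Finset (Sym2 (Fin k))} {F : SimpleGraph (Fin k)} (hF : F.edgeSet = S) (x : Fin k → X) :
    ∏ e ∈ S, edgeVal V x e = ∏ q : edgeIdx F, V (x q.1.1) (x q.1.2) := by
  have hmem : ∀ a b, s(a, b) ∈ S ↔ F.Adj a b := fun a b => by
    rw [← Finset.mem_coe, ← hF, SimpleGraph.mem_edgeSet]
  symm
  refine Finset.prod_bij (fun q _ => s(q.1.1, q.1.2)) (fun q _ => (hmem _ _).2 q.2.2)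
    (fun q _ q' _ h => ?_) (fun e he => ?_) fun q _ => (edgeVal_of_not_isDiag hV x q.2.1.ne).symm
  · rcases Sym2.eq_iff.1 h with h | h
    · exact Subtype.ext (Prod.ext h.1 h.2)
    · have h1 := q.2.1
      rw [h.1, h.2] at h1
      exact absurd h1 q'.2.1.asymm
  · induction e using Sym2.ind with
    | _ a b =>
      have hab : F.Adj a b := (hmem a b).1 he
      rcases hab.ne.lt_or_gt with h | h
      · exact ⟨⟨(a, b), h, hab⟩, Finset.mem_univ _, rfl⟩
      · exact ⟨⟨(b, a), h, hab.symm⟩, Finset.mem_univ _, Sym2.eq_swap⟩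

/-- The moments of a normalized kernel power are normalized densities of subdivisions. -/
lemma integral_prod_edgeVal_iterKernel {κ : ℝ → ℝ → ℝ} {C : ℝ} (h : IsBoundedKernel κ C) (n : ℕ)
    {k : ℕ} {S : Finset (Sym2 (Fin k))} {F : SimpleGraph (Fin k)} (hF : F.edgeSet = S) :
    ∫ x, ∏ e ∈ S, edgeVal (fun a b : unitInterval =>
        iterKernel (volume.restrict (Icc (0 : ℝ) 1)) κ n a b / C ^ (n + 1)) x e
        ∂(Measure.pi fun _ => volume) =
      homDensity (subdiv (n + 1) F) κ / ∏ _q : edgeIdx F, C ^ (n + 1) := by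
  have := isProbabilityMeasure_restrict_Icc
  have hK := h.iterKernel (μ := volume.restrict (Icc (0 : ℝ) 1)) n
  have hmp : MeasurePreserving (fun (x : Fin k → unitInterval) i => (x i : ℝ))
      (Measure.pi fun _ => volume) (Measure.pi fun _ => volume.restrict (Icc (0 : ℝ) 1)) :=
    measurePreserving_pi _ _ fun _ => unitInterval.measurePreserving_coe
  rw [homDensity_subdiv h, ← integral_div, ← hmp.map_eq, integral_map hmp.aemeasurable]
  · refine integral_congr_ae (ae_of_all _ fun x => ?_)
    dsimp only
    rw [prod_edgeVal_eq_prod_edgeIdx (fun a b => by rw [hK.symm]) hF, Finset.prod_div_distrib]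
  · refine Measurable.aestronglyMeasurable ((Finset.measurable_prod _ fun q _ => ?_).div_const _)
    have hpair : Measurable fun x : Fin k → ℝ => (x q.1.1, x q.1.2) := by fun_prop
    exact hK.measurable.comp hpair

lemma IsKernelBdd.isBoundedKernel {κ : ℝ → ℝ → ℝ} {C : ℝ} (h : IsKernelBdd κ C) :
    IsBoundedKernel κ C :=
  ⟨h.1, h.2.1, fun x y => (h.2.2 x y).1, fun x y => (h.2.2 x y).2⟩

end

/-- If two bounded kernels have equal densities of the `t`-subdivision
of every finite simple graph, `t` odd, then they are equivalent. -/
theorem odd_subdivision_counts_determine_kernel (C : ℝ) (hC : 0 < C)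
    (κ₁ κ₂ : ℝ → ℝ → ℝ) (h₁ : IsKernelBdd κ₁ C) (h₂ : IsKernelBdd κ₂ C)
    (t : ℕ) (ht : 1 ≤ t) (hodd : Odd t)
    (hcounts : ∀ (k : ℕ) (F : SimpleGraph (Fin k)),
      homDensity (subdiv t F) κ₁ = homDensity (subdiv t F) κ₂) :
    KernelEquiv κ₁ κ₂ := by
  obtain ⟨n, rfl⟩ : ∃ n, t = n + 1 := ⟨t - 1, by omega⟩
  have := isProbabilityMeasure_restrict_Icc
  have hb₁ := h₁.isBoundedKernel
  have hb₂ := h₂.isBoundedKernel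
  have hCn : 0 < C ^ (n + 1) := pow_pos hC _
  obtain ⟨μ, hμ, hfst, hsnd, heq⟩ := exists_coupling_of_moments_eq
    (ν := (volume : Measure unitInterval))
    (((hb₁.iterKernel (μ := volume.restrict (Icc (0 : ℝ) 1)) n).div_const hCn).comp
      measurable_subtype_coe)
    (((hb₂.iterKernel (μ := volume.restrict (Icc (0 : ℝ) 1)) n).div_const hCn).comp
      measurable_subtype_coe)
    fun k S hS => by
      obtain ⟨F, hF⟩ : ∃ F : SimpleGraph (Fin k), F.edgeSet = S := by
        refine ⟨SimpleGraph.fromEdgeSet S, ?_⟩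
        rw [SimpleGraph.edgeSet_fromEdgeSet, sdiff_eq_left, Set.disjoint_left]
        exact fun e he => by simpa using hS e he
      rw [integral_prod_edgeVal_iterKernel hb₁ n hF, integral_prod_edgeVal_iterKernel hb₂ n hF,
        hcounts]
  have hv := unitInterval.measurePreserving_coe
  have hp₁ : MeasurePreserving (fun w : unitInterval × unitInterval => (w.1 : ℝ)) μ
      (volume.restrict (Icc (0 : ℝ) 1)) := hv.comp ⟨measurable_fst, hfst⟩
  have hp₂ : MeasurePreserving (fun w : unitInterval × unitInterval => (w.2 : ℝ)) μ
      (volume.restrict (Icc (0 : ℝ) 1)) := hv.comp ⟨measurable_snd, hsnd⟩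
  have hκ : ∀ᵐ w ∂(μ.prod μ), κ₁ w.1.1 w.2.1 = κ₂ w.1.2 w.2.2 := by
    refine ae_eq_of_iterKernel_ae_eq (hb₁.comp hp₁.measurable) (hb₂.comp hp₂.measurable) hodd ?_
    filter_upwards [heq] with w hw
    rw [iterKernel_comp hp₁ hb₁, iterKernel_comp hp₂ hb₂]
    exact (div_left_inj' hCn.ne').1 hw
  have hm : Measurable fun w : unitInterval × unitInterval => ((w.1 : ℝ), (w.2 : ℝ)) :=
    hp₁.measurable.prodMk hp₂.measurable
  refine ⟨μ.map fun w => ((w.1 : ℝ), (w.2 : ℝ)), ⟨?_, ?_⟩, ?_⟩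
  · rw [Measure.map_map measurable_fst hm]
    exact hp₁.map_eq
  · rw [Measure.map_map measurable_snd hm]
    exact hp₂.map_eq
  · rw [Measure.map_prod_map μ μ hm hm, ae_map_iff (hm.prodMap hm).aemeasurable]
    · exact hκ
    · exact measurableSet_eq_fun
        (hb₁.comp measurable_fst).measurable (hb₂.comp measurable_snd).measurable
end

section
/- Let C > 0 be constant, let p : ℕ → (0,1] satisfy n·p(n) → ∞, and let (G_n) be a sequence of graphs with vertex set {1,…,n} such that sup_n t_p(T,G_n) < ∞ for every finite tree T. Then for every ε > 0 and every ℓ ≥ 1 there is a δ > 0 such that: for every n and every kernel κ : [0,1]² → [0,C] with ‖κ_{G_n} − κ‖_□ ≤ δ, and all subsets X_0, X_1, …, X_ℓ ⊆ V(G_n), one has |G_n(X_0,X_1,…,X_ℓ) − n^{ℓ+1}·p(n)^ℓ·κ(X_0,X_1,…,X_ℓ)| ≤ ε·n^{ℓ+1}·p(n)^ℓ. -/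
open MeasureTheory Set Filter
open scoped ENNReal Classical

section Discrete

variable {n : ℕ}

/-- The number of walks through `X`, each weighted by the value of `g` at its first vertex. -/
noncomputable def walkSum {ℓ : ℕ} (G : SimpleGraph (Fin n)) (X : Fin (ℓ + 1) → Finset (Fin n))
    (g : Fin n → ℝ) : ℝ :=
  ∑ v : Fin (ℓ + 1) → Fin n,
    if (∀ i, v i ∈ X i) ∧ ∀ i : Fin ℓ, G.Adj (v i.castSucc) (v i.succ) then g (v 0) else 0

/-- The value of the kernel of `G` on the cell of a pair of vertices. -/
noncomputable def edgeWeight (p : ℝ) (G : SimpleGraph (Fin n)) (i j : Fin n) : ℝ :=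
  if G.Adj i j then 1 / p else 0

/-- The normalized degree of a vertex. -/
noncomputable def normDegree (p : ℝ) (G : SimpleGraph (Fin n)) (i : Fin n) : ℝ :=
  (1 / n) * ∑ j, edgeWeight p G i j

/-- One step of a normalized walk starting in `A`, applied to a vertex weight. -/
noncomputable def walkStep (p : ℝ) (G : SimpleGraph (Fin n)) (A : Finset (Fin n))
    (g : Fin n → ℝ) (j : Fin n) : ℝ :=
  (1 / n) * ∑ i ∈ A, edgeWeight p G i j * g i

theorem walkCount_eq_walkSum {ℓ : ℕ} (G : SimpleGraph (Fin n))
    (X : Fin (ℓ + 1) → Finset (Fin n)) : (walkCount G X : ℝ) = walkSum G X fun _ => 1 := by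
  rw [walkCount, Nat.card_eq_fintype_card, Fintype.card_subtype, walkSum, Finset.sum_boole]

theorem walkSum_zero (G : SimpleGraph (Fin n)) (X : Fin 1 → Finset (Fin n)) (g : Fin n → ℝ) :
    walkSum G X g = ∑ i ∈ X 0, g i := by
  rw [walkSum, ← (Equiv.funUnique (Fin 1) (Fin n)).symm.sum_comp, ← Finset.sum_filter]
  refine Finset.sum_congr ?_ fun i _ => rfl
  ext i
  simp

theorem walkSum_succ {ℓ : ℕ} {p : ℝ} (hn : 0 < n) (hp : 0 < p) (G : SimpleGraph (Fin n))
    (X : Fin (ℓ + 2) → Finset (Fin n)) (g : Fin n → ℝ) :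
    walkSum G X g = n * p * walkSum G (Fin.tail X) (walkStep p G (X 0) g) := by
  have hn' : (n : ℝ) ≠ 0 := by positivity
  rw [walkSum, ← (Fin.consEquiv fun _ : Fin (ℓ + 2) => Fin n).sum_comp, Fintype.sum_prod_type,
    Finset.sum_comm, walkSum, Finset.mul_sum]
  refine Finset.sum_congr rfl fun v _ => ?_
  have key : ∀ i : Fin n,
      ((∀ k, Fin.cons (α := fun _ : Fin (ℓ + 2) => Fin n) i v k ∈ X k) ∧
        ∀ k : Fin (ℓ + 1), G.Adj (Fin.cons (α := fun _ : Fin (ℓ + 2) => Fin n) i v k.castSucc)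
          (Fin.cons (α := fun _ : Fin (ℓ + 2) => Fin n) i v k.succ)) ↔
      ((∀ k, v k ∈ Fin.tail X k) ∧ ∀ k : Fin ℓ, G.Adj (v k.castSucc) (v k.succ)) ∧
        i ∈ X 0 ∧ G.Adj i (v 0) := by
    intro i
    rw [Fin.forall_fin_succ]
    have h0 : (∀ k : Fin (ℓ + 1), G.Adj (Fin.cons (α := fun _ : Fin (ℓ + 2) => Fin n) i v k.castSucc)
          (Fin.cons (α := fun _ : Fin (ℓ + 2) => Fin n) i v k.succ)) ↔
        G.Adj i (v 0) ∧ ∀ k : Fin ℓ, G.Adj (v k.castSucc) (v k.succ) := by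
      rw [Fin.forall_fin_succ]
      rfl
    rw [h0]
    simp only [Fin.cons_zero, Fin.cons_succ, Fin.tail]
    tauto
  simp only [Fin.consEquiv, Equiv.coe_fn_mk, key, Fin.cons_zero]
  by_cases h : (∀ k, v k ∈ Fin.tail X k) ∧ ∀ k : Fin ℓ, G.Adj (v k.castSucc) (v k.succ)
  · simp only [h, true_and, if_true, walkStep, edgeWeight, implies_true]
    rw [← mul_assoc, Finset.mul_sum, ← Finset.sum_filter, ← Finset.filter_filter,
      Finset.sum_filter]
    simp only [Finset.filter_univ_mem]
    refine Finset.sum_congr rfl fun i _ => ?_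
    split_ifs <;> field_simp
    simp
  · simp only [h, false_and, if_false, Finset.sum_const_zero, mul_zero]

theorem edgeWeight_nonneg {p : ℝ} (hp : 0 < p) (G : SimpleGraph (Fin n)) (i j : Fin n) :
    0 ≤ edgeWeight p G i j := by
  unfold edgeWeight; split_ifs <;> positivity

theorem edgeWeight_comm (p : ℝ) (G : SimpleGraph (Fin n)) (i j : Fin n) :
    edgeWeight p G i j = edgeWeight p G j i := by
  simp only [edgeWeight, G.adj_comm]

theorem sum_edgeWeight_mul (p : ℝ) (G : SimpleGraph (Fin n)) (j : Fin n) (g : Fin n → ℝ) :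
    ∑ i, edgeWeight p G i j * g i = (1 / p) * ∑ i ∈ G.neighborFinset j, g i := by
  rw [Finset.mul_sum, SimpleGraph.neighborFinset_eq_filter, Finset.sum_filter]
  refine Finset.sum_congr rfl fun i _ => ?_
  rw [edgeWeight, G.adj_comm]
  split_ifs <;> simp

theorem normDegree_nonneg {p : ℝ} (hp : 0 < p) (G : SimpleGraph (Fin n)) (i : Fin n) :
    0 ≤ normDegree p G i :=
  mul_nonneg (by positivity) (Finset.sum_nonneg fun j _ => edgeWeight_nonneg hp G i j)

theorem normDegree_eq (p : ℝ) (G : SimpleGraph (Fin n)) (i : Fin n) :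
    normDegree p G i = (1 / n) * ((1 / p) * G.degree i) := by
  have h := sum_edgeWeight_mul p G i fun _ => 1
  simp only [mul_one, Finset.sum_const, SimpleGraph.card_neighborFinset_eq_degree,
    nsmul_eq_mul] at h
  rw [normDegree, ← h]
  simp only [edgeWeight_comm p G i]

theorem walkStep_nonneg {p : ℝ} (hp : 0 < p) (G : SimpleGraph (Fin n)) (A : Finset (Fin n))
    {g : Fin n → ℝ} (hg : ∀ i, 0 ≤ g i) (j : Fin n) : 0 ≤ walkStep p G A g j :=
  mul_nonneg (by positivity)
    (Finset.sum_nonneg fun i _ => mul_nonneg (edgeWeight_nonneg hp G i j) (hg i))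

/-- Jensen's inequality for one step of a walk. -/
theorem walkStep_pow_le {p : ℝ} (hp : 0 < p) (G : SimpleGraph (Fin n)) (A : Finset (Fin n))
    {g : Fin n → ℝ} (hg : ∀ i, 0 ≤ g i) (j : Fin n) (a : ℕ) :
    walkStep p G A g j ^ (a + 1) ≤
      normDegree p G j ^ a * ((1 / n) * ∑ i, edgeWeight p G i j * g i ^ (a + 1)) := by
  have h1 : walkStep p G A g j ≤ (1 / n) * ((1 / p) * ∑ i ∈ G.neighborFinset j, g i) := by
    rw [← sum_edgeWeight_mul]
    refine mul_le_mul_of_nonneg_left ?_ (by positivity)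
    exact Finset.sum_le_sum_of_subset_of_nonneg (Finset.subset_univ A)
      fun i _ _ => mul_nonneg (edgeWeight_nonneg hp G i j) (hg i)
  refine (pow_le_pow_left₀ (walkStep_nonneg hp G A hg j) h1 _).trans ?_
  rw [sum_edgeWeight_mul p G j fun i => g i ^ (a + 1), normDegree_eq]
  have h2 := pow_sum_div_card_le_sum_pow (s := G.neighborFinset j) (f := g) (fun i _ => hg i) a
  rw [SimpleGraph.card_neighborFinset_eq_degree] at h2
  rcases Nat.eq_zero_or_pos (G.degree j) with hd | hd
  · have : G.neighborFinset j = ∅ := by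
      rw [← Finset.card_eq_zero, SimpleGraph.card_neighborFinset_eq_degree, hd]
    simp [this]
  · have hd' : (0 : ℝ) < (G.degree j : ℝ) := by exact_mod_cast hd
    rw [div_le_iff₀ (by positivity)] at h2
    calc (1 / n * (1 / p * ∑ i ∈ G.neighborFinset j, g i)) ^ (a + 1)
        = (1 / n * (1 / p)) ^ (a + 1) * (∑ i ∈ G.neighborFinset j, g i) ^ (a + 1) := by
          rw [← mul_pow]; ring
      _ ≤ (1 / n * (1 / p)) ^ (a + 1) *
          ((∑ i ∈ G.neighborFinset j, g i ^ (a + 1)) * (G.degree j : ℝ) ^ a) := by gcongr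
      _ = _ := by rw [mul_pow, mul_pow, mul_pow]; ring

/-- A step of a walk preserves boundedness of moments. -/
theorem walkStep_moment_le {p : ℝ} (hp : 0 < p) (G : SimpleGraph (Fin n))
    {D M : ℕ → ℝ} (hD : ∀ k, (1 / n : ℝ) * ∑ i, normDegree p G i ^ k ≤ D k)
    (A : Finset (Fin n)) {g : Fin n → ℝ} (hg : ∀ i, 0 ≤ g i)
    (hM : ∀ k, (1 / n : ℝ) * ∑ i, g i ^ k ≤ M k) (a : ℕ) :
    (1 / n : ℝ) * ∑ j, walkStep p G A g j ^ (a + 1) ≤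
      D (2 * a + 1) + (D 2 + M (4 * (a + 1))) := by
  have hd := normDegree_nonneg hp G
  have hw := edgeWeight_nonneg hp G
  calc (1 / n : ℝ) * ∑ j, walkStep p G A g j ^ (a + 1)
      ≤ (1 / n : ℝ) * ∑ j, ((1 / n) * ∑ i, (edgeWeight p G i j * normDegree p G j ^ (2 * a) +
          edgeWeight p G i j * g i ^ (2 * (a + 1)))) := by
        gcongr with j
        refine (walkStep_pow_le hp G A hg j a).trans ?_
        rw [mul_left_comm, Finset.mul_sum]
        gcongr with i
        rw [mul_left_comm, ← mul_add]
        refine mul_le_mul_of_nonneg_left ?_ (hw i j)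
        rw [pow_mul', pow_mul' (g i)]
        nlinarith [sq_nonneg (normDegree p G j ^ a - g i ^ (a + 1)),
          sq_nonneg (normDegree p G j ^ a), sq_nonneg (g i ^ (a + 1))]
    _ = (1 / n : ℝ) * ∑ j, normDegree p G j ^ (2 * a + 1) +
          (1 / n : ℝ) * ∑ i, normDegree p G i * g i ^ (2 * (a + 1)) := by
        simp only [Finset.sum_add_distrib, mul_add]
        congr 2
        · refine Finset.sum_congr rfl fun j _ => ?_
          rw [← Finset.sum_mul, pow_succ, normDegree]
          simp only [edgeWeight_comm p G _ j]
          ring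
        · rw [← Finset.mul_sum, Finset.sum_comm, Finset.mul_sum]
          refine Finset.sum_congr rfl fun j _ => ?_
          rw [← Finset.sum_mul, normDegree]
          ring
    _ ≤ D (2 * a + 1) + ((1 / n : ℝ) * ∑ i, (normDegree p G i ^ 2 + g i ^ (4 * (a + 1)))) := by
        gcongr with i
        · exact hD _
        · rw [show 4 * (a + 1) = 2 * (2 * (a + 1)) by ring, pow_mul' (g i) 2 (2 * (a + 1))]
          nlinarith [sq_nonneg (normDegree p G i - g i ^ (2 * (a + 1))),
            sq_nonneg (normDegree p G i), sq_nonneg (g i ^ (2 * (a + 1)))]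
    _ ≤ _ := by
        rw [Finset.sum_add_distrib, mul_add]
        linarith [hD 2, hM (4 * (a + 1))]

/-- Homomorphisms from a star count at least the corresponding power sum of the degrees. -/
theorem sum_degree_pow_le_homCount (G : SimpleGraph (Fin n)) (k : ℕ) :
    ∑ i, G.degree i ^ k ≤ homCount (SimpleGraph.starGraph (0 : Fin (k + 1))) G := by
  let f : (Σ i : Fin n, Fin k → G.neighborSet i) →
      (SimpleGraph.starGraph (0 : Fin (k + 1)) →g G) := fun x =>
    ⟨Fin.cons x.1 fun r => (x.2 r : Fin n), by
      intro a b
      refine Fin.cases ?_ (fun a => ?_) a <;> refine Fin.cases ?_ (fun b => ?_) b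
      · simp
      · intro _
        exact (x.2 b).2
      · intro _
        exact (x.2 a).2.symm
      · simp⟩
  have hf : Function.Injective f := by
    rintro ⟨i, u⟩ ⟨j, v⟩ h
    have h' : (Fin.cons i fun r => (u r : Fin n) : Fin (k + 1) → Fin n) =
        Fin.cons j fun r => (v r : Fin n) := congrArg DFunLike.coe h
    obtain ⟨rfl, h2⟩ := Fin.cons_inj.mp h'
    congr
    funext r
    exact Subtype.ext (congrFun h2 r)
  have : Finite (SimpleGraph.starGraph (0 : Fin (k + 1)) →g G) :=
    Finite.of_injective _ DFunLike.coe_injective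
  have := Nat.card_le_card_of_injective f hf
  rw [Nat.card_eq_fintype_card, Fintype.card_sigma] at this
  rw [homCount]
  simpa only [Fintype.card_fun, Fintype.card_fin, SimpleGraph.card_neighborSet_eq_degree] using this

theorem normDegree_moment_le {p : ℝ} (hn : 0 < n) (hp : 0 < p) (G : SimpleGraph (Fin n)) (k : ℕ) :
    (1 / n : ℝ) * ∑ i, normDegree p G i ^ k ≤
      tDen p (SimpleGraph.starGraph (0 : Fin (k + 1))) G := by
  have hn' : (0 : ℝ) < n := by exact_mod_cast hn
  have he : edgeCount (SimpleGraph.starGraph (0 : Fin (k + 1))) = k := by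
    have := (SimpleGraph.isTree_starGraph (0 : Fin (k + 1))).card_edgeFinset
    rw [Fintype.card_fin] at this
    rw [edgeCount, Nat.card_eq_fintype_card, ← SimpleGraph.edgeFinset_card]
    omega
  have h : (∑ i, (G.degree i : ℝ) ^ k) ≤
      homCount (SimpleGraph.starGraph (0 : Fin (k + 1))) G := by
    exact_mod_cast sum_degree_pow_le_homCount G k
  rw [tDen, he, Fintype.card_fin, Fintype.card_fin, le_div_iff₀ (by positivity)]
  refine le_trans (le_of_eq ?_) h
  simp only [normDegree_eq, mul_pow, ← Finset.mul_sum, one_div, inv_pow]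
  field_simp
  ring

end Discrete

section CutNorm

/-- A bounded measurable function is integrable on a set of finite measure. -/
theorem integrableOn_of_bounded {α : Type*} [MeasurableSpace α] {μ : Measure α} {f : α → ℝ}
    (hf : Measurable f) {B : ℝ} (hB : ∀ x, |f x| ≤ B) {s : Set α} (hs : μ s < ∞) :
    IntegrableOn f s μ :=
  Measure.integrableOn_of_bounded hs.ne hf.aestronglyMeasurable (ae_of_all _ hB)

theorem volume_lt_top_of_subset_Icc {S : Set ℝ} (hS : S ⊆ Icc 0 1) : volume S < ∞ :=
  (measure_mono hS).trans_lt (by simp)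

theorem volumeReal_le_one_of_subset_Icc {S : Set ℝ} (hS : S ⊆ Icc 0 1) : volume.real S ≤ 1 := by
  have := measureReal_mono (μ := volume) hS (by simp)
  simpa using this

theorem volume_prod_lt_top {S T : Set ℝ} (hS : S ⊆ Icc 0 1) (hT : T ⊆ Icc 0 1) :
    volume (S ×ˢ T) < ∞ := by
  rw [Measure.volume_eq_prod, Measure.prod_prod]
  exact ENNReal.mul_lt_top (volume_lt_top_of_subset_Icc hS) (volume_lt_top_of_subset_Icc hT)

variable {D : ℝ → ℝ → ℝ} {B : ℝ}

theorem abs_setIntegral_le_cutNorm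
    (hB : ∀ x y, |D x y| ≤ B) {S T : Set ℝ} (hS : MeasurableSet S) (hT : MeasurableSet T)
    (hS1 : S ⊆ Icc 0 1) (hT1 : T ⊆ Icc 0 1) : |∫ q in S ×ˢ T, D q.1 q.2| ≤ cutNorm D := by
  refine le_csSup ⟨B, ?_⟩ ⟨S, T, hS, hT, hS1, hT1, rfl⟩
  rintro r ⟨S, T, -, -, hS1, hT1, rfl⟩
  have hB0 : 0 ≤ B := (abs_nonneg _).trans (hB 0 0)
  have h := norm_setIntegral_le_of_norm_le_const (μ := volume) (f := fun q : ℝ × ℝ => D q.1 q.2)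
    (volume_prod_lt_top hS1 hT1) fun q _ => hB q.1 q.2
  rw [Measure.volume_eq_prod, measureReal_prod_prod] at h
  refine h.trans ?_
  have h1 := volumeReal_le_one_of_subset_Icc hS1
  have h2 := volumeReal_le_one_of_subset_Icc hT1
  exact mul_le_of_le_one_right hB0 (mul_le_one₀ h1 measureReal_nonneg h2)

theorem integrableOn_mul_right (hD : Measurable (Function.uncurry D))
    (hB : ∀ x y, |D x y| ≤ B) {S T : Set ℝ} (hS1 : S ⊆ Icc 0 1) (hT1 : T ⊆ Icc 0 1)
    {h : ℝ → ℝ} (hh : Measurable h) {H : ℝ} (h0 : ∀ y, 0 ≤ h y) (hH : ∀ y, h y ≤ H) :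
    Integrable (Function.uncurry fun x y => D x y * h y)
      ((volume.restrict S).prod (volume.restrict T)) := by
  rw [Measure.prod_restrict]
  refine integrableOn_of_bounded (B := B * H) (hD.mul (hh.comp measurable_snd)) (fun q => ?_)
    (volume_prod_lt_top hS1 hT1)
  change |D q.1 q.2 * h q.2| ≤ B * H
  rw [abs_mul, abs_of_nonneg (h0 _)]
  exact mul_le_mul (hB _ _) (hH _) (h0 _) ((abs_nonneg _).trans (hB 0 0))

theorem integral_integral_mul_le (hD : Measurable (Function.uncurry D))
    (hB : ∀ x y, |D x y| ≤ B) {δ : ℝ}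
    (hδ : ∀ S T : Set ℝ, MeasurableSet S → MeasurableSet T → S ⊆ Icc 0 1 → T ⊆ Icc 0 1 →
      ∫ q in S ×ˢ T, D q.1 q.2 ≤ δ)
    {S T : Set ℝ} (hS : MeasurableSet S) (hT : MeasurableSet T)
    (hS1 : S ⊆ Icc 0 1) (hT1 : T ⊆ Icc 0 1) {h : ℝ → ℝ} (hh : Measurable h) {H : ℝ}
    (h0 : ∀ y, 0 ≤ h y) (hH : ∀ y, h y ≤ H) :
    ∫ x in S, ∫ y in T, D x y * h y ≤ H * δ := by
  have hfin : IsFiniteMeasure (volume.restrict S) := ⟨by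
    simpa using volume_lt_top_of_subset_Icc hS1⟩
  have hH0 : 0 ≤ H := (h0 0).trans (hH 0)
  have hB0 : 0 ≤ B := (abs_nonneg _).trans (hB 0 0)
  rw [integral_integral_swap (integrableOn_mul_right hD hB hS1 hT1 hh h0 hH)]
  set Ψ : ℝ → ℝ := fun y => ∫ x in S, D x y
  have hΨm : Measurable Ψ := by
    have : StronglyMeasurable (Function.uncurry fun y x => D x y) :=
      (hD.comp measurable_swap).stronglyMeasurable
    exact this.integral_prod_right.measurable
  have hΨB : ∀ y, |Ψ y| ≤ B := fun y => by
    refine (norm_setIntegral_le_of_norm_le_const (f := fun x => D x y)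
      (volume_lt_top_of_subset_Icc hS1) fun x _ => hB x y).trans ?_
    exact mul_le_of_le_one_right hB0 (volumeReal_le_one_of_subset_Icc hS1)
  set T' : Set ℝ := T ∩ {y | 0 < Ψ y}
  have hpos : MeasurableSet {y | 0 < Ψ y} := measurableSet_lt measurable_const hΨm
  have hT'm : MeasurableSet T' := hT.inter hpos
  have hT'1 : T' ⊆ Icc 0 1 := inter_subset_left.trans hT1
  have hfinT := volume_lt_top_of_subset_Icc hT1
  have hind : IntegrableOn (fun y => H * {y | 0 < Ψ y}.indicator Ψ y) T :=
    ((integrableOn_of_bounded hΨm hΨB hfinT).indicator hpos).const_mul H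
  have hleft : IntegrableOn (fun y => Ψ y * h y) T :=
    integrableOn_of_bounded (B := B * H) (hΨm.mul hh) (fun y => by
      rw [Pi.mul_apply, abs_mul, abs_of_nonneg (h0 y)]
      exact mul_le_mul (hΨB y) (hH y) (h0 y) hB0) hfinT
  calc ∫ y in T, ∫ x in S, D x y * h y = ∫ y in T, Ψ y * h y :=
        integral_congr_ae (ae_of_all _ fun y => integral_mul_const (h y) fun x => D x y)
    _ ≤ ∫ y in T, H * {y | 0 < Ψ y}.indicator Ψ y := by
        refine setIntegral_mono hleft hind fun y => ?_
        by_cases hy : 0 < Ψ y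
        · rw [indicator_of_mem (show y ∈ {y | 0 < Ψ y} from hy), mul_comm]
          exact mul_le_mul_of_nonneg_right (hH y) hy.le
        · rw [indicator_of_notMem (show y ∉ {y | 0 < Ψ y} from hy), mul_zero]
          exact mul_nonpos_of_nonpos_of_nonneg (not_lt.mp hy) (h0 y)
    _ = H * ∫ y in T', Ψ y := by
        rw [integral_const_mul, setIntegral_indicator hpos]
    _ ≤ H * δ := by
        refine mul_le_mul_of_nonneg_left ?_ hH0
        refine le_trans (le_of_eq ?_) (hδ S T' hS hT'm hS1 hT'1)
        have hInt := integrableOn_mul_right hD hB hS1 hT'1 (h := fun _ => 1) measurable_const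
          (H := 1) (by simp) (by simp)
        simp only [mul_one] at hInt
        rw [Measure.volume_eq_prod, ← Measure.prod_restrict]
        exact (integral_prod_symm _ hInt).symm

theorem abs_integral_integral_mul_le (hD : Measurable (Function.uncurry D))
    (hB : ∀ x y, |D x y| ≤ B) {δ : ℝ} (hδ : cutNorm D ≤ δ)
    {S T : Set ℝ} (hS : MeasurableSet S) (hT : MeasurableSet T)
    (hS1 : S ⊆ Icc 0 1) (hT1 : T ⊆ Icc 0 1) {h : ℝ → ℝ} (hh : Measurable h) {H : ℝ}
    (h0 : ∀ y, 0 ≤ h y) (hH : ∀ y, h y ≤ H) :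
    |∫ x in S, ∫ y in T, D x y * h y| ≤ H * δ := by
  have hcut : ∀ S T : Set ℝ, MeasurableSet S → MeasurableSet T → S ⊆ Icc 0 1 → T ⊆ Icc 0 1 →
      |∫ q in S ×ˢ T, D q.1 q.2| ≤ δ := fun S T hS hT hS1 hT1 =>
    (abs_setIntegral_le_cutNorm hB hS hT hS1 hT1).trans hδ
  refine abs_le'.mpr ⟨integral_integral_mul_le hD hB (fun S T hS hT hS1 hT1 =>
    (le_abs_self _).trans (hcut S T hS hT hS1 hT1)) hS hT hS1 hT1 hh h0 hH, ?_⟩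
  have := integral_integral_mul_le (D := fun x y => -D x y) (B := B) (δ := δ) hD.neg
    (fun x y => by rw [abs_neg]; exact hB x y) (fun S T hS hT hS1 hT1 => by
      rw [integral_neg]
      exact (neg_le_abs _).trans (hcut S T hS hT hS1 hT1)) hS hT hS1 hT1 hh h0 hH
  simpa only [neg_mul, integral_neg] using this

end CutNorm

section KernelTail

/-- The density of walks `x, x₁, …, x_m` in `κ` with `x_i ∈ Y_i`, as a function of `x`. -/
noncomputable def kernelTail (κ : ℝ → ℝ → ℝ) : (m : ℕ) → (Fin m → Set ℝ) → ℝ → ℝ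
  | 0, _ => fun _ => 1
  | m + 1, Y => fun x => ∫ y in Y 0, κ x y * kernelTail κ m (Fin.tail Y) y

variable {κ : ℝ → ℝ → ℝ} {C : ℝ}

theorem measurable_kernelTail (hκ : IsKernelBdd κ C) :
    ∀ (m : ℕ) (Y : Fin m → Set ℝ), Measurable (kernelTail κ m Y)
  | 0, _ => measurable_const
  | m + 1, Y => by
    have : StronglyMeasurable
        (Function.uncurry fun x y => κ x y * kernelTail κ m (Fin.tail Y) y) :=
      (hκ.1.mul ((measurable_kernelTail hκ m (Fin.tail Y)).comp measurable_snd)).stronglyMeasurable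
    exact this.integral_prod_right.measurable

theorem kernelTail_nonneg (hκ : IsKernelBdd κ C) :
    ∀ (m : ℕ) (Y : Fin m → Set ℝ) (x : ℝ), 0 ≤ kernelTail κ m Y x
  | 0, _, _ => zero_le_one
  | m + 1, _, x =>
    integral_nonneg fun y => mul_nonneg (hκ.2.2 x y).1 (kernelTail_nonneg hκ m _ y)

theorem kernelTail_le (hκ : IsKernelBdd κ C) :
    ∀ (m : ℕ) (Y : Fin m → Set ℝ), (∀ i, Y i ⊆ Icc 0 1) → ∀ x, kernelTail κ m Y x ≤ C ^ m
  | 0, _, _, _ => (pow_zero C).ge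
  | m + 1, Y, hY, x => by
    have hC : 0 ≤ C := (hκ.2.2 0 0).1.trans (hκ.2.2 0 0).2
    have hb : ∀ y, ‖κ x y * kernelTail κ m (Fin.tail Y) y‖ ≤ C ^ (m + 1) := fun y => by
      rw [Real.norm_of_nonneg (mul_nonneg (hκ.2.2 x y).1 (kernelTail_nonneg hκ m _ y)), pow_succ']
      exact mul_le_mul (hκ.2.2 x y).2 (kernelTail_le hκ m _ (fun i => hY i.succ) y)
        (kernelTail_nonneg hκ m _ y) hC
    refine (le_abs_self _).trans ((norm_setIntegral_le_of_norm_le_const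
      (volume_lt_top_of_subset_Icc (hY 0)) fun y _ => hb y).trans ?_)
    exact mul_le_of_le_one_right (by positivity) (volumeReal_le_one_of_subset_Icc (hY 0))

theorem volume_pi_lt_top {m : ℕ} {Y : Fin m → Set ℝ} (hY : ∀ i, Y i ⊆ Icc 0 1) :
    volume (Set.univ.pi Y) < ∞ := by
  rw [volume_pi_pi]
  exact ENNReal.prod_lt_top fun i _ => volume_lt_top_of_subset_Icc (hY i)

theorem setIntegral_pi_mul_prod (hκ : IsKernelBdd κ C) :
    ∀ (m : ℕ) (Y : Fin (m + 1) → Set ℝ), (∀ i, MeasurableSet (Y i)) → (∀ i, Y i ⊆ Icc 0 1) →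
      ∀ (F : ℝ → ℝ), Measurable F → ∀ B : ℝ, (∀ x, |F x| ≤ B) →
      ∫ x in Set.univ.pi Y, F (x 0) * ∏ i : Fin m, κ (x i.castSucc) (x i.succ) =
        ∫ x in Y 0, F x * kernelTail κ m (Fin.tail Y) x
  | 0, Y, hYm, hY, F, hF, B, hB => by
    have e := (volume_preserving_funUnique (Fin 1) ℝ).symm
    have h := e.setIntegral_preimage_emb (MeasurableEquiv.measurableEmbedding _)
      (fun x => F (x 0)) (Set.univ.pi Y)
    have hpre : (MeasurableEquiv.funUnique (Fin 1) ℝ).symm ⁻¹' Set.univ.pi Y = Y 0 := by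
      ext x
      simp [Set.mem_pi]
    rw [hpre] at h
    simp only [kernelTail, Finset.univ_eq_empty, Finset.prod_empty, mul_one]
    exact h.symm
  | m + 1, Y, hYm, hY, F, hF, B, hB => by
    have hC : 0 ≤ C := (hκ.2.2 0 0).1.trans (hκ.2.2 0 0).2
    have hB0 : 0 ≤ B := (abs_nonneg _).trans (hB 0)
    have e := (volume_preserving_piFinSuccAbove (fun _ : Fin (m + 2) => ℝ) 0).symm
    rw [← e.setIntegral_preimage_emb (MeasurableEquiv.measurableEmbedding _)]
    have hpre : (MeasurableEquiv.piFinSuccAbove (fun _ : Fin (m + 2) => ℝ) 0).symm ⁻¹'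
        Set.univ.pi Y = Y 0 ×ˢ Set.univ.pi (Fin.tail Y) := by
      ext q
      simp [Set.mem_pi, Fin.forall_fin_succ, Fin.tail]
    let P : (Fin (m + 1) → ℝ) → ℝ := fun z => ∏ i : Fin m, κ (z i.castSucc) (z i.succ)
    have hP : Measurable P := Finset.measurable_prod _ fun i _ =>
      hκ.1.comp (f := fun z : Fin (m + 1) → ℝ => (z i.castSucc, z i.succ))
        ((measurable_pi_apply i.castSucc).prodMk (measurable_pi_apply i.succ))
    have hP0 : ∀ z, 0 ≤ P z := fun z => Finset.prod_nonneg fun i _ => (hκ.2.2 _ _).1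
    have hPC : ∀ z, P z ≤ C ^ m := fun z => by
      refine (Finset.prod_le_prod (fun i _ => (hκ.2.2 _ _).1) fun i _ => (hκ.2.2 _ _).2).trans ?_
      simp
    have hInt : IntegrableOn (fun q : ℝ × (Fin (m + 1) → ℝ) => F q.1 * (κ q.1 (q.2 0) * P q.2))
        (Y 0 ×ˢ Set.univ.pi (Fin.tail Y)) (volume.prod volume) := by
      refine integrableOn_of_bounded (B := B * (C * C ^ m)) ?_ (fun q => ?_) ?_
      · exact (hF.comp measurable_fst).mul ((hκ.1.comp (measurable_fst.prodMk
          ((measurable_pi_apply 0).comp measurable_snd))).mul (hP.comp measurable_snd))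
      · rw [abs_mul, abs_of_nonneg (mul_nonneg (hκ.2.2 _ _).1 (hP0 _))]
        exact mul_le_mul (hB _) (mul_le_mul (hκ.2.2 _ _).2 (hPC _) (hP0 _) hC)
          (mul_nonneg (hκ.2.2 _ _).1 (hP0 _)) hB0
      · rw [Measure.prod_prod]
        exact ENNReal.mul_lt_top (volume_lt_top_of_subset_Icc (hY 0))
          (volume_pi_lt_top fun i => hY i.succ)
    calc _ = ∫ q in Y 0 ×ˢ Set.univ.pi (Fin.tail Y), F q.1 * (κ q.1 (q.2 0) * P q.2)
            ∂(volume.prod volume) := by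
          rw [hpre]
          refine integral_congr_ae (ae_of_all _ fun q => ?_)
          simp only [Fin.prod_univ_succ (n := m)]
          rfl
      _ = ∫ x in Y 0, F x * kernelTail κ (m + 1) (Fin.tail Y) x := by
          rw [setIntegral_prod _ hInt]
          refine integral_congr_ae (ae_of_all _ fun x => ?_)
          simp only [integral_const_mul]
          congr 1
          exact setIntegral_pi_mul_prod hκ m (Fin.tail Y) (fun i => hYm i.succ)
            (fun i => hY i.succ) (κ x) (hκ.1.comp measurable_prodMk_left) C fun y => by
              rw [abs_of_nonneg (hκ.2.2 x y).1]
              exact (hκ.2.2 x y).2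

theorem kernelWalk_eq (hκ : IsKernelBdd κ C) {m : ℕ} (Y : Fin (m + 1) → Set ℝ)
    (hYm : ∀ i, MeasurableSet (Y i)) (hY : ∀ i, Y i ⊆ Icc 0 1) :
    kernelWalk κ Y = ∫ x in Y 0, kernelTail κ m (Fin.tail Y) x := by
  have := setIntegral_pi_mul_prod hκ m Y hYm hY (fun _ => 1) measurable_const 1 (by simp)
  simp only [one_mul] at this
  exact this

end KernelTail

section Cells

variable {n : ℕ}

/-- The subinterval of `[0,1]` corresponding to a vertex. -/
def cell (n : ℕ) (i : Fin n) : Set ℝ := Ioc ((i : ℝ) / n) (((i : ℝ) + 1) / n)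

theorem measurableSet_cell (i : Fin n) : MeasurableSet (cell n i) := measurableSet_Ioc

theorem cell_subset_Ioc (i : Fin n) : cell n i ⊆ Ioc 0 1 := by
  have hn : (0 : ℝ) < n := by exact_mod_cast i.pos
  refine Ioc_subset_Ioc (by positivity) ?_
  rw [div_le_one hn]
  exact_mod_cast i.isLt

theorem cell_subset_Icc (i : Fin n) : cell n i ⊆ Icc 0 1 :=
  (cell_subset_Ioc i).trans Ioc_subset_Icc_self

theorem volumeReal_cell (i : Fin n) : volume.real (cell n i) = 1 / n := by
  rw [cell, Real.volume_real_Ioc_of_le (by gcongr; linarith)]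
  ring

theorem idx_eq_of_mem_cell {i : Fin n} {x : ℝ} (hx : x ∈ cell n i) : idx n x = i := by
  have hn : (0 : ℝ) < n := by exact_mod_cast i.pos
  have h1 := (div_lt_iff₀ hn).mp hx.1
  have h2 := (le_div_iff₀ hn).mp hx.2
  have h : ⌈x * n⌉₊ = (i : ℕ) + 1 := by
    rw [Nat.ceil_eq_iff (by omega)]
    refine ⟨by simpa using h1, by push_cast; exact h2⟩
  rw [idx, h, Nat.add_sub_cancel]

theorem pairwise_disjoint_cell : Pairwise fun i j : Fin n => Disjoint (cell n i) (cell n j) :=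
  fun _ _ hij => Set.disjoint_left.mpr fun _ hi hj =>
    hij (Fin.ext ((idx_eq_of_mem_cell hi).symm.trans (idx_eq_of_mem_cell hj)))

theorem measurableSet_vtxSet (A : Finset (Fin n)) : MeasurableSet (vtxSet n A) :=
  Finset.measurableSet_biUnion _ fun i _ => measurableSet_cell i

theorem vtxSet_subset_Icc (A : Finset (Fin n)) : vtxSet n A ⊆ Icc 0 1 :=
  iUnion₂_subset fun i _ => cell_subset_Icc i

theorem setIntegral_vtxSet (A : Finset (Fin n)) {f : ℝ → ℝ}
    (hf : IntegrableOn f (vtxSet n A)) :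
    ∫ x in vtxSet n A, f x = ∑ i ∈ A, ∫ x in cell n i, f x :=
  integral_biUnion_finset A (fun i _ => measurableSet_cell i)
    (fun _ _ _ _ hij => pairwise_disjoint_cell hij)
    fun i hi => hf.mono_set (subset_iUnion₂ (s := fun i (_ : i ∈ A) => cell n i) i hi)

theorem graphKernel_of_mem_cell (p : ℝ) (G : SimpleGraph (Fin n)) {i j : Fin n} {x y : ℝ}
    (hx : x ∈ cell n i) (hy : y ∈ cell n j) : graphKernel p G x y = edgeWeight p G i j := by
  have h1 := idx_eq_of_mem_cell hx
  have h2 := idx_eq_of_mem_cell hy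
  have h : x ∈ Ioc (0 : ℝ) 1 ∧ y ∈ Ioc (0 : ℝ) 1 ∧ idx n x < n ∧ idx n y < n :=
    ⟨cell_subset_Ioc i hx, cell_subset_Ioc j hy, h1 ▸ i.isLt, h2 ▸ j.isLt⟩
  rw [graphKernel, dif_pos h]
  simp only [edgeWeight, h1, h2, Fin.eta]

theorem measurable_idx (n : ℕ) : Measurable (idx n) :=
  (measurable_of_countable fun k : ℕ => k - 1).comp
    (Nat.measurable_ceil.comp (measurable_id.mul_const _))

theorem measurable_graphKernel (p : ℝ) (G : SimpleGraph (Fin n)) :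
    Measurable (Function.uncurry (graphKernel p G)) := by
  let F : ℕ × ℕ → ℝ := fun k =>
    if h : k.1 < n ∧ k.2 < n then edgeWeight p G ⟨k.1, h.1⟩ ⟨k.2, h.2⟩ else 0
  have hF : Measurable fun q : ℝ × ℝ => F (idx n q.1, idx n q.2) :=
    (measurable_of_countable F).comp (((measurable_idx n).comp measurable_fst).prodMk
      ((measurable_idx n).comp measurable_snd))
  convert hF.indicator ((measurableSet_Ioc (a := (0 : ℝ)) (b := 1)).prod
    (measurableSet_Ioc (a := (0 : ℝ)) (b := 1))) using 1
  funext q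
  by_cases h : q.1 ∈ Ioc (0 : ℝ) 1 ∧ q.2 ∈ Ioc (0 : ℝ) 1
  · rw [indicator_of_mem (show q ∈ Ioc (0 : ℝ) 1 ×ˢ Ioc (0 : ℝ) 1 from h)]
    by_cases h' : idx n q.1 < n ∧ idx n q.2 < n
    · simp [Function.uncurry, graphKernel, F, h, h', edgeWeight]
    · simp only [Function.uncurry, graphKernel, F, dif_neg h']
      rw [dif_neg fun hh => h' hh.2.2]
  · rw [indicator_of_notMem (show q ∉ Ioc (0 : ℝ) 1 ×ˢ Ioc (0 : ℝ) 1 from h)]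
    exact dif_neg fun hh => h ⟨hh.1, hh.2.1⟩

theorem abs_graphKernel_le {p : ℝ} (hp : 0 < p) (G : SimpleGraph (Fin n)) (x y : ℝ) :
    |graphKernel p G x y| ≤ 1 / p := by
  have : 0 < 1 / p := by positivity
  unfold graphKernel
  split_ifs
  · exact (abs_of_pos this).le
  · simpa using this.le
  · simpa using this.le

end Cells

section Replacement

variable {n : ℕ} {p C H δ : ℝ} {κ : ℝ → ℝ → ℝ} {h : ℝ → ℝ}

theorem cell_integral_graphKernel (hp : 0 < p) (G : SimpleGraph (Fin n)) (B : Finset (Fin n))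
    (hh : Measurable h) (h0 : ∀ y, 0 ≤ h y) (hH : ∀ y, h y ≤ H) (i : Fin n) :
    ∫ x in cell n i, ∫ y in vtxSet n B, graphKernel p G x y * h y =
      (1 / n) * ∑ j ∈ B, edgeWeight p G i j * ∫ y in cell n j, h y := by
  have hinner : ∀ x ∈ cell n i, ∫ y in vtxSet n B, graphKernel p G x y * h y =
      ∑ j ∈ B, edgeWeight p G i j * ∫ y in cell n j, h y := fun x hx => by
    have hm : Measurable fun y => graphKernel p G x y * h y :=
      ((measurable_graphKernel p G).comp measurable_prodMk_left).mul hh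
    rw [setIntegral_vtxSet B (integrableOn_of_bounded (B := 1 / p * H) hm (fun y => ?_)
      (volume_lt_top_of_subset_Icc (vtxSet_subset_Icc B)))]
    · refine Finset.sum_congr rfl fun j _ => ?_
      rw [← integral_const_mul]
      refine setIntegral_congr_fun (measurableSet_cell j) fun y hy => ?_
      simp only [graphKernel_of_mem_cell p G hx hy]
    · rw [abs_mul, abs_of_nonneg (h0 y)]
      exact mul_le_mul (abs_graphKernel_le hp G x y) (hH y) (h0 y) (by positivity)
  rw [setIntegral_congr_fun (measurableSet_cell i) hinner, setIntegral_const, volumeReal_cell,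
    smul_eq_mul]

/-- The error of replacing the graph by the kernel in one step of a walk. -/
theorem abs_walkStep_sub_le (hp : 0 < p) (G : SimpleGraph (Fin n))
    (hκ : IsKernelBdd κ C) (hδ : cutNorm (fun x y => graphKernel p G x y - κ x y) ≤ δ)
    (A B : Finset (Fin n)) (hh : Measurable h) (h0 : ∀ y, 0 ≤ h y) (hH : ∀ y, h y ≤ H)
    {g : Fin n → ℝ} (hg : ∀ i, 0 ≤ g i) {K : ℝ} (hK : 0 < K) {D₂ M₂ M₄ : ℝ}
    (hD₂ : (1 / n : ℝ) * ∑ i, normDegree p G i ^ 2 ≤ D₂)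
    (hM₂ : (1 / n : ℝ) * ∑ i, g i ^ 2 ≤ M₂) (hM₄ : (1 / n : ℝ) * ∑ i, g i ^ 4 ≤ M₄) :
    |(∑ j ∈ B, walkStep p G A g j * ∫ y in cell n j, h y) -
        ∑ i ∈ A, g i * ∫ x in cell n i, ∫ y in vtxSet n B, κ x y * h y| ≤
      2 * K * H * δ + H / K * (M₄ + D₂ + C * M₂) := by
  have hC : 0 ≤ C := (hκ.2.2 0 0).1.trans (hκ.2.2 0 0).2
  have hH0 : 0 ≤ H := (h0 0).trans (hH 0)
  have hκB : ∀ x y, |κ x y| ≤ C := fun x y => by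
    rw [abs_of_nonneg (hκ.2.2 x y).1]; exact (hκ.2.2 x y).2
  have hWm := measurable_graphKernel p G
  have hB1 := vtxSet_subset_Icc B
  have hDm : Measurable (Function.uncurry fun x y => graphKernel p G x y - κ x y) :=
    hWm.sub hκ.1
  have hDB : ∀ x y, |graphKernel p G x y - κ x y| ≤ 1 / p + C := fun x y =>
    (abs_sub _ _).trans (add_le_add (abs_graphKernel_le hp G x y) (hκB x y))
  set Φ : Fin n → ℝ := fun i =>
    ∫ x in cell n i, ∫ y in vtxSet n B, (graphKernel p G x y - κ x y) * h y with hΦ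
  have hcell : ∀ j : Fin n, ∫ y in cell n j, h y ≤ H * (1 / n) := fun j => by
    have := norm_setIntegral_le_of_norm_le_const (μ := volume) (f := h) (C := H)
      (volume_lt_top_of_subset_Icc (cell_subset_Icc j))
      fun y _ => by rw [Real.norm_of_nonneg (h0 y)]; exact hH y
    rw [volumeReal_cell] at this
    exact (le_abs_self _).trans this
  have hsplit : ∀ i, Φ i = (1 / n) * ∑ j ∈ B, edgeWeight p G i j * (∫ y in cell n j, h y) -
      ∫ x in cell n i, ∫ y in vtxSet n B, κ x y * h y := fun i => by
    have hi1 := integrableOn_mul_right hWm (abs_graphKernel_le hp G) (cell_subset_Icc i) hB1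
      hh h0 hH
    have hi2 := integrableOn_mul_right hκ.1 hκB (cell_subset_Icc i) hB1 hh h0 hH
    rw [← cell_integral_graphKernel hp G B hh h0 hH i]
    simp only [hΦ, sub_mul]
    exact integral_integral_sub hi1 hi2
  have hsum : ∀ S : Finset (Fin n), |∑ i ∈ S, Φ i| ≤ H * δ := fun S => by
    rw [← setIntegral_vtxSet S]
    · exact abs_integral_integral_mul_le hDm hDB hδ (measurableSet_vtxSet S)
        (measurableSet_vtxSet B) (vtxSet_subset_Icc S) hB1 hh h0 hH
    · exact (integrableOn_mul_right hDm hDB (vtxSet_subset_Icc S) hB1 hh h0 hH).integral_prod_left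
  have habs : ∑ i ∈ A, |Φ i| ≤ 2 * (H * δ) := by
    rw [← Finset.sum_filter_add_sum_filter_not A fun i => 0 ≤ Φ i,
      Finset.sum_congr rfl fun i hi => abs_of_nonneg (Finset.mem_filter.mp hi).2,
      Finset.sum_congr (s₁ := A.filter fun i => ¬ 0 ≤ Φ i) rfl fun i hi =>
        abs_of_neg (not_le.mp (Finset.mem_filter.mp hi).2), Finset.sum_neg_distrib]
    have e1 := (le_abs_self _).trans (hsum (A.filter fun i => 0 ≤ Φ i))
    have e2 := (neg_le_abs _).trans (hsum (A.filter fun i => ¬ 0 ≤ Φ i))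
    linarith
  have hone : ∀ i, |Φ i| ≤ H * (1 / n) * (normDegree p G i + C) := fun i => by
    have hw := edgeWeight_nonneg hp G i
    have e1 : |(1 / n : ℝ) * ∑ j ∈ B, edgeWeight p G i j * (∫ y in cell n j, h y)| ≤
        H * (1 / n) * normDegree p G i := by
      rw [abs_of_nonneg (mul_nonneg (by positivity) (Finset.sum_nonneg fun j _ =>
        mul_nonneg (hw j) (integral_nonneg h0)))]
      calc (1 / n : ℝ) * ∑ j ∈ B, edgeWeight p G i j * (∫ y in cell n j, h y)
          ≤ (1 / n : ℝ) * ∑ j, edgeWeight p G i j * (H * (1 / n)) := by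
            gcongr
            refine (Finset.sum_le_sum fun j _ =>
              mul_le_mul_of_nonneg_left (hcell j) (hw j)).trans ?_
            exact Finset.sum_le_sum_of_subset_of_nonneg (Finset.subset_univ B)
              fun j _ _ => mul_nonneg (hw j) (by positivity)
        _ = _ := by rw [← Finset.sum_mul, normDegree]; ring
    have e2 : |∫ x in cell n i, ∫ y in vtxSet n B, κ x y * h y| ≤ C * H * (1 / n) := by
      rw [← volumeReal_cell i, ← Real.norm_eq_abs]
      refine norm_setIntegral_le_of_norm_le_const
        (volume_lt_top_of_subset_Icc (cell_subset_Icc i)) fun x _ => ?_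
      refine (norm_setIntegral_le_of_norm_le_const (C := C * H)
        (volume_lt_top_of_subset_Icc hB1) fun y _ => ?_).trans
        (mul_le_of_le_one_right (by positivity) (volumeReal_le_one_of_subset_Icc hB1))
      rw [norm_mul, Real.norm_of_nonneg (h0 y)]
      exact mul_le_mul (hκB x y) (hH y) (h0 y) hC
    rw [hsplit]
    refine (abs_sub _ _).trans ((add_le_add e1 e2).trans (le_of_eq ?_))
    ring
  have hmain : (∑ j ∈ B, walkStep p G A g j * ∫ y in cell n j, h y) -
      ∑ i ∈ A, g i * ∫ x in cell n i, ∫ y in vtxSet n B, κ x y * h y = ∑ i ∈ A, g i * Φ i := by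
    simp only [hsplit, mul_sub, Finset.sum_sub_distrib, walkStep, Finset.mul_sum, Finset.sum_mul]
    rw [Finset.sum_comm]
    refine congrArg₂ _ (Finset.sum_congr rfl fun i _ => Finset.sum_congr rfl fun j _ => ?_) rfl
    ring
  rw [hmain]
  calc |∑ i ∈ A, g i * Φ i| ≤ ∑ i ∈ A, g i * |Φ i| := by
        refine (Finset.abs_sum_le_sum_abs _ _).trans (le_of_eq ?_)
        exact Finset.sum_congr rfl fun i _ => by rw [abs_mul, abs_of_nonneg (hg i)]
    _ ≤ ∑ i ∈ A, (K * |Φ i| + H / K * ((1 / n) * (g i ^ 4 + normDegree p G i ^ 2 +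
          C * g i ^ 2))) := by
        refine Finset.sum_le_sum fun i _ => ?_
        have e1 : g i ≤ K + g i ^ 2 / K := by
          rw [← sub_le_iff_le_add', le_div_iff₀ hK]
          nlinarith [sq_nonneg (g i - K)]
        calc g i * |Φ i| ≤ (K + g i ^ 2 / K) * |Φ i| := by gcongr
          _ = K * |Φ i| + g i ^ 2 / K * |Φ i| := by ring
          _ ≤ K * |Φ i| + g i ^ 2 / K * (H * (1 / n) * (normDegree p G i + C)) := by
              gcongr
              exact hone i
          _ = K * |Φ i| + H / K * ((1 / n) * (g i ^ 2 * normDegree p G i + C * g i ^ 2)) := by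
              ring
          _ ≤ _ := by
              gcongr
              nlinarith [sq_nonneg (g i ^ 2 - normDegree p G i), sq_nonneg (g i ^ 2),
                sq_nonneg (normDegree p G i)]
    _ ≤ K * (2 * (H * δ)) + H / K * ((1 / n) * ∑ i, (g i ^ 4 + normDegree p G i ^ 2 +
          C * g i ^ 2)) := by
        rw [Finset.sum_add_distrib, ← Finset.mul_sum, ← Finset.mul_sum, ← Finset.mul_sum]
        gcongr
        exact Finset.subset_univ A
    _ ≤ _ := by
        rw [Finset.sum_add_distrib, Finset.sum_add_distrib, ← Finset.mul_sum]
        have : (1 / n : ℝ) * (∑ i, g i ^ 4 + ∑ i, normDegree p G i ^ 2 + C * ∑ i, g i ^ 2) ≤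
            M₄ + D₂ + C * M₂ := by
          have := mul_le_mul_of_nonneg_left hM₂ hC
          nlinarith
        have := mul_le_mul_of_nonneg_left this (div_nonneg hH0 hK.le)
        linarith

end Replacement

/-- Weighted walk counts are approximated by their kernel analogues, for weights with bounded
moments. -/
theorem exists_walkSum_approx {C : ℝ} (hC : 0 < C) {p : ℕ → ℝ} (hp : ∀ n, 0 < p n)
    (G : ∀ n, SimpleGraph (Fin n)) {D : ℕ → ℝ}
    (hD : ∀ n : ℕ, 0 < n → ∀ k, (1 / n : ℝ) * ∑ i, normDegree (p n) (G n) i ^ k ≤ D k) (ℓ : ℕ) :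
    ∀ (M : ℕ → ℝ) (ε : ℝ), 0 < ε → ∃ δ : ℝ, 0 < δ ∧
      ∀ (n : ℕ), 0 < n → ∀ κ : ℝ → ℝ → ℝ, IsKernelBdd κ C →
        cutNorm (fun x y => graphKernel (p n) (G n) x y - κ x y) ≤ δ →
        ∀ (X : Fin (ℓ + 1) → Finset (Fin n)) (g : Fin n → ℝ), (∀ i, 0 ≤ g i) →
          (∀ k, (1 / n : ℝ) * ∑ i, g i ^ k ≤ M k) →
          |walkSum (G n) X g - (n : ℝ) ^ (ℓ + 1) * p n ^ ℓ *
            ∑ i ∈ X 0, g i *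
              ∫ x in cell n i, kernelTail κ ℓ (Fin.tail fun i => vtxSet n (X i)) x| ≤
            ε * ((n : ℝ) ^ (ℓ + 1) * p n ^ ℓ) := by
  induction ℓ with
  | zero =>
    intro M ε hε
    refine ⟨1, one_pos, fun n hn κ _ _ X g _ _ => ?_⟩
    have hn' : (n : ℝ) ≠ 0 := by positivity
    simp only [walkSum_zero, kernelTail, setIntegral_const, volumeReal_cell, smul_eq_mul, mul_one,
      ← Finset.sum_mul]
    have : (n : ℝ) ^ (0 + 1) * p n ^ 0 * ((∑ i ∈ X 0, g i) * (1 / n)) = ∑ i ∈ X 0, g i := by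
      field_simp
      ring
    rw [this, sub_self, abs_zero]
    positivity
  | succ ℓ ih =>
    intro M ε hε
    obtain ⟨δ', hδ', hstep⟩ := ih
      (fun | 0 => 1 | a + 1 => D (2 * a + 1) + (D 2 + M (4 * (a + 1)))) (ε / 2) (by positivity)
    set H : ℝ := C ^ ℓ
    have hH : 0 < H := by positivity
    set Q : ℝ := |M 4 + D 2 + C * M 2| + 1
    have hQ : 0 < Q := by positivity
    set K : ℝ := 4 * H * Q / ε
    have hK : 0 < K := by positivity
    refine ⟨min δ' (ε / (8 * K * H)), by positivity, fun n hn κ hκ hcut X g hg hM => ?_⟩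
    have hp' := hp n
    have hn' : (0 : ℝ) < n := by exact_mod_cast hn
    set Y : Fin (ℓ + 2) → Set ℝ := fun i => vtxSet n (X i)
    have hY : ∀ i, Y i ⊆ Icc 0 1 := fun i => vtxSet_subset_Icc _
    set R : ℝ → ℝ := kernelTail κ ℓ (Fin.tail (Fin.tail Y))
    have h1 := hstep n hn κ hκ (hcut.trans (min_le_left _ _)) (Fin.tail X)
      (walkStep (p n) (G n) (X 0) g) (walkStep_nonneg hp' (G n) (X 0) hg) (by
        rintro (_ | a)
        · simp only [pow_zero, Finset.sum_const, Finset.card_univ, Fintype.card_fin,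
            nsmul_eq_mul, mul_one]
          rw [one_div_mul_cancel hn'.ne']
        · exact walkStep_moment_le hp' (G n) (hD n hn) (X 0) hg hM a)
    have h2 := abs_walkStep_sub_le hp' (G n) hκ (hcut.trans (min_le_right _ _)) (X 0) (X 1)
      (h := R) (H := H) (measurable_kernelTail hκ _ _) (kernelTail_nonneg hκ _ _)
      (kernelTail_le hκ _ _ fun i => hY i.succ.succ) hg hK (hD n hn 2) (hM 2) (hM 4)
    have h3 : 2 * K * H * (ε / (8 * K * H)) + H / K * (M 4 + D 2 + C * M 2) ≤ ε / 2 := by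
      have e1 : 2 * K * H * (ε / (8 * K * H)) = ε / 4 := by field_simp; norm_num
      have e2 : H / K * (M 4 + D 2 + C * M 2) ≤ H / K * Q := by
        gcongr
        exact (le_abs_self _).trans (le_add_of_nonneg_right zero_le_one)
      have e3 : H / K * Q = ε / 4 := by simp only [K]; field_simp
      linarith
    rw [walkSum_succ hn hp']
    set N : ℝ := (n : ℝ) ^ (ℓ + 1) * p n ^ ℓ with hN
    have hN0 : 0 < N := by positivity
    have hNs : (n : ℝ) ^ (ℓ + 1 + 1) * p n ^ (ℓ + 1) = n * p n * N := by rw [hN]; ring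
    rw [hNs, mul_assoc (n * p n : ℝ), ← mul_sub, abs_mul, abs_of_pos (by positivity),
      mul_left_comm ε]
    refine mul_le_mul_of_nonneg_left ?_ (by positivity)
    have h4 := mul_le_mul_of_nonneg_left (h2.trans h3) hN0.le
    rw [← abs_of_pos hN0, ← abs_mul, abs_of_pos hN0, mul_sub] at h4
    refine (abs_sub_le _ _ _).trans ((add_le_add h1 h4).trans (le_of_eq ?_))
    ring

/-- Walk-counting lemma for sequences with bounded tree counts. -/
theorem walk_counting_lemma (C : ℝ) (hC : 0 < C) (p : ℕ → ℝ)
    (hp : ∀ n, p n ∈ Ioc (0:ℝ) 1)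
    (hpn : Tendsto (fun n : ℕ => (n:ℝ) * p n) atTop atTop)
    (G : ∀ n, SimpleGraph (Fin n))
    (htree : ∀ (m : ℕ) (T : SimpleGraph (Fin m)), T.IsTree →
      ∃ M : ℝ, ∀ n, tDen (p n) T (G n) ≤ M) :
    ∀ ε : ℝ, 0 < ε → ∀ ℓ : ℕ, 1 ≤ ℓ → ∃ δ : ℝ, 0 < δ ∧
      ∀ (n : ℕ) (κ : ℝ → ℝ → ℝ), IsKernelBdd κ C →
        cutNorm (fun x y => graphKernel (p n) (G n) x y - κ x y) ≤ δ →
        ∀ X : Fin (ℓ + 1) → Finset (Fin n),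
          |(walkCount (G n) X : ℝ) -
              (n:ℝ) ^ (ℓ + 1) * p n ^ ℓ * kernelWalk κ (fun i => vtxSet n (X i))|
            ≤ ε * (n:ℝ) ^ (ℓ + 1) * p n ^ ℓ := by
  intro ε hε ℓ _
  have hp0 : ∀ n, 0 < p n := fun n => (hp n).1
  choose D hD using fun k : ℕ =>
    htree (k + 1) (SimpleGraph.starGraph 0) (SimpleGraph.isTree_starGraph 0)
  obtain ⟨δ, hδ, happrox⟩ := exists_walkSum_approx hC hp0 G
    (fun n hn k => (normDegree_moment_le hn (hp0 n) (G n) k).trans (hD k n)) ℓ (fun _ => 1) ε hε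
  refine ⟨δ, hδ, fun n κ hκ hcut X => ?_⟩
  rcases Nat.eq_zero_or_pos n with rfl | hn
  · simp [walkCount]
  · have hn' : (n : ℝ) ≠ 0 := by positivity
    have h := happrox n hn κ hκ hcut X (fun _ => 1) (fun _ => zero_le_one) fun k => by
      simp [hn']
    simp only [one_mul] at h
    rw [← walkCount_eq_walkSum, ← setIntegral_vtxSet, ← kernelWalk_eq hκ (fun i => vtxSet n (X i))
      (fun i => measurableSet_vtxSet _) (fun i => vtxSet_subset_Icc _)] at h
    · rwa [mul_assoc ε]
    · refine integrableOn_of_bounded (measurable_kernelTail hκ _ _) (B := C ^ ℓ) (fun x => ?_)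
        (volume_lt_top_of_subset_Icc (vtxSet_subset_Icc _))
      rw [abs_of_nonneg (kernelTail_nonneg hκ _ _ x)]
      exact kernelTail_le hκ _ _ (fun i => vtxSet_subset_Icc _) x
end
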